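/- For every set C of 8 distinct real numbers, the number of Möbius-equivalence classes (under real Möbius changes of the independent variable) of rational functions over ℝ that are generic of degree 5 with critical value set C equals 406. -/

import Mathlib

open Polynomial

/-- The Wronskian `W = p′q − pq′` of a rational function `f = p/q` (with `p = f.num`,
`q = f.denom` coprime). -/
noncomputable def wronskian' (f : RatFunc ℝ) : Polynomial ℝ :=
  derivative f.num * f.denom - f.num * derivative f.denom

/-- Two rational functions over `ℝ` are Möbius-equivalent if `g = p(L)/q(L)` in `ℝ(X)`
for some `L = (aX+b)/(cX+d)` with real `a, b, c, d`, `ad − bc ≠ 0`, where `f = p/q`. -/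
def MobiusEquiv (f g : RatFunc ℝ) : Prop :=
  ∃ a b c d : ℝ, a * d - b * c ≠ 0 ∧
    ∃ L : RatFunc ℝ,
      L = algebraMap (Polynomial ℝ) (RatFunc ℝ) (C a * X + C b) /
          algebraMap (Polynomial ℝ) (RatFunc ℝ) (C c * X + C d) ∧
      g = Polynomial.aeval L f.num / Polynomial.aeval L f.denom

/-- A rational function `f = p/q` over `ℝ` is generic of degree `n` with critical value
set `C` (a set of `2n−2` distinct reals): `deg f = n`, `deg W = 2n−2`, `q(z) ≠ 0` for
every complex root `z` of `W`, and `{p(z)/q(z) : z ∈ ℂ, W(z) = 0} = C`. -/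
def GenericDegR (n : ℕ) (Cv : Set ℝ) (f : RatFunc ℝ) : Prop :=
  max f.num.natDegree f.denom.natDegree = n ∧
  (wronskian' f).natDegree = 2 * n - 2 ∧
  (∀ z : ℂ, Polynomial.aeval z (wronskian' f) = 0 → Polynomial.aeval z f.denom ≠ 0) ∧
  {w : ℂ | ∃ z : ℂ, Polynomial.aeval z (wronskian' f) = 0 ∧
      Polynomial.aeval z f.num / Polynomial.aeval z f.denom = w} = Complex.ofReal '' Cv

namespace MFun

open Topology Filter

section

/-- The complexification of a real polynomial. -/
noncomputable abbrev cx (p : ℝ[X]) : ℂ[X] := p.map (algebraMap ℝ ℂ)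

/-- The fibre polynomial `p - y q`. -/
noncomputable def fam (p q : ℝ[X]) (y : ℂ) : ℂ[X] := cx p - C y * cx q

/-- The Wronskian `p' q - p q'`. -/
noncomputable def wr (p q : ℝ[X]) : ℝ[X] := derivative p * q - p * derivative q

/-- A normalized generic pair: `p` is monic of degree 5, `q` has degree 4 and positive leading
coefficient, the Wronskian has the eight distinct real roots `x j`, where `p / q` takes the
value `c j`. -/
structure Good (p q : ℝ[X]) (c x : Fin 8 → ℝ) : Prop where
  monic : p.Monic
  degp : p.natDegree = 5
  degq : q.natDegree = 4
  pos : 0 < q.leadingCoeff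
  wr_eq : wr p q = C q.leadingCoeff * ∏ j, (X - C (x j))
  xinj : Function.Injective x
  val : ∀ j, p.eval (x j) = c j * q.eval (x j)

theorem eval_fam (p q : ℝ[X]) (y r : ℂ) :
    (fam p q y).eval r = (cx p).eval r - y * (cx q).eval r := by simp [fam]

theorem derivative_fam (p q : ℝ[X]) (y : ℂ) :
    derivative (fam p q y) = fam (derivative p) (derivative q) y := by
  simp [fam, derivative_map]

theorem fam_conj (p q : ℝ[X]) (y r : ℂ) :
    (fam p q (starRingEnd ℂ y)).eval (starRingEnd ℂ r) = starRingEnd ℂ ((fam p q y).eval r) := by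
  have h (p : ℝ[X]) : (cx p).eval (starRingEnd ℂ r) = starRingEnd ℂ ((cx p).eval r) := by
    rw [eval_map_algebraMap, eval_map_algebraMap, ← Complex.conjAe_coe,
      ← aeval_algHom_apply]
  simp [eval_fam, h]

theorem cx_eval_ofReal (p : ℝ[X]) (r : ℝ) : (cx p).eval (r : ℂ) = ((p.eval r : ℝ) : ℂ) := by
  rw [eval_map_algebraMap]; exact (Polynomial.aeval_algebraMap_apply_eq_algebraMap_eval r p)

variable {p q : ℝ[X]} {c x : Fin 8 → ℝ}

/-- A monic polynomial of degree 5 and a polynomial of smaller degree. -/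
structure Pre (p q : ℝ[X]) : Prop where
  monic : p.Monic
  degp : p.natDegree = 5
  degq : q.natDegree ≤ 4

namespace Pre

theorem fam_monic (h : Pre p q) (y : ℂ) : (fam p q y).Monic := by
  refine (h.monic.map _).sub_of_left ?_
  have h5 : (cx p).degree = 5 := by
    rw [degree_map, degree_eq_natDegree h.monic.ne_zero, h.degp]; rfl
  rw [h5]
  have h4 : (C y * cx q).natDegree ≤ 4 := (natDegree_C_mul_le _ _).trans (by
    rw [natDegree_map]; exact h.degq)
  exact degree_le_natDegree.trans_lt (by exact_mod_cast Nat.lt_succ_of_le h4)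

theorem fam_natDegree (h : Pre p q) (y : ℂ) : (fam p q y).natDegree = 5 := by
  have h5 : (cx p).natDegree = 5 := by rw [natDegree_map, h.degp]
  rw [fam, natDegree_sub_eq_left_of_natDegree_lt, h5]
  rw [h5]
  refine (natDegree_C_mul_le _ _).trans_lt ?_
  rw [natDegree_map]; exact Nat.lt_succ_of_le h.degq

theorem norm_root_le (h : Pre p q) {B : ℝ} (hB : 0 ≤ B) (hp : ∀ i < 5, |p.coeff i| ≤ B)
    (hq : ∀ i < 5, |q.coeff i| ≤ B) {y r : ℂ} (hr : (fam p q y).eval r = 0) :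
    ‖r‖ ≤ 1 + B * (1 + ‖y‖) := by
  have h1 : ‖r‖ ≤ (cauchyBound (fam p q y) : ℝ) :=
    NNReal.coe_le_coe.2 (IsRoot.norm_lt_cauchyBound (h.fam_monic y).ne_zero (a := r) hr).le
  refine h1.trans ?_
  have h2 : ‖(fam p q y).leadingCoeff‖₊ = 1 := by rw [(h.fam_monic y).leadingCoeff, nnnorm_one]
  rw [cauchyBound, h2, div_one, h.fam_natDegree, add_comm]
  rw [NNReal.coe_add, NNReal.coe_one]
  gcongr
  have h0 : 0 ≤ B * (1 + ‖y‖) := by positivity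
  have : (Finset.range 5).sup (fun i => ‖(fam p q y).coeff i‖₊) ≤ (B * (1 + ‖y‖)).toNNReal := by
    refine Finset.sup_le fun i hi => ?_
    rw [← NNReal.coe_le_coe]
    rw [Real.coe_toNNReal _ h0]
    simp only [coe_nnnorm, fam, coeff_sub, coeff_C_mul, coeff_map]
    refine (norm_sub_le _ _).trans ?_
    rw [norm_mul, mul_add, mul_one]
    have e1 := hp i (Finset.mem_range.1 hi)
    have e2 := hq i (Finset.mem_range.1 hi)
    simp only [Complex.coe_algebraMap, Complex.norm_real, Real.norm_eq_abs]
    nlinarith [norm_nonneg y]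
  exact (NNReal.coe_le_coe.2 this).trans (Real.coe_toNNReal _ h0).le

theorem exists_norm_root_le (h : Pre p q) : ∃ B : ℝ, 0 ≤ B ∧ ∀ y r : ℂ, (fam p q y).eval r = 0 →
    ‖r‖ ≤ 1 + B * (1 + ‖y‖) := by
  refine ⟨∑ i ∈ Finset.range 5, (|p.coeff i| + |q.coeff i|), by positivity, fun y r hr =>
    h.norm_root_le (by positivity) (fun i hi => ?_) (fun i hi => ?_) hr⟩
  · refine le_trans ?_ (Finset.single_le_sum (fun i _ => by positivity) (Finset.mem_range.2 hi))
    simp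
  · refine le_trans ?_ (Finset.single_le_sum (fun i _ => by positivity) (Finset.mem_range.2 hi))
    simp

end Pre

namespace Good

theorem pre (h : Good p q c x) : Pre p q := ⟨h.monic, h.degp, h.degq.le⟩

theorem fam_monic (h : Good p q c x) (y : ℂ) : (fam p q y).Monic := h.pre.fam_monic y

theorem fam_natDegree (h : Good p q c x) (y : ℂ) : (fam p q y).natDegree = 5 :=
  h.pre.fam_natDegree y

theorem q_ne_zero (h : Good p q c x) : q ≠ 0 := by
  rintro rfl; simpa using h.degq

theorem cx_wr_root (h : Good p q c x) {r : ℂ}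
    (hr : (cx (derivative p)).eval r * (cx q).eval r -
      (cx p).eval r * (cx (derivative q)).eval r = 0) : ∃ j, r = x j := by
  have h1 : (cx (wr p q)).eval r = 0 := by simpa [wr] using hr
  rw [h.wr_eq] at h1
  have h2 : (q.leadingCoeff : ℂ) ≠ 0 := by exact_mod_cast h.pos.ne'
  simp only [cx, Polynomial.map_mul, Polynomial.map_prod, map_C, eval_mul, eval_C,
    Polynomial.map_sub, map_X, eval_prod, eval_sub, eval_X, mul_eq_zero, Finset.prod_eq_zero_iff] at h1
  rcases h1 with h1 | ⟨j, -, hj⟩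
  · exact absurd h1 h2
  · exact ⟨j, sub_eq_zero.1 hj⟩

theorem wr_eval (h : Good p q c x) (j : Fin 8) : (wr p q).eval (x j) = 0 := by
  rw [h.wr_eq, eval_mul, eval_prod, Finset.prod_eq_zero (Finset.mem_univ j), mul_zero]
  simp

theorem wr_deriv_eval_ne (h : Good p q c x) (j : Fin 8) :
    (derivative (wr p q)).eval (x j) ≠ 0 := by
  rw [h.wr_eq, ← Finset.mul_prod_erase _ _ (Finset.mem_univ j)]
  simp only [derivative_mul, derivative_C, zero_mul, derivative_sub, derivative_X, sub_zero,
    one_mul, eval_mul, eval_add, eval_C, eval_sub, eval_X, sub_self, zero_add, add_zero]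
  refine mul_ne_zero h.pos.ne' ?_
  rw [eval_prod, Finset.prod_ne_zero_iff]
  intro i hi
  simp only [eval_sub, eval_X, eval_C]
  exact sub_ne_zero.2 fun e => (Finset.ne_of_mem_erase hi) (h.xinj e).symm

theorem derivative_wr (p q : ℝ[X]) :
    derivative (wr p q) = derivative (derivative p) * q - p * derivative (derivative q) := by
  simp only [wr, derivative_sub, derivative_mul]; ring

theorem not_both_zero (h : Good p q c x) (r : ℂ) (hp : (cx p).eval r = 0)
    (hq : (cx q).eval r = 0) : False := by
  obtain ⟨j, rfl⟩ := h.cx_wr_root (r := r) (by rw [hp, hq]; ring)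
  rw [cx_eval_ofReal, Complex.ofReal_eq_zero] at hp hq
  apply h.wr_deriv_eval_ne j
  rw [derivative_wr]; simp [hp, hq]

theorem q_eval_ne (h : Good p q c x) (j : Fin 8) : q.eval (x j) ≠ 0 := fun hq =>
  h.not_both_zero (x j) (by rw [cx_eval_ofReal, h.val, hq]; simp) (by rw [cx_eval_ofReal, hq]; simp)

theorem q_ne_of_fam (h : Good p q c x) {y r : ℂ} (hr : (fam p q y).eval r = 0) :
    (cx q).eval r ≠ 0 := fun hq => by
  rw [eval_fam, hq, mul_zero, sub_zero] at hr
  exact h.not_both_zero r hr hq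

theorem crit (h : Good p q c x) {y r : ℂ} (hr : (fam p q y).eval r = 0)
    (hr' : (derivative (fam p q y)).eval r = 0) : ∃ j, r = x j ∧ y = c j := by
  have hq := h.q_ne_of_fam hr
  rw [derivative_fam, eval_fam] at hr'
  rw [eval_fam] at hr
  obtain ⟨j, rfl⟩ := h.cx_wr_root (r := r) (by
    rw [sub_eq_zero.1 hr, sub_eq_zero.1 hr']; ring)
  refine ⟨j, rfl, ?_⟩
  rw [cx_eval_ofReal, cx_eval_ofReal, h.val] at hr
  rw [cx_eval_ofReal] at hq
  push_cast at hr
  rw [← sub_mul, mul_eq_zero, or_iff_left hq, sub_eq_zero] at hr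
  exact hr.symm

theorem fam_val (h : Good p q c x) (j : Fin 8) : (fam p q (c j)).eval (x j : ℂ) = 0 := by
  rw [eval_fam, cx_eval_ofReal, cx_eval_ofReal, h.val]; push_cast; ring

theorem fam_deriv2_val (h : Good p q c x) (j : Fin 8) :
    (derivative (derivative (fam p q (c j)))).eval (x j : ℂ) ≠ 0 := by
  rw [derivative_fam, derivative_fam, eval_fam, cx_eval_ofReal, cx_eval_ofReal]
  intro h0
  apply h.wr_deriv_eval_ne j
  rw [derivative_wr]
  have : (derivative (derivative p)).eval (x j) =
      c j * (derivative (derivative q)).eval (x j) := by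
    have := sub_eq_zero.1 h0; exact_mod_cast this
  simp only [eval_sub, eval_mul, this, h.val]; ring

end Good

theorem prod_X_sub_C_eval_derivative {n : ℕ} (X : Fin n → ℂ) (i : Fin n) :
    (derivative (∏ j, (Polynomial.X - C (X j)))).eval (X i) =
      ∏ j ∈ Finset.univ.erase i, (X i - X j) := by
  rw [← Finset.mul_prod_erase _ _ (Finset.mem_univ i)]
  simp [derivative_mul, eval_prod]

theorem eq_prod_of_roots {f : ℂ[X]} {n : ℕ} (hf : f.Monic) (hn : f.natDegree = n) {R : Fin n → ℂ}
    (hR : Function.Injective R) (h : ∀ i, f.eval (R i) = 0) :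
    f = ∏ i, (Polynomial.X - C (R i)) := by
  have hm : (∏ i, (Polynomial.X - C (R i))).Monic := monic_prod_of_monic _ _ fun i _ => monic_X_sub_C _
  have hd : ∏ i, (Polynomial.X - C (R i)) ∣ f := by
    refine Finset.prod_dvd_of_coprime ?_ fun i _ => dvd_iff_isRoot.2 (h i)
    exact fun i _ j _ hij => pairwise_coprime_X_sub_C hR hij
  refine (eq_of_monic_of_dvd_of_natDegree_le hm hf hd ?_)
  rw [hn, natDegree_prod_of_monic _ _ fun i _ => monic_X_sub_C _]
  simp

end

section

variable {p q : ℝ[X]} {c x : Fin 8 → ℝ}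

theorem isCompact_preimage (h : Good p q c x) {K : Set ℂ} (hK : IsCompact K) :
    IsCompact {r : ℂ | ∃ y ∈ K, (fam p q y).eval r = 0} := by
  obtain ⟨B, hB, hb⟩ := h.pre.exists_norm_root_le
  obtain ⟨M, hM⟩ := hK.isBounded.exists_norm_le
  have hM' : ∀ y ∈ K, ‖y‖ ≤ |M| := fun y hy => (hM y hy).trans (le_abs_self M)
  have hc : IsCompact ((K ×ˢ Metric.closedBall (0 : ℂ) (1 + B * (1 + |M|))) ∩
      {z : ℂ × ℂ | (fam p q z.1).eval z.2 = 0}) := by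
    refine (hK.prod (isCompact_closedBall _ _)).inter_right (isClosed_eq ?_ continuous_const)
    simp only [eval_fam]
    fun_prop
  convert hc.image continuous_snd
  ext r
  constructor
  · rintro ⟨y, hy, hr⟩
    refine ⟨(y, r), ⟨⟨hy, ?_⟩, hr⟩, rfl⟩
    rw [mem_closedBall_zero_iff]
    refine (hb y r hr).trans ?_
    gcongr; exact hM' y hy
  · rintro ⟨⟨y, r⟩, ⟨⟨hy, -⟩, hr⟩, rfl⟩
    exact ⟨y, hy, hr⟩

/-- The rational function `p / q` as a map on the complement of its poles. -/
noncomputable def quo (p q : ℝ[X]) (r : {r : ℂ // (cx q).eval r ≠ 0}) : ℂ :=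
  (cx p).eval r.1 / (cx q).eval r.1

theorem quo_eq_iff (r : {r : ℂ // (cx q).eval r ≠ 0}) (y : ℂ) :
    quo p q r = y ↔ (fam p q y).eval r.1 = 0 := by
  rw [quo, div_eq_iff r.2, eval_fam, sub_eq_zero]

theorem continuous_quo : Continuous (quo p q) := by
  unfold quo
  exact Continuous.div (by fun_prop) (by fun_prop) fun r => r.2

theorem isClosedMap_quo (h : Good p q c x) : IsClosedMap (quo p q) := by
  apply IsProperMap.isClosedMap
  rw [isProperMap_iff_isCompact_preimage]
  refine ⟨continuous_quo, fun K hK => ?_⟩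
  rw [Subtype.isCompact_iff]
  convert isCompact_preimage h hK
  ext r
  constructor
  · rintro ⟨s, hs, rfl⟩
    exact ⟨_, hs, (quo_eq_iff s _).1 rfl⟩
  · rintro ⟨y, hy, hr⟩
    exact ⟨⟨r, h.q_ne_of_fam hr⟩, by rwa [Set.mem_preimage, (quo_eq_iff _ _).2 hr], rfl⟩

theorem isCoveringMapOn_quo (h : Good p q c x) :
    IsCoveringMapOn (quo p q) {y | ∀ j, y ≠ c j} := by
  have ho : IsOpen {r : ℂ | (cx q).eval r ≠ 0} :=
    isOpen_ne_fun (by fun_prop) continuous_const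
  refine (isClosedMap_quo h).isCoveringMapOn_of_isLocalHomeomorphOn (fun y hy => ?_) ?_
  · have : (Subtype.val '' (quo p q ⁻¹' {y})).Finite := by
      refine ((fam p q y).roots.toFinset.finite_toSet).subset ?_
      rintro _ ⟨r, hr, rfl⟩
      simpa [(h.fam_monic y).ne_zero] using (quo_eq_iff r y).1 hr
    exact this.of_finite_image Subtype.val_injective.injOn
  · have h1 : IsLocalHomeomorphOn (fun r : ℂ => (cx p).eval r / (cx q).eval r)
        {r | (cx q).eval r ≠ 0 ∧ (cx (wr p q)).eval r ≠ 0} := by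
      intro r hr
      have hd := ((cx p).hasStrictDerivAt r).div ((cx q).hasStrictDerivAt r) hr.1
      have hne : ((derivative (cx p)).eval r * (cx q).eval r -
          (cx p).eval r * (derivative (cx q)).eval r) / (cx q).eval r ^ 2 ≠ 0 := by
        refine div_ne_zero ?_ (pow_ne_zero _ hr.1)
        have := hr.2
        simpa [wr, derivative_map] using this
      exact ⟨_, (hd.hasStrictFDerivAt_equiv hne).mem_toOpenPartialHomeomorph_source, by
        ext; rfl⟩
    have h2 := h1.comp (f := (Subtype.val : {r : ℂ // (cx q).eval r ≠ 0} → ℂ))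
      (s := quo p q ⁻¹' {y | ∀ j, y ≠ c j})
      ((ho.isOpenEmbedding_subtypeVal.isLocalHomeomorph).isLocalHomeomorphOn) ?_
    · exact h2
    · intro r hr
      refine ⟨r.2, fun hw => ?_⟩
      obtain ⟨j, hj⟩ := h.cx_wr_root (r := r.1) (by simpa [wr] using hw)
      refine hr j ?_
      rw [quo_eq_iff, hj]
      exact h.fam_val j

theorem fam_roots_nodup (h : Good p q c x) {y : ℂ} (hy : ∀ j, y ≠ c j) :
    (fam p q y).roots.Nodup := by
  rw [Multiset.nodup_iff_count_le_one]
  intro r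
  by_contra! hr
  rw [count_roots, one_lt_rootMultiplicity_iff_isRoot (h.fam_monic y).ne_zero] at hr
  obtain ⟨j, -, hj⟩ := h.crit hr.1 hr.2
  exact hy j hj

/-- Continuous parametrization of the roots of the fibre polynomials over the open upper half
plane. -/
theorem exists_sheets_upper (h : Good p q c x) :
    ∃ X : Fin 5 → ℂ → ℂ, (∀ i, ContinuousOn (X i) {y | 0 < y.im}) ∧
      ∀ y : ℂ, 0 < y.im → fam p q y = ∏ i, (Polynomial.X - C (X i y)) := by
  have hreg : ∀ y : ℂ, 0 < y.im → ∀ j, y ≠ c j := by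
    rintro y hy j rfl; simp at hy
  have hI := fam_roots_nodup h (hreg Complex.I (by simp))
  have hcard : (fam p q Complex.I).roots.toFinset.card = 5 := by
    rw [Multiset.toFinset_card_of_nodup hI, splits_iff_card_roots.1 (IsAlgClosed.splits _),
      h.fam_natDegree]
  let e := (Finset.equivFinOfCardEq hcard).symm
  have he : ∀ i, (fam p q Complex.I).eval (e i : ℂ) = 0 := fun i => by
    have := (e i).2
    rw [Multiset.mem_toFinset, mem_roots (h.fam_monic _).ne_zero] at this
    exact this
  have hlift : ∀ i, ∃ F : C(UpperHalfPlane, {r : ℂ // (cx q).eval r ≠ 0}),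
      (F UpperHalfPlane.I).1 = e i ∧ ∀ y, quo p q (F y) = y := by
    intro i
    obtain ⟨F, ⟨hF1, hF2⟩, -⟩ := (isCoveringMapOn_quo h).existsUnique_continuousMap_lifts
      ⟨fun y : UpperHalfPlane => (y : ℂ), UpperHalfPlane.continuous_coe⟩
      (a₀ := UpperHalfPlane.I) (e₀ := ⟨e i, h.q_ne_of_fam (he i)⟩)
      ((quo_eq_iff _ _).2 (he i)) (fun y => hreg _ y.im_pos)
    exact ⟨F, by rw [hF1], fun y => congrFun hF2 y⟩
  choose F hF1 hF2 using hlift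
  have hinj : ∀ y, Function.Injective fun i => F i y := by
    intro y i j hij
    have := (isCoveringMapOn_quo h).existsUnique_continuousMap_lifts
      ⟨fun y : UpperHalfPlane => (y : ℂ), UpperHalfPlane.continuous_coe⟩
      (a₀ := y) (e₀ := F i y) (hF2 i y) (fun y => hreg _ y.im_pos)
    have h1 := this.unique ⟨rfl, funext (hF2 i)⟩ ⟨hij.symm, funext (hF2 j)⟩
    have h2 : e i = e j := Subtype.ext (by rw [← hF1, ← hF1, h1])
    exact e.injective h2
  refine ⟨fun i y => F i (UpperHalfPlane.ofComplex y), fun i => ?_, fun y hy => ?_⟩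
  · refine ContinuousOn.comp (t := Set.univ) (f := UpperHalfPlane.ofComplex)
      (g := fun z => ((F i z : {r : ℂ // (cx q).eval r ≠ 0}) : ℂ))
      (by fun_prop) ?_ (Set.mapsTo_univ _ _)
    intro y hy
    exact (UpperHalfPlane.contMDiffAt_ofComplex (n := 0) hy).continuousAt.continuousWithinAt
  · have hroot : ∀ i, (fam p q y).IsRoot (F i (UpperHalfPlane.ofComplex y)) := fun i => by
      have := (quo_eq_iff _ _).1 (hF2 i (UpperHalfPlane.ofComplex y))
      have hy' : ((UpperHalfPlane.ofComplex y : UpperHalfPlane) : ℂ) = y := by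
        rw [UpperHalfPlane.ofComplex_apply_of_im_pos hy]
      rwa [hy'] at this
    exact eq_prod_of_roots (h.fam_monic y) (h.fam_natDegree y)
      (fun i j hij => hinj _ (Subtype.ext hij)) hroot

end

section

variable {p q : ℝ[X]} {c x : Fin 8 → ℝ}

/-- A continuous function that accumulates only at a finite set along a filter with a basis of
preconnected sets converges. -/
theorem exists_tendsto_of_finite {α : Type*} [TopologicalSpace α] {l : Filter α} [l.NeBot]
    (hl : ∀ S ∈ l, ∃ K ∈ l, K ⊆ S ∧ IsPreconnected K) {g : α → ℂ} {S₀ : Set α} (hS₀ : S₀ ∈ l)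
    (hg : ContinuousOn g S₀) {Z : Set ℂ} (hZ : Z.Finite)
    (h : ∀ ε > 0, ∀ᶠ y in l, ∃ z ∈ Z, dist (g y) z < ε) : ∃ z ∈ Z, Tendsto g l (𝓝 z) := by
  obtain ⟨δ, hδ, hsep⟩ : ∃ δ > 0, ∀ z ∈ Z, ∀ w ∈ Z, z ≠ w → 2 * δ ≤ dist z w := by
    obtain ⟨C, hC, h⟩ := Set.einfsep_pos.1 hZ.einfsep_pos
    rcases eq_or_ne C ⊤ with rfl | hC'
    · exact ⟨1, one_pos, fun z hz w hw hzw => absurd (h z hz w hw hzw) (by simp [edist_ne_top])⟩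
    · refine ⟨C.toReal / 2, half_pos (ENNReal.toReal_pos hC.ne' hC'), fun z hz w hw hzw => ?_⟩
      rw [dist_edist]
      have := ENNReal.toReal_mono (edist_ne_top z w) (h z hz w hw hzw)
      linarith
  obtain ⟨K, hK, hKS, hKc⟩ := hl _ (inter_mem hS₀ (h δ hδ))
  obtain ⟨y₀, hy₀⟩ := nonempty_of_mem hK
  obtain ⟨z₀, hz₀, hd₀⟩ := (hKS hy₀).2
  have hsub : g '' K ⊆ Metric.ball z₀ δ := by
    refine (hKc.image g (hg.mono fun y hy => (hKS hy).1)).subset_left_of_subset_union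
      (v := ⋃ z ∈ Z \ {z₀}, Metric.ball z δ) Metric.isOpen_ball
      (isOpen_biUnion fun _ _ => Metric.isOpen_ball) ?_ ?_ ⟨g y₀, ⟨y₀, hy₀, rfl⟩, hd₀⟩
    · rw [Set.disjoint_iUnion₂_right]
      intro z hz
      exact Metric.ball_disjoint_ball (by linarith [hsep z₀ hz₀ z hz.1 (Ne.symm hz.2)])
    · rintro _ ⟨y, hy, rfl⟩
      obtain ⟨z, hz, hd⟩ := (hKS hy).2
      by_cases e : z = z₀
      · subst e; exact Or.inl hd
      · exact Or.inr (Set.mem_biUnion ⟨hz, e⟩ hd)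
  refine ⟨z₀, hz₀, Metric.tendsto_nhds.2 fun ε hε => ?_⟩
  filter_upwards [hK, h (min ε δ) (lt_min hε hδ)] with y hy ⟨z, hz, hd⟩
  by_cases e : z = z₀
  · subst e; exact hd.trans_le (min_le_left _ _)
  · have h1 := hsub ⟨y, hy, rfl⟩
    rw [Metric.mem_ball] at h1
    have h2 := hsep z hz z₀ hz₀ e
    have h3 := dist_triangle_left z z₀ (g y)
    linarith [min_le_right ε δ]

theorem exists_root_near {f : ℂ[X]} (hf : f.Monic) {r : ℂ} {ε : ℝ} (hε : 0 ≤ ε)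
    (h : ‖f.eval r‖ < ε ^ f.natDegree) : ∃ z, f.eval z = 0 ∧ dist r z < ε := by
  by_contra! hc
  have hs := IsAlgClosed.splits f
  have h1 : f.eval r = (f.roots.map fun z => r - z).prod := by
    conv_lhs => rw [hs.eq_prod_roots_of_monic hf]
    rw [eval_multiset_prod, Multiset.map_map]
    simp
  rw [h1, ← splits_iff_card_roots.1 hs] at h
  have key : ∀ s : Multiset ℂ, (∀ z ∈ s, ε ≤ dist r z) →
      ε ^ s.card ≤ ‖(s.map fun z => r - z).prod‖ := by
    intro s
    induction s using Multiset.induction with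
    | empty => simp
    | cons a s ih =>
      intro hs
      rw [Multiset.card_cons, Multiset.map_cons, Multiset.prod_cons, norm_mul, pow_succ']
      have h1 := hs a (Multiset.mem_cons_self a s)
      rw [dist_eq_norm] at h1
      exact mul_le_mul h1 (ih fun z hz => hs z (Multiset.mem_cons_of_mem hz)) (by positivity)
        (norm_nonneg _)
  exact (key _ fun z hz => hc z ((mem_roots hf.ne_zero).1 hz)).not_gt h

/-- Continuous parametrization of the roots of the fibre polynomials over the closed upper half
plane. -/
structure Sheets (p q : ℝ[X]) (X : Fin 5 → ℂ → ℂ) : Prop where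
  cont : ∀ i, ContinuousOn (X i) {y | 0 ≤ y.im}
  fac : ∀ y : ℂ, 0 ≤ y.im → fam p q y = ∏ i, (Polynomial.X - C (X i y))

theorem fam_sub_eval (p q : ℝ[X]) (y s r : ℂ) :
    (fam p q s).eval r = (fam p q y).eval r + (y - s) * (cx q).eval r := by
  simp only [eval_fam]; ring

theorem eventually_root_near (h : Pre p q) (s : ℂ) {ε : ℝ} (hε : 0 < ε) :
    ∀ᶠ y in 𝓝 s, ∀ r, (fam p q y).eval r = 0 → ∃ z, (fam p q s).eval z = 0 ∧ dist r z < ε := by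
  obtain ⟨B, hB, hb⟩ := h.exists_norm_root_le
  obtain ⟨M, hM⟩ := (isCompact_closedBall (0 : ℂ) (1 + B * (1 + (‖s‖ + 1)))).exists_bound_of_continuousOn
    (f := fun r => (cx q).eval r) (by fun_prop)
  have h1 : Tendsto (fun y : ℂ => ‖y - s‖ * |M|) (𝓝 s) (𝓝 (‖s - s‖ * |M|)) :=
    ((continuous_id.sub continuous_const).norm.mul continuous_const).tendsto s
  rw [sub_self, norm_zero, zero_mul] at h1
  filter_upwards [h1.eventually (gt_mem_nhds (pow_pos hε 5)), Metric.ball_mem_nhds s one_pos]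
    with y hy hy1 r hr
  refine exists_root_near (h.fam_monic s) hε.le ?_
  rw [h.fam_natDegree, fam_sub_eval p q y s r, hr, zero_add, norm_mul]
  refine lt_of_le_of_lt ?_ hy
  have h2 : ‖y‖ ≤ ‖s‖ + 1 := by
    have := norm_le_norm_add_norm_sub' y s
    rw [mem_ball_iff_norm] at hy1
    linarith
  have h3 : ‖(cx q).eval r‖ ≤ M := hM r (by
    rw [mem_closedBall_zero_iff]
    refine (hb y r hr).trans ?_
    gcongr)
  gcongr
  exact h3.trans (le_abs_self M)

theorem Good.exists_sheets (h : Good p q c x) : ∃ X, Sheets p q X := by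
  obtain ⟨X, hX, hf⟩ := exists_sheets_upper h
  set U : Set ℂ := {y | 0 < y.im} with hU
  have hcl : {y : ℂ | 0 ≤ y.im} = closure U := (Complex.closure_setOfPred_lt_im 0).symm
  have hUo : IsOpen U := isOpen_lt continuous_const Complex.continuous_im
  have hlim : ∀ i, ∀ s ∈ closure U, ∃ z, Tendsto (X i) (𝓝[U] s) (𝓝 z) := by
    intro i s hs
    have hne : (𝓝[U] s).NeBot := mem_closure_iff_nhdsWithin_neBot.1 hs
    suffices ∃ z ∈ {z | (fam p q s).eval z = 0}, Tendsto (X i) (𝓝[U] s) (𝓝 z) from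
      this.imp fun z hz => hz.2
    refine exists_tendsto_of_finite (fun S hS => ?_) self_mem_nhdsWithin (hX i) ?_ ?_
    · obtain ⟨ε, hε, hb⟩ := Metric.mem_nhdsWithin_iff.1 hS
      refine ⟨Metric.ball s ε ∩ U, inter_mem (mem_nhdsWithin_of_mem_nhds (Metric.ball_mem_nhds s hε)) self_mem_nhdsWithin, hb, ?_⟩
      exact ((convex_ball s ε).inter (convex_halfSpace_im_gt 0)).isPreconnected
    · refine ((fam p q s).roots.toFinset.finite_toSet).subset fun z hz => ?_
      simpa [(h.fam_monic s).ne_zero] using hz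
    · intro ε hε
      filter_upwards [nhdsWithin_le_nhds (eventually_root_near h.pre s hε), self_mem_nhdsWithin]
        with y hy hyU
      refine hy _ ?_
      rw [hf y hyU, eval_prod, Finset.prod_eq_zero (Finset.mem_univ i)]
      simp
  refine ⟨fun i => extendFrom U (X i), fun i => ?_, fun y hy => ?_⟩
  · rw [hcl]
    exact continuousOn_extendFrom subset_rfl (hlim i)
  · have hy' : y ∈ closure U := hcl ▸ hy
    have hne : (𝓝[U] y).NeBot := mem_closure_iff_nhdsWithin_neBot.1 hy'
    refine Polynomial.funext fun r => ?_
    have h1 : Tendsto (fun y => (fam p q y).eval r) (𝓝[U] y) (𝓝 ((fam p q y).eval r)) := by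
      simp only [eval_fam]
      exact (Continuous.tendsto (by fun_prop) y).mono_left nhdsWithin_le_nhds
    have h2 : Tendsto (fun y => ∏ i, (r - X i y)) (𝓝[U] y)
        (𝓝 (∏ i, (r - extendFrom U (X i) y))) :=
      tendsto_finsetProd _ fun i _ => tendsto_const_nhds.sub
        (tendsto_extendFrom (hlim i y hy'))
    rw [eval_prod]
    simp only [eval_sub, eval_X, eval_C]
    refine tendsto_nhds_unique h1 (h2.congr' ?_)
    filter_upwards [self_mem_nhdsWithin] with z hz
    rw [hf z hz, eval_prod]; simp

end

section

variable {p q : ℝ[X]} {c x : Fin 8 → ℝ} {X : Fin 5 → ℂ → ℂ}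

theorem eq_of_isPreconnected {α ι : Type*} [TopologicalSpace α] [Finite ι] {K : Set α}
    (hK : IsPreconnected K) {g : α → ℂ} {f : ι → α → ℂ} (hg : ContinuousOn g K)
    (hf : ∀ i, ContinuousOn (f i) K) (hinj : ∀ y ∈ K, Function.Injective fun i => f i y)
    (h : ∀ y ∈ K, ∃ i, g y = f i y) {y₀ : α} (hy₀ : y₀ ∈ K) {i : ι} (hi : g y₀ = f i y₀)
    {y : α} (hy : y ∈ K) : g y = f i y := by
  have := Fintype.ofFinite ι
  classical
  have : PreconnectedSpace K := isPreconnected_iff_preconnectedSpace.1 hK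
  have hg' := continuousOn_iff_continuous_domRestrict.1 hg
  have hf' := fun i => continuousOn_iff_continuous_domRestrict.1 (hf i)
  let A : Set K := {y | K.domRestrict g y = K.domRestrict (f i) y}
  let B : Set K := ⋃ j ∈ {j | j ≠ i}, {y | K.domRestrict g y = K.domRestrict (f j) y}
  have hA : IsClosed A := isClosed_eq hg' (hf' i)
  have hB : IsClosed B := (Set.toFinite _).isClosed_biUnion fun j _ => isClosed_eq hg' (hf' j)
  have hAB : A = Bᶜ := by
    ext ⟨y, hy⟩
    simp only [A, B, Set.mem_compl_iff, Set.mem_iUnion, Set.mem_ofPred_eq,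
      not_exists]
    constructor
    · intro h1 j hj h2
      exact hj (hinj y hy (h2.symm.trans h1))
    · intro h1
      obtain ⟨j, hj⟩ := h y hy
      by_cases e : j = i
      · rwa [e] at hj
      · exact absurd hj (h1 j e)
  have hA' : IsClopen A := ⟨hA, hAB ▸ hB.isOpen_compl⟩
  have := hA'.eq_univ ⟨⟨y₀, hy₀⟩, hi⟩
  exact (Set.eq_univ_iff_forall.1 this) ⟨y, hy⟩

/-- The real numbers exceeding exactly the first `k` of the values `c j`. -/
def gap (c : Fin 8 → ℝ) (k : ℕ) : Set ℝ :=
  {y | (∀ j : Fin 8, j.val < k → c j < y) ∧ ∀ j : Fin 8, k ≤ j.val → y < c j}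

theorem ne_of_mem_gap {k : ℕ} {y : ℝ} (hy : y ∈ gap c k) (j : Fin 8) : y ≠ c j := by
  rcases lt_or_ge j.val k with h | h
  · exact (hy.1 j h).ne'
  · exact (hy.2 j h).ne

theorem ne_of_mem_gap' {k : ℕ} {y : ℝ} (hy : y ∈ gap c k) (j : Fin 8) : (y : ℂ) ≠ c j := by
  exact_mod_cast ne_of_mem_gap hy j

theorem isPreconnected_gap (c : Fin 8 → ℝ) (k : ℕ) : IsPreconnected (gap c k) := by
  refine Set.OrdConnected.isPreconnected ⟨fun a ha b hb z hz => ⟨fun j hj => ?_, fun j hj => ?_⟩⟩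
  · exact (ha.1 j hj).trans_le hz.1
  · exact hz.2.trans_lt (hb.2 j hj)

theorem eventually_mem_gap_left (hc : StrictMono c) (k : Fin 8) :
    ∀ᶠ y in 𝓝[<] (c k), y ∈ gap c k := by
  have h : ∀ j : Fin 8, ∀ᶠ y in 𝓝 (c k), j.val < k → c j < y := fun j => by
    by_cases hj : j < k
    · filter_upwards [lt_mem_nhds (hc hj)] with y hy _ using hy
    · exact Eventually.of_forall fun y h => absurd h hj
  filter_upwards [nhdsWithin_le_nhds (eventually_all.2 h), self_mem_nhdsWithin] with y h1 h2
  exact ⟨h1, fun j hj => lt_of_lt_of_le h2 (hc.monotone hj)⟩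

theorem eventually_mem_gap_right (hc : StrictMono c) (k : Fin 8) :
    ∀ᶠ y in 𝓝[>] (c k), y ∈ gap c (k + 1) := by
  have h : ∀ j : Fin 8, ∀ᶠ y in 𝓝 (c k), k.val + 1 ≤ j → y < c j := fun j => by
    by_cases hj : k < j
    · filter_upwards [gt_mem_nhds (hc hj)] with y hy _ using hy
    · exact Eventually.of_forall fun y h => absurd h hj
  filter_upwards [nhdsWithin_le_nhds (eventually_all.2 h), self_mem_nhdsWithin] with y h1 h2
  exact ⟨fun j hj => lt_of_le_of_lt (hc.monotone (Nat.lt_succ_iff.1 hj)) h2, h1⟩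

theorem gap_nonempty (hc : StrictMono c) {k : ℕ} (hk : k ≤ 8) : (gap c k).Nonempty := by
  rcases hk.eq_or_lt with rfl | hk
  · exact (eventually_mem_gap_right hc 7).exists
  · exact (eventually_mem_gap_left hc ⟨k, hk⟩).exists

theorem exists_gap (hc : StrictMono c) (y : ℝ) : (∃ j, y = c j) ∨ ∃ k ≤ 8, y ∈ gap c k := by
  by_cases h : ∃ j, y = c j
  · exact Or.inl h
  right
  push Not at h
  have key : ∀ n ≤ 8, (∃ k ≤ n, y ∈ gap c k) ∨ ∀ j : Fin 8, j.val < n → c j < y := by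
    intro n
    induction n with
    | zero => intro _; right; intro j hj; omega
    | succ n ih =>
      intro hn
      rcases ih (by omega) with ⟨k, hk, hy⟩ | h1
      · exact Or.inl ⟨k, by omega, hy⟩
      rcases lt_or_gt_of_ne (h ⟨n, hn⟩) with h2 | h2
      · exact Or.inl ⟨n, by omega, h1, fun j hj => h2.trans_le (hc.monotone hj)⟩
      · right
        intro j hj
        rcases (Nat.lt_succ_iff.1 hj).eq_or_lt with e | e
        · have : j = ⟨n, hn⟩ := Fin.ext e
          rwa [this]
        · exact h1 j e
  rcases key 8 le_rfl with h1 | h1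
  · exact h1
  · exact ⟨8, le_rfl, h1, fun j hj => by omega⟩

theorem im_ofReal_nonneg (y : ℝ) : (y : ℂ) ∈ {y : ℂ | 0 ≤ y.im} := by simp

theorem ne_of_im_pos {y : ℂ} (hy : 0 < y.im) (j : Fin 8) : y ≠ c j := by
  rintro rfl; simp at hy

namespace Sheets

theorem root (hs : Sheets p q X) {y : ℂ} (hy : 0 ≤ y.im) (i : Fin 5) :
    (fam p q y).eval (X i y) = 0 := by
  rw [hs.fac y hy, eval_prod, Finset.prod_eq_zero (Finset.mem_univ i)]
  simp

theorem exists_eq (hs : Sheets p q X) {y r : ℂ} (hy : 0 ≤ y.im) (hr : (fam p q y).eval r = 0) :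
    ∃ i, r = X i y := by
  rw [hs.fac y hy, eval_prod, Finset.prod_eq_zero_iff] at hr
  obtain ⟨i, -, hi⟩ := hr
  exact ⟨i, by simpa [sub_eq_zero] using hi⟩

theorem roots_eq (hs : Sheets p q X) {y : ℂ} (hy : 0 ≤ y.im) :
    (fam p q y).roots = Finset.univ.val.map fun i => X i y := by
  rw [hs.fac y hy]
  have := roots_multiset_prod_X_sub_C (Finset.univ.val.map fun i => X i y)
  rwa [Multiset.map_map] at this

theorem injective (h : Good p q c x) (hs : Sheets p q X) {y : ℂ} (hy : 0 ≤ y.im)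
    (hc : ∀ j, y ≠ c j) : Function.Injective fun i => X i y := by
  have := fam_roots_nodup h hc
  rw [hs.roots_eq hy] at this
  intro i j hij
  exact Multiset.inj_on_of_nodup_map this i (Finset.mem_univ_val i) j (Finset.mem_univ_val j) hij

theorem exists_conj (hs : Sheets p q X) (y : ℝ) (i : Fin 5) :
    ∃ j, starRingEnd ℂ (X i y) = X j y := by
  refine hs.exists_eq (im_ofReal_nonneg y) ?_
  have := fam_conj p q y (X i y)
  rw [hs.root (im_ofReal_nonneg y), Complex.conj_ofReal, map_zero] at this
  exact this

theorem continuousOn_ofReal (hs : Sheets p q X) (i : Fin 5) : Continuous fun y : ℝ => X i y :=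
  (hs.cont i).comp_continuous Complex.continuous_ofReal im_ofReal_nonneg

theorem exists_perm (h : Good p q c x) (hc : StrictMono c) (hs : Sheets p q X) {k : ℕ}
    (hk : k ≤ 8) : ∃ σ : Equiv.Perm (Fin 5), ∀ y ∈ gap c k, ∀ i,
      starRingEnd ℂ (X i y) = X (σ i) y := by
  obtain ⟨y₀, hy₀⟩ := gap_nonempty hc hk
  choose σ hσ using hs.exists_conj y₀
  have hinj : Function.Injective σ := fun i j hij => by
    refine injective h hs (im_ofReal_nonneg y₀) (ne_of_mem_gap' hy₀) ?_
    refine (starRingEnd ℂ).injective ?_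
    rw [hσ, hσ, hij]
  refine ⟨Equiv.ofBijective σ (Finite.injective_iff_bijective.1 hinj), fun y hy i => ?_⟩
  exact eq_of_isPreconnected (isPreconnected_gap c k)
    (g := fun y : ℝ => starRingEnd ℂ (X i y)) (f := fun i (y : ℝ) => X i y)
    (Complex.continuous_conj.comp (hs.continuousOn_ofReal i)).continuousOn
    (fun i => (hs.continuousOn_ofReal i).continuousOn)
    (fun y hy => injective h hs (im_ofReal_nonneg y) (ne_of_mem_gap' hy))
    (fun y _ => hs.exists_conj y i) hy₀ (hσ i) hy

end Sheets

end

section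

variable {p q : ℝ[X]} {c x : Fin 8 → ℝ} {X : Fin 5 → ℂ → ℂ}

namespace Sheets

theorem eq_crit_of_eq (h : Good p q c x) (hc : StrictMono c) (hs : Sheets p q X) {k : Fin 8}
    {i j : Fin 5} (hij : i ≠ j) (he : X i (c k) = X j (c k)) : X i (c k) = x k := by
  have hd : (derivative (fam p q (c k))).eval (X i (c k)) = 0 := by
    rw [hs.fac _ (im_ofReal_nonneg _), prod_X_sub_C_eval_derivative (fun i => X i (c k))]
    exact Finset.prod_eq_zero (Finset.mem_erase.2 ⟨hij.symm, Finset.mem_univ j⟩)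
      (sub_eq_zero.2 he)
  obtain ⟨l, h1, h2⟩ := h.crit (hs.root (im_ofReal_nonneg _) i) hd
  rw [h1, hc.injective (Complex.ofReal_injective h2)]

theorem not_three (h : Good p q c x) (hs : Sheets p q X) {k : Fin 8} {i j l : Fin 5}
    (hij : i ≠ j) (hil : i ≠ l) (hjl : j ≠ l) (hi : X i (c k) = x k) (hj : X j (c k) = x k)
    (hl : X l (c k) = x k) : False := by
  have hd : ∏ m ∈ {i, j, l}, (Polynomial.X - C (X m (c k))) ∣ fam p q (c k) := by
    rw [hs.fac _ (im_ofReal_nonneg _)]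
    exact Finset.prod_dvd_prod_of_subset _ _ _ (Finset.subset_univ _)
  rw [Finset.prod_insert (by simp [hij, hil]), Finset.prod_insert (by simp [hjl]),
    Finset.prod_singleton, hi, hj, hl] at hd
  obtain ⟨g, hg⟩ := hd
  apply h.fam_deriv2_val k
  rw [hg]
  simp [derivative_mul]

theorem crossing (h : Good p q c x) (hc : StrictMono c) (hs : Sheets p q X) (k : Fin 8)
    {σ τ : Equiv.Perm (Fin 5)}
    (hσ : ∀ y ∈ gap c k, ∀ i, starRingEnd ℂ (X i y) = X (σ i) y)
    (hτ : ∀ y ∈ gap c (k + 1), ∀ i, starRingEnd ℂ (X i y) = X (τ i) y) :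
    τ = σ ∨ ∃ a b, a ≠ b ∧ τ = Equiv.swap a b * σ := by
  have hcont := fun i => hs.continuousOn_ofReal i
  have lim : ∀ (l : Filter ℝ) (ρ : Equiv.Perm (Fin 5)), l.NeBot → l ≤ 𝓝 (c k) →
      (∀ᶠ y : ℝ in l, ∀ i, starRingEnd ℂ (X i y) = X (ρ i) y) →
      ∀ i, starRingEnd ℂ (X i (c k)) = X (ρ i) (c k) := by
    intro l ρ _ hl he i
    refine tendsto_nhds_unique_of_eventuallyEq
      (((Complex.continuous_conj.comp (hcont i)).tendsto (c k)).mono_left hl)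
      (((hcont (ρ i)).tendsto (c k)).mono_left hl) ?_
    filter_upwards [he] with y hy using hy i
  have h1 := lim _ σ inferInstance nhdsWithin_le_nhds
    ((eventually_mem_gap_left hc k).mono fun y hy => hσ y hy)
  have h2 := lim _ τ inferInstance nhdsWithin_le_nhds
    ((eventually_mem_gap_right hc k).mono fun y hy => hτ y hy)
  set ρ := τ * σ⁻¹ with hρ
  have hτρ : τ = ρ * σ := by simp [hρ]
  have hfix : ∀ i, X (ρ i) (c k) = X i (c k) := fun i => by
    have := (h1 (σ⁻¹ i)).symm.trans (h2 (σ⁻¹ i))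
    simpa [hρ] using this.symm
  by_cases hne : ρ = 1
  · left; rw [hτρ, hne, one_mul]
  right
  obtain ⟨a, ha⟩ : ∃ a, ρ a ≠ a := by
    by_contra! hall
    exact hne (Equiv.ext hall)
  have hx : ∀ i, ρ i ≠ i → X i (c k) = x k := fun i hi =>
    eq_crit_of_eq h hc hs hi.symm (hfix i).symm
  have hxa := hx a ha
  have hxb : X (ρ a) (c k) = x k := (hfix a).trans hxa
  have hmem : ∀ i, X i (c k) = x k → i = a ∨ i = ρ a := fun i hi => by
    by_contra! hi'
    exact not_three h hs ha hi'.2.symm hi'.1.symm hxb hxa hi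
  refine ⟨a, ρ a, ha.symm, ?_⟩
  rw [hτρ]
  congr 1
  ext i : 1
  by_cases e1 : i = a
  · rw [e1, Equiv.swap_apply_left]
  by_cases e2 : i = ρ a
  · rw [e2, Equiv.swap_apply_right]
    rcases hmem (ρ (ρ a)) ((hfix _).trans hxb) with e | e
    · exact e
    · exact absurd (ρ.injective e) ha
  rw [Equiv.swap_apply_of_ne_of_ne e1 e2]
  by_contra e
  rcases hmem i (hx i e) with e' | e'
  exacts [e1 e', e2 e']

theorem perm_unique (h : Good p q c x) (hs : Sheets p q X) {y : ℝ} (hy : ∀ j, y ≠ c j)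
    {σ τ : Equiv.Perm (Fin 5)} (hσ : ∀ i, starRingEnd ℂ (X i y) = X (σ i) y)
    (hτ : ∀ i, starRingEnd ℂ (X i y) = X (τ i) y) : σ = τ := by
  ext i : 1
  exact injective h hs (im_ofReal_nonneg y) (fun j => by exact_mod_cast hy j)
    ((hσ i).symm.trans (hτ i))

theorem perm_mul_self (h : Good p q c x) (hs : Sheets p q X) {y : ℝ} (hy : ∀ j, y ≠ c j)
    {σ : Equiv.Perm (Fin 5)} (hσ : ∀ i, starRingEnd ℂ (X i y) = X (σ i) y) : σ * σ = 1 := by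
  ext i : 1
  refine injective h hs (im_ofReal_nonneg y) (fun j => by exact_mod_cast hy j) ?_
  simp only [Equiv.Perm.mul_apply, ← hσ, Complex.conj_conj, Equiv.Perm.one_apply]

end Sheets

end

section

/-- The homogenization of `p` in degree `n`, evaluated at `(A, B)`. -/
noncomputable def hom {R : Type*} [CommRing R] (n : ℕ) (p A B : R[X]) : R[X] :=
  ∑ k ∈ Finset.range (n + 1), C (p.coeff k) * A ^ k * B ^ (n - k)

theorem map_hom {R S : Type*} [CommRing R] [CommRing S] (f : R →+* S) (n : ℕ) (p A B : R[X]) :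
    (hom n p A B).map f = hom n (p.map f) (A.map f) (B.map f) := by
  simp [hom, Polynomial.map_sum]

theorem eval_hom {K : Type*} [Field K] {n : ℕ} {p A B : K[X]} (hp : p.natDegree ≤ n) {u : K}
    (hu : B.eval u ≠ 0) :
    (hom n p A B).eval u = B.eval u ^ n * p.eval (A.eval u / B.eval u) := by
  rw [hom, eval_finsetSum, eval_eq_sum_range' (Nat.lt_succ_of_le hp), Finset.mul_sum]
  refine Finset.sum_congr rfl fun k hk => ?_
  have hk' : k ≤ n := Nat.lt_succ_iff.1 (Finset.mem_range.1 hk)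
  simp only [eval_mul, eval_C, eval_pow]
  rw [div_pow]
  field_simp
  rw [mul_assoc, ← pow_add, Nat.sub_add_cancel hk']

theorem natDegree_lin_le {R : Type*} [CommRing R] (a b : R) : (C a * X + C b).natDegree ≤ 1 :=
  natDegree_linear_le

theorem natDegree_hom_term_le {R : Type*} [CommRing R] {n k : ℕ} (hk : k ≤ n) (s : R) {A B : R[X]}
    (hA : A.natDegree ≤ 1) (hB : B.natDegree ≤ 1) :
    (C s * A ^ k * B ^ (n - k)).natDegree ≤ n := by
  have h1 : (C s * A ^ k).natDegree ≤ k :=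
    (natDegree_C_mul_le _ _).trans (natDegree_pow_le_of_le k hA |>.trans (by simp))
  have h2 : (B ^ (n - k)).natDegree ≤ n - k := natDegree_pow_le_of_le _ hB |>.trans (by simp)
  exact (natDegree_mul_le_of_le h1 h2).trans (by omega)

theorem natDegree_hom_le {R : Type*} [CommRing R] (n : ℕ) (p : R[X]) {A B : R[X]}
    (hA : A.natDegree ≤ 1) (hB : B.natDegree ≤ 1) : (hom n p A B).natDegree ≤ n :=
  natDegree_sum_le_of_forall_le _ _ fun _ hk =>
    natDegree_hom_term_le (Nat.lt_succ_iff.1 (Finset.mem_range.1 hk)) _ hA hB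

theorem coeff_hom {R : Type*} [CommRing R] (n : ℕ) (p : R[X]) {A B : R[X]}
    (hA : A.natDegree ≤ 1) (hB : B.natDegree ≤ 1) : (hom n p A B).coeff n =
      ∑ k ∈ Finset.range (n + 1), p.coeff k * A.coeff 1 ^ k * B.coeff 1 ^ (n - k) := by
  rw [hom, finsetSum_coeff]
  refine Finset.sum_congr rfl fun k hk => ?_
  have hk' : k ≤ n := Nat.lt_succ_iff.1 (Finset.mem_range.1 hk)
  have h1 : (A ^ k).natDegree ≤ k := natDegree_pow_le_of_le k hA |>.trans (by simp)
  have h2 : (B ^ (n - k)).natDegree ≤ n - k := natDegree_pow_le_of_le _ hB |>.trans (by simp)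
  have h3 := coeff_mul_add_eq_of_natDegree_le h1 h2
  have h4 := coeff_pow_of_natDegree_le hA (m := k)
  have h5 := coeff_pow_of_natDegree_le hB (m := n - k)
  rw [mul_one] at h4 h5
  rw [mul_assoc, coeff_C_mul]
  conv_lhs => rw [show n = k + (n - k) by omega]
  rw [Nat.add_sub_cancel_left, h3, h4, h5, mul_assoc]

theorem eval_derivative_hom {n : ℕ} {p A B : ℝ[X]} (hp : p.natDegree ≤ n) {u : ℝ}
    (hu : B.eval u ≠ 0) : (derivative (hom n p A B)).eval u =
      n * B.eval u ^ (n - 1) * (derivative B).eval u * p.eval (A.eval u / B.eval u) +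
      B.eval u ^ n * ((derivative p).eval (A.eval u / B.eval u) *
        (((derivative A).eval u * B.eval u - A.eval u * (derivative B).eval u) /
          B.eval u ^ 2)) := by
  have h1 := (hom n p A B).hasDerivAt u
  have h2 : HasDerivAt (fun v => B.eval v ^ n * p.eval (A.eval v / B.eval v)) _ u :=
    ((B.hasDerivAt u).fun_pow n).fun_mul (HasDerivAt.comp (h₂ := fun v => p.eval v) u
      (p.hasDerivAt (A.eval u / B.eval u)) ((A.hasDerivAt u).fun_div (B.hasDerivAt u) hu))
  have h3 : (fun v => B.eval v ^ n * p.eval (A.eval v / B.eval v)) =ᶠ[𝓝 u]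
      fun v => (hom n p A B).eval v := by
    filter_upwards [B.continuous.continuousAt.eventually_ne hu] with v hv
    rw [eval_hom hp hv]
  exact (h1.congr_of_eventuallyEq h3).unique h2

theorem eq_of_eval_eq_of_ne {p q B : ℝ[X]} (hB : B ≠ 0)
    (h : ∀ u, B.eval u ≠ 0 → p.eval u = q.eval u) : p = q := by
  refine mul_left_cancel₀ hB (Polynomial.funext fun u => ?_)
  simp only [eval_mul]
  by_cases hu : B.eval u = 0
  · simp [hu]
  · rw [h u hu]

theorem wr_hom {p q A B : ℝ[X]} (hB : B ≠ 0) (hp : p.natDegree ≤ 5) (hq : q.natDegree ≤ 5)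
    (hw : (wr p q).natDegree ≤ 8) :
    wr (hom 5 p A B) (hom 5 q A B) = wr A B * hom 8 (wr p q) A B := by
  refine eq_of_eval_eq_of_ne hB fun u hu => ?_
  rw [eval_mul, eval_hom hw hu]
  simp only [wr, eval_sub, eval_mul]
  rw [eval_derivative_hom hp hu, eval_derivative_hom hq hu, eval_hom hp hu, eval_hom hq hu]
  field_simp
  push_cast
  ring

theorem exists_root_of_natDegree_five {p : ℝ[X]} (hp : p.natDegree = 5) : ∃ r, p.eval r = 0 := by
  wlog hl : 0 ≤ p.leadingCoeff
  · obtain ⟨r, hr⟩ := this (p := -p) (by rw [natDegree_neg, hp]) (by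
      rw [leadingCoeff_neg]; linarith)
    exact ⟨r, by simpa using hr⟩
  have hd : ∀ f : ℝ[X], f.natDegree = 5 → 0 < f.degree := fun f hf =>
    natDegree_pos_iff_degree_pos.1 (by omega)
  have h1 := tendsto_atTop_of_leadingCoeff_nonneg p (hd p hp) hl
  have h2 : (-(p.comp (-X))).natDegree = 5 := by
    rw [natDegree_neg, natDegree_comp, natDegree_neg, natDegree_X, hp]
  have h3 := tendsto_atTop_of_leadingCoeff_nonneg (-(p.comp (-X))) (hd _ h2) (by
    rw [leadingCoeff_neg, leadingCoeff_comp (by simp), hp]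
    simp only [leadingCoeff_neg, leadingCoeff_X]; linarith)
  obtain ⟨a, ha⟩ := (h1.eventually_ge_atTop 0).exists
  obtain ⟨b, hb⟩ := (h3.eventually_ge_atTop 0).exists
  simp only [eval_neg, eval_comp, eval_X] at hb
  exact mem_range_of_exists_le_of_exists_ge p.continuous ⟨-b, by linarith⟩ ⟨a, ha⟩

variable {p q : ℝ[X]} {c x : Fin 8 → ℝ}

/-- A pair of polynomials of degree at most `5` whose Wronskian has the eight distinct real roots
`x j`, where `p / q` takes the value `c j`. -/
structure Gen (p q : ℝ[X]) (κ : ℝ) (c x : Fin 8 → ℝ) : Prop where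
  degp : p.natDegree ≤ 5
  degq : q.natDegree ≤ 5
  ne : κ ≠ 0
  wr_eq : wr p q = C κ * ∏ j, (X - C (x j))
  xinj : Function.Injective x
  val : ∀ j, p.eval (x j) = c j * q.eval (x j)

theorem natDegree_prod_eight (x : Fin 8 → ℝ) : (∏ j, (X - C (x j))).natDegree = 8 := by
  rw [natDegree_prod_of_monic _ _ fun i _ => monic_X_sub_C _]; simp

theorem Gen.natDegree_wr (h : Gen p q κ c x) : (wr p q).natDegree = 8 := by
  rw [h.wr_eq, natDegree_C_mul h.ne, natDegree_prod_eight]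

theorem Gen.hom (h : Gen p q κ c x) {a b e d : ℝ} (hD : a * d - b * e ≠ 0)
    (hx : ∀ j, a - e * x j ≠ 0) :
    Gen (hom 5 p (C a * X + C b) (C e * X + C d)) (hom 5 q (C a * X + C b) (C e * X + C d))
      ((a * d - b * e) * κ * ∏ j, (a - e * x j)) c (fun j => (d * x j - b) / (a - e * x j)) := by
  have hB : (C e * X + C d : ℝ[X]) ≠ 0 := by
    intro h0
    have h1 := congrArg (fun f => f.coeff 1) h0
    have h2 := congrArg (fun f => f.coeff 0) h0
    simp at h1 h2
    rw [h1, h2] at hD; simp at hD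
  refine ⟨natDegree_hom_le _ _ (natDegree_lin_le _ _) (natDegree_lin_le _ _),
    natDegree_hom_le _ _ (natDegree_lin_le _ _) (natDegree_lin_le _ _), ?_, ?_, ?_, fun j => ?_⟩
  · exact mul_ne_zero (mul_ne_zero hD h.ne) (Finset.prod_ne_zero_iff.2 fun j _ => hx j)
  · rw [wr_hom hB h.degp h.degq h.natDegree_wr.le]
    refine eq_of_eval_eq_of_ne hB fun u hu => ?_
    rw [eval_mul, eval_hom h.natDegree_wr.le hu, h.wr_eq]
    simp only [wr, eval_mul, eval_C, eval_prod, eval_sub, eval_X, derivative_add, derivative_mul,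
      derivative_C, derivative_X, eval_add, zero_mul, zero_add, mul_one, add_zero]
    simp only [eval_add, eval_mul, eval_C, eval_X] at hu
    have h8 : (e * u + d) ^ 8 = ∏ _j : Fin 8, (e * u + d) := by simp
    have h9 : (e * u + d) ^ 8 * ∏ j, ((a * u + b) / (e * u + d) - x j) =
        (∏ j, (a - e * x j)) * ∏ j, (u - (d * x j - b) / (a - e * x j)) := by
      rw [h8, ← Finset.prod_mul_distrib, ← Finset.prod_mul_distrib]
      refine Finset.prod_congr rfl fun j _ => ?_
      have := hx j
      field_simp
      ring
    linear_combination (a * d - b * e) * κ * h9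
  · intro i j hij
    have h1 := hx i
    have h2 := hx j
    apply h.xinj
    simp only at hij
    rw [div_eq_div_iff h1 h2] at hij
    exact mul_left_cancel₀ hD (by linear_combination hij)
  · have h1 := hx j
    have hBx : e * ((d * x j - b) / (a - e * x j)) + d = (a * d - b * e) / (a - e * x j) := by
      field_simp; ring
    have hAx : a * ((d * x j - b) / (a - e * x j)) + b =
        x j * ((a * d - b * e) / (a - e * x j)) := by
      rw [mul_div_assoc', mul_div_assoc', div_add' _ _ _ h1]
      congr 1; ring
    have hne : (a * d - b * e) / (a - e * x j) ≠ 0 := div_ne_zero hD h1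
    have hu : (C e * X + C d : ℝ[X]).eval ((d * x j - b) / (a - e * x j)) ≠ 0 := by
      simp only [eval_add, eval_mul, eval_C, eval_X]; rwa [hBx]
    rw [eval_hom h.degp hu, eval_hom h.degq hu]
    simp only [eval_add, eval_mul, eval_C, eval_X]
    rw [hBx, hAx, mul_div_cancel_right₀ _ hne, h.val]; ring

theorem Gen.good (h : Gen p q κ c x) (hκ : 0 < κ) (hq : q.natDegree ≤ 4) :
    p.coeff 5 ≠ 0 ∧ Good (C (p.coeff 5)⁻¹ * p) (C (p.coeff 5)⁻¹ * q) c x := by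
  have hc : p.coeff 5 * q.coeff 4 = κ := by
    have h1 := congrArg (fun f => f.coeff 8) h.wr_eq
    simp only [coeff_C_mul] at h1
    have h2 : (∏ j, (X - C (x j))).coeff 8 = 1 := by
      have := monic_prod_of_monic Finset.univ (fun j => X - C (x j)) fun i _ => monic_X_sub_C _
      rw [Monic, leadingCoeff, natDegree_prod_eight] at this
      exact this
    rw [h2, mul_one, wr, coeff_sub] at h1
    have h3 := coeff_mul_add_eq_of_natDegree_le (f := derivative p) (g := q) (df := 4) (dg := 4)
      ((natDegree_derivative_le p).trans (by have := h.degp; omega)) hq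
    have h4 := coeff_mul_add_eq_of_natDegree_le (f := p) (g := derivative q) (df := 5) (dg := 3)
      h.degp ((natDegree_derivative_le q).trans (by omega))
    norm_num at h3 h4
    rw [h3, h4, coeff_derivative, coeff_derivative] at h1
    norm_num at h1
    linarith
  have hp5 : p.coeff 5 ≠ 0 := by
    intro h0; rw [h0, zero_mul] at hc; exact h.ne hc.symm
  have hq4 : q.coeff 4 ≠ 0 := by
    intro h0; rw [h0, mul_zero] at hc; exact h.ne hc.symm
  have hdp : p.natDegree = 5 := le_antisymm h.degp (le_natDegree_of_ne_zero hp5)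
  have hdq : q.natDegree = 4 := le_antisymm hq (le_natDegree_of_ne_zero hq4)
  have hlp : p.leadingCoeff = p.coeff 5 := by rw [leadingCoeff, hdp]
  have hlq : q.leadingCoeff = q.coeff 4 := by rw [leadingCoeff, hdq]
  have hi : (p.coeff 5)⁻¹ ≠ 0 := inv_ne_zero hp5
  refine ⟨hp5, ?_, ?_, ?_, ?_, ?_, h.xinj, fun j => ?_⟩
  · rw [Monic, leadingCoeff_mul, leadingCoeff_C, hlp, inv_mul_cancel₀ hp5]
  · rw [natDegree_C_mul hi, hdp]
  · rw [natDegree_C_mul hi, hdq]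
  · rw [leadingCoeff_mul, leadingCoeff_C, hlq, inv_mul_eq_div, ← mul_div_mul_left _ _ hp5, hc]
    exact div_pos hκ (mul_self_pos.2 hp5)
  · have : wr (C (p.coeff 5)⁻¹ * p) (C (p.coeff 5)⁻¹ * q) =
        C ((p.coeff 5)⁻¹ * (p.coeff 5)⁻¹) * wr p q := by
      simp only [wr, derivative_mul, derivative_C, zero_mul, zero_add, C_mul]; ring
    rw [this, h.wr_eq, leadingCoeff_mul, leadingCoeff_C, hlq, ← mul_assoc, ← C_mul, ← hc]
    congr 2; field_simp
  · simp only [eval_mul, eval_C, h.val]; ring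

end

section

variable {p q : ℝ[X]} {c x : Fin 8 → ℝ} {κ : ℝ}

theorem natDegree_le_four {q : ℝ[X]} (h : q.natDegree ≤ 5) (h5 : q.coeff 5 = 0) :
    q.natDegree ≤ 4 := by
  rcases h.lt_or_eq with h' | h'
  · omega
  · have : q.leadingCoeff = 0 := by rw [leadingCoeff, h', h5]
    rw [leadingCoeff_eq_zero] at this
    simp [this]

theorem Gen.q_eval_ne (h : Gen p q κ c x) (j : Fin 8) : q.eval (x j) ≠ 0 := by
  intro hq
  have hp : p.eval (x j) = 0 := by rw [h.val, hq, mul_zero]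
  have h1 : (derivative (wr p q)).eval (x j) = 0 := by
    rw [Good.derivative_wr]; simp [hp, hq]
  rw [h.wr_eq, ← Finset.mul_prod_erase _ _ (Finset.mem_univ j)] at h1
  simp only [derivative_mul, derivative_C, zero_mul, derivative_sub, derivative_X, sub_zero,
    one_mul, eval_mul, eval_add, eval_C, eval_sub, eval_X, sub_self, zero_add, add_zero,
    mul_eq_zero, h.ne, false_or] at h1
  rw [eval_prod, Finset.prod_eq_zero_iff] at h1
  obtain ⟨i, hi, h2⟩ := h1
  simp only [eval_sub, eval_X, eval_C] at h2
  exact Finset.ne_of_mem_erase hi (h.xinj (sub_eq_zero.1 h2)).symm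

theorem exists_sign {s : ℝ} (hs : s ≠ 0) : ∃ ε : ℝ, (ε = 1 ∨ ε = -1) ∧ 0 < ε * s := by
  rcases lt_or_gt_of_ne hs with h | h
  · exact ⟨-1, Or.inr rfl, by linarith⟩
  · exact ⟨1, Or.inl rfl, by linarith⟩

/-- Moving a pole to infinity normalizes a generic pair. -/
theorem Gen.exists_good_of_root (h : Gen p q κ c x) {r : ℝ} (hr : q.eval r = 0) :
    ∃ ε u : ℝ, ε ≠ 0 ∧ u ≠ 0 ∧ ∃ x', Good (C u * MFun.hom 5 p (C r * X + C ε) (C 1 * X + C 0))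
      (C u * MFun.hom 5 q (C r * X + C ε) (C 1 * X + C 0)) c x' := by
  have hx : ∀ j, r - 1 * x j ≠ 0 := fun j h0 => h.q_eval_ne j (by
    rw [one_mul, sub_eq_zero] at h0; rwa [← h0])
  obtain ⟨ε, hε, hpos⟩ := exists_sign (s := -(κ * ∏ j, (r - 1 * x j)))
    (neg_ne_zero.2 (mul_ne_zero h.ne (Finset.prod_ne_zero_iff.2 fun j _ => hx j)))
  have hε0 : ε ≠ 0 := by rcases hε with rfl | rfl <;> norm_num
  have h1 := h.hom (a := r) (b := ε) (e := 1) (d := 0) (by simpa using hε0) hx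
  obtain ⟨h2, h3⟩ := h1.good (by linarith) (natDegree_le_four h1.degq (by
    rw [coeff_hom 5 q (natDegree_lin_le _ _) (natDegree_lin_le _ _)]
    rw [eval_eq_sum_range' (Nat.lt_succ_of_le h.degq)] at hr
    simpa using hr))
  exact ⟨ε, _, hε0, inv_ne_zero h2, _, h3⟩

theorem Gen.exists_good (h : Gen p q κ c x) :
    ∃ a b e d u : ℝ, a * d - b * e ≠ 0 ∧ u ≠ 0 ∧ ∃ x',
      Good (C u * MFun.hom 5 p (C a * X + C b) (C e * X + C d))
        (C u * MFun.hom 5 q (C a * X + C b) (C e * X + C d)) c x' := by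
  rcases h.degq.lt_or_eq with hq | hq
  · obtain ⟨ε, hε, hpos⟩ := exists_sign h.ne
    have hε0 : ε ≠ 0 := by rcases hε with rfl | rfl <;> norm_num
    have h1 := h.hom (a := ε) (b := 0) (e := 0) (d := 1) (by simpa using hε0) (by simpa using hε0)
    obtain ⟨h2, h3⟩ := h1.good (by
      have : ε ^ 8 = 1 := by rcases hε with rfl | rfl <;> norm_num
      simpa [this] using hpos) (natDegree_le_four h1.degq (by
        rw [coeff_hom 5 q (natDegree_lin_le _ _) (natDegree_lin_le _ _)]
        have : q.coeff 5 = 0 := coeff_eq_zero_of_natDegree_lt hq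
        simp [Finset.sum_range_succ, this, coeff_one]))
    exact ⟨ε, 0, 0, 1, _, by simpa using hε0, inv_ne_zero h2, _, h3⟩
  · obtain ⟨r, hr⟩ := exists_root_of_natDegree_five hq
    obtain ⟨ε, u, hε, hu, h1⟩ := h.exists_good_of_root hr
    exact ⟨r, ε, 1, 0, u, by simpa using hε, hu, h1⟩

theorem Good.perm (h : Good p q c x) (e : Equiv.Perm (Fin 8)) : Good p q (c ∘ e) (x ∘ e) where
  monic := h.monic
  degp := h.degp
  degq := h.degq
  pos := h.pos
  wr_eq := by
    rw [h.wr_eq]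
    refine congrArg (fun z => C q.leadingCoeff * z) ?_
    simp only [Function.comp_apply]
    exact (Equiv.prod_comp e fun j => X - C (x j)).symm
  xinj := h.xinj.comp e.injective
  val j := h.val (e j)

/-- The critical values after the target transformation `y ↦ 1 / (y₀ - y)`, in increasing order
when `y₀` lies between the last two of them. -/
noncomputable def rot (y₀ : ℝ) (c : Fin 8 → ℝ) (j : Fin 8) : ℝ := 1 / (y₀ - c (j - 1))

theorem rot_lt {y₀ a b : ℝ} (h : (a - y₀) * (b - y₀) > 0 ∧ a < b ∨ b < y₀ ∧ y₀ < a) :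
    1 / (y₀ - a) < 1 / (y₀ - b) := by
  rcases h with ⟨h, hab⟩ | ⟨hb, ha⟩
  · rcases lt_or_ge a y₀ with h1 | h1
    · have h2 : b < y₀ := by nlinarith
      exact one_div_lt_one_div_of_lt (by linarith) (by linarith)
    · have h2 : y₀ < b := by nlinarith
      have h3 : y₀ < a := lt_of_le_of_ne h1 (by rintro rfl; simp at h)
      exact one_div_lt_one_div_of_neg_of_lt (by linarith) (by linarith)
  · exact (one_div_neg.2 (by linarith)).trans (one_div_pos.2 (by linarith))

end

section

variable {p q : ℝ[X]} {c x y z : Fin 8 → ℝ} {κ : ℝ}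

/-- Two configurations with the same separation relation on the projective line and the same
alternating sign. -/
def SameKey (x y : Fin 8 → ℝ) : Prop :=
  (∀ a b e d, 0 < (x a - x e) * (x b - x e) * (x a - x d) * (x b - x d) ↔
    0 < (y a - y e) * (y b - y e) * (y a - y d) * (y b - y d)) ∧
  ∀ j, 0 < ∏ l ∈ Finset.univ.erase j, (x j - x l) ↔ 0 < ∏ l ∈ Finset.univ.erase j, (y j - y l)

theorem SameKey.symm (h : SameKey x y) : SameKey y x :=
  ⟨fun a b e d => (h.1 a b e d).symm, fun j => (h.2 j).symm⟩

theorem SameKey.trans (h : SameKey x y) (h' : SameKey y z) : SameKey x z :=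
  ⟨fun a b e d => (h.1 a b e d).trans (h'.1 a b e d), fun j => (h.2 j).trans (h'.2 j)⟩

theorem SameKey.perm (h : SameKey x y) (e : Equiv.Perm (Fin 8)) : SameKey (x ∘ e) (y ∘ e) := by
  refine ⟨fun _ _ _ _ => h.1 _ _ _ _, fun j => ?_⟩
  have key : ∀ z : Fin 8 → ℝ, ∏ l ∈ Finset.univ.erase j, ((z ∘ e) j - (z ∘ e) l) =
      ∏ l ∈ Finset.univ.erase (e j), (z (e j) - z l) := fun z =>
    Finset.prod_equiv e (by simp) fun _ _ => rfl
  rw [key, key]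
  exact h.2 _

theorem sameKey_of_order (h : ∀ a b, x a < x b ↔ y a < y b) : SameKey x y := by
  have hs : ∀ a b, SignType.sign (x a - x b) = SignType.sign (y a - y b) := by
    intro a b
    rcases lt_trichotomy (x a) (x b) with hl | hl | hl
    · rw [sign_neg (sub_neg.2 hl), sign_neg (sub_neg.2 ((h a b).1 hl))]
    · have h1 : ¬ y a < y b := fun h1 => hl.not_lt ((h a b).2 h1)
      have h2 : ¬ y b < y a := fun h1 => hl.not_gt ((h b a).2 h1)
      rw [hl, le_antisymm (not_lt.1 h2) (not_lt.1 h1)]; simp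
    · rw [sign_pos (sub_pos.2 hl), sign_pos (sub_pos.2 ((h b a).1 hl))]
  refine ⟨fun a b e d => ?_, fun j => ?_⟩
  · rw [← sign_eq_one_iff, ← sign_eq_one_iff]
    simp only [sign_mul, hs]
  · rw [← sign_eq_one_iff, ← sign_eq_one_iff]
    have key : ∀ z : Fin 8 → ℝ, SignType.sign (∏ l ∈ Finset.univ.erase j, (z j - z l)) =
      ∏ l ∈ Finset.univ.erase j, SignType.sign (z j - z l) := fun z => map_prod signHom _ _
    rw [key, key]
    simp only [hs]

theorem sameKey_moebius {a b e d : ℝ} (hs : ∀ j, a - e * x j ≠ 0)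
    (hD : 0 < (a * d - b * e) * ∏ j, (a - e * x j)) :
    SameKey x fun j => (d * x j - b) / (a - e * x j) := by
  have hD0 : a * d - b * e ≠ 0 := left_ne_zero_of_mul hD.ne'
  have hsub : ∀ j l, (d * x j - b) / (a - e * x j) - (d * x l - b) / (a - e * x l) =
      (a * d - b * e) * (x j - x l) / ((a - e * x j) * (a - e * x l)) := by
    intro j l
    have h1 := hs j
    have h2 := hs l
    rw [div_sub_div _ _ h1 h2]
    congr 1; ring
  refine ⟨fun i j k l => ?_, fun j => ?_⟩
  · simp only [hsub]
    have e1 : (a * d - b * e) * (x i - x k) / ((a - e * x i) * (a - e * x k)) *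
        ((a * d - b * e) * (x j - x k) / ((a - e * x j) * (a - e * x k))) *
        ((a * d - b * e) * (x i - x l) / ((a - e * x i) * (a - e * x l))) *
        ((a * d - b * e) * (x j - x l) / ((a - e * x j) * (a - e * x l))) =
        ((x i - x k) * (x j - x k) * (x i - x l) * (x j - x l)) *
        ((a * d - b * e) ^ 2 / ((a - e * x i) * (a - e * x j) * (a - e * x k) * (a - e * x l))) ^ 2
        := by
      have h1 := hs i
      have h2 := hs j
      have h3 := hs k
      have h4 := hs l
      field_simp
    rw [e1]
    refine (mul_pos_iff_of_pos_right ?_).symm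
    have := hs i
    have := hs j
    have := hs k
    have := hs l
    positivity
  · simp only [hsub, Finset.prod_div_distrib, Finset.prod_mul_distrib, Finset.prod_const,
      Finset.card_erase_of_mem (Finset.mem_univ j), Finset.card_univ, Fintype.card_fin]
    rw [← Finset.mul_prod_erase Finset.univ (fun i => a - e * x i) (Finset.mem_univ j)] at hD
    have h1 := hs j
    have h2 : ∏ i ∈ Finset.univ.erase j, (a - e * x i) ≠ 0 :=
      Finset.prod_ne_zero_iff.2 fun i _ => hs i
    generalize ∏ i ∈ Finset.univ.erase j, (a - e * x i) = S at *
    generalize ∏ i ∈ Finset.univ.erase j, (x j - x i) = T at *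
    have e1 : (a * d - b * e) ^ (8 - 1) * T / ((a - e * x j) ^ (8 - 1) * S) =
        T * ((a * d - b * e) ^ 8 / ((a - e * x j) ^ 6 * ((a * d - b * e) * ((a - e * x j) * S)))) := by
      field_simp
    rw [e1]
    refine (mul_pos_iff_of_pos_right ?_).symm
    have : 0 < (a - e * x j) ^ 6 := by positivity
    have : 0 < (a * d - b * e) ^ 8 := by positivity
    positivity

theorem wr_C_mul (u : ℝ) (p q : ℝ[X]) : wr (C u * p) (C u * q) = C (u ^ 2) * wr p q := by
  simp only [wr, derivative_mul, derivative_C, C_pow]; ring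

theorem wr_linear (a b e d : ℝ) : wr (C a * X + C b) (C e * X + C d) = C (a * d - b * e) := by
  simp only [wr, derivative_add, derivative_mul, derivative_C, derivative_X, C_sub, C_mul]; ring

theorem Good.natDegree_wr (h : Good p q c x) : (wr p q).natDegree = 8 := by
  rw [h.wr_eq, natDegree_C_mul h.pos.ne', natDegree_prod_eight]

/-- Critical points of Möbius related normalized pairs correspond, with the same key. -/
theorem Gen.sameKey {P Q : ℝ[X]} (h : Gen P Q κ c x) (hκ : 0 < κ) (hc : Function.Injective c)
    {a b e d u : ℝ} (hD : a * d - b * e ≠ 0) (hu : u ≠ 0)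
    (hG : Good (C u * MFun.hom 5 P (C a * X + C b) (C e * X + C d))
      (C u * MFun.hom 5 Q (C a * X + C b) (C e * X + C d)) c y) :
    (∀ j, a - e * x j ≠ 0) ∧ (y = fun j => (d * x j - b) / (a - e * x j)) ∧ SameKey x y := by
  have hB : (C e * X + C d : ℝ[X]) ≠ 0 := by
    intro h0
    have h1 := congrArg (fun f => f.coeff 1) h0
    have h2 := congrArg (fun f => f.coeff 0) h0
    simp at h1 h2
    rw [h1, h2] at hD; simp at hD
  have hs : ∀ j, a - e * x j ≠ 0 := by
    intro j h0
    have h8 := hG.natDegree_wr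
    have hW : wr (C u * MFun.hom 5 P (C a * X + C b) (C e * X + C d))
        (C u * MFun.hom 5 Q (C a * X + C b) (C e * X + C d)) =
        C (u ^ 2 * (a * d - b * e)) * MFun.hom 8 (wr P Q) (C a * X + C b) (C e * X + C d) := by
      rw [wr_C_mul, wr_hom hB h.degp h.degq h.natDegree_wr.le, wr_linear, C_mul, mul_assoc]
    rw [hW, natDegree_C_mul (mul_ne_zero (pow_ne_zero 2 hu) hD)] at h8
    have h9 : (MFun.hom 8 (wr P Q) (C a * X + C b) (C e * X + C d)).coeff 8 ≠ 0 := by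
      have h10 : MFun.hom 8 (wr P Q) (C a * X + C b) (C e * X + C d) ≠ 0 := by
        intro h0; rw [h0] at h8; simp at h8
      have h11 := leadingCoeff_ne_zero.2 h10
      rwa [leadingCoeff, h8] at h11
    apply h9
    rw [coeff_hom _ _ (natDegree_lin_le _ _) (natDegree_lin_le _ _)]
    have ha : a = e * x j := sub_eq_zero.1 h0
    have h11 : (wr P Q).eval (x j) = 0 := by
      rw [h.wr_eq, eval_mul, eval_prod, Finset.prod_eq_zero (Finset.mem_univ j) (by simp), mul_zero]
    rw [eval_eq_sum_range' (n := 9) (by rw [h.natDegree_wr]; norm_num)] at h11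
    rw [← mul_zero (e ^ 8), ← h11, Finset.mul_sum]
    refine Finset.sum_congr rfl fun k hk => ?_
    have hk' : k ≤ 8 := Nat.lt_succ_iff.1 (Finset.mem_range.1 hk)
    simp only [coeff_add, coeff_C_mul, coeff_X_one, coeff_C_succ, mul_one, add_zero]
    rw [ha, mul_pow, ← pow_sub_mul_pow e hk']
    ring
  have hgen := h.hom hD hs
  have hW := hgen.wr_eq
  have hG1 := hG.wr_eq
  rw [wr_C_mul, hW] at hG1
  have hlead := congrArg leadingCoeff hG1
  have hmon : ∀ t : Fin 8 → ℝ, (∏ j, (X - C (t j))).leadingCoeff = 1 := fun t =>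
    (monic_prod_of_monic _ _ fun i _ => monic_X_sub_C _).leadingCoeff
  simp only [leadingCoeff_mul, leadingCoeff_C, hmon, mul_one] at hlead
  have hpos := hG.pos
  simp only [leadingCoeff_mul, leadingCoeff_C] at hpos
  rw [← hlead] at hpos
  have hy : y = fun j => (d * x j - b) / (a - e * x j) := by
    funext j
    have h0 : (wr (C u * MFun.hom 5 P (C a * X + C b) (C e * X + C d))
        (C u * MFun.hom 5 Q (C a * X + C b) (C e * X + C d))).eval
        ((d * x j - b) / (a - e * x j)) = 0 := by
      rw [wr_C_mul, hW]
      simp only [eval_mul, eval_prod]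
      refine mul_eq_zero_of_right _ (mul_eq_zero_of_right _
        (Finset.prod_eq_zero (Finset.mem_univ j) ?_))
      simp
    rw [hG.wr_eq, eval_mul, eval_C, eval_prod] at h0
    obtain ⟨i, -, hi⟩ := Finset.prod_eq_zero_iff.1 ((mul_eq_zero.1 h0).resolve_left hG.pos.ne')
    rw [eval_sub, eval_X, eval_C, sub_eq_zero] at hi
    have h1 := hG.val i
    rw [← hi, eval_mul, eval_mul, hgen.val j] at h1
    have h2 : c j = c i := by
      have h3 := hgen.q_eval_ne j
      refine mul_right_cancel₀ (mul_ne_zero hu h3) ?_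
      simp only [eval_C] at h1
      linear_combination h1
    rw [hi, hc h2]
  refine ⟨hs, hy, ?_⟩
  rw [hy]
  refine sameKey_moebius hs ?_
  have : 0 < (u ^ 2 * κ) * ((a * d - b * e) * ∏ j, (a - e * x j)) := by
    linear_combination hpos
  have hu2 : 0 < u ^ 2 * κ := by positivity
  exact (mul_pos_iff_of_pos_left hu2).1 this

end

section

variable {p q : ℝ[X]} {c x : Fin 8 → ℝ} {κ : ℝ} {X : Fin 5 → ℂ → ℂ}

theorem Sheets.comp_perm (hs : Sheets p q X) (ρ : Equiv.Perm (Fin 5)) :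
    Sheets p q (fun i => X (ρ i)) where
  cont i := hs.cont (ρ i)
  fac y hy := by
    rw [hs.fac y hy]
    exact (Equiv.prod_comp ρ fun i => Polynomial.X - C (X i y)).symm

theorem rot_strictMono (hc : StrictMono c) {y₀ : ℝ} (hy₀ : y₀ ∈ gap c 7) :
    StrictMono (rot y₀ c) := by
  rw [Fin.strictMono_iff_lt_succ]
  intro i
  have h7 : y₀ < c 7 := hy₀.2 7 le_rfl
  have hl : ∀ j : Fin 8, j.val < 7 → c j < y₀ := fun j hj => hy₀.1 j hj
  apply rot_lt
  by_cases hi : i = 0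
  · subst hi
    exact Or.inr ⟨hl _ (by decide), h7⟩
  · have h1 : ((Fin.castSucc i - 1 : Fin 8)).val < 7 ∧ ((Fin.succ i - 1 : Fin 8)).val < 7 ∧
        (Fin.castSucc i - 1 : Fin 8) < Fin.succ i - 1 := by
      revert hi; revert i; decide
    exact Or.inl ⟨mul_pos_of_neg_of_neg (by linarith [hl _ h1.1]) (by linarith [hl _ h1.2.1]),
      hc h1.2.2⟩

theorem Good.gen_target (h : Good p q c x) {y₀ : ℝ} (hy : ∀ j, y₀ ≠ c j) :
    Gen (-q) (p - C y₀ * q) q.leadingCoeff (fun j => 1 / (y₀ - c j)) x where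
  degp := by rw [natDegree_neg, h.degq]; norm_num
  degq := by
    refine (natDegree_sub_le _ _).trans (max_le h.degp.le ?_)
    exact (natDegree_C_mul_le _ _).trans (by rw [h.degq]; norm_num)
  ne := h.pos.ne'
  wr_eq := by
    rw [← h.wr_eq]
    simp only [wr, derivative_sub, derivative_mul, derivative_neg, derivative_C]; ring
  xinj := h.xinj
  val j := by
    have := sub_ne_zero.2 (hy j)
    simp only [eval_neg, eval_sub, eval_mul, eval_C, h.val]
    field_simp
    ring

theorem im_target {y₀ : ℝ} {s : ℂ} (hs : 0 ≤ s.im) : 0 ≤ ((y₀ : ℂ) - 1 / s).im := by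
  simp only [one_div, Complex.sub_im, Complex.ofReal_im, Complex.inv_im, zero_sub]
  rw [neg_div, neg_neg]
  exact div_nonneg hs (Complex.normSq_nonneg _)

theorem im_target_pos {y₀ : ℝ} {s : ℂ} (hs : 0 < s.im) : 0 < ((y₀ : ℂ) - 1 / s).im := by
  simp only [one_div, Complex.sub_im, Complex.ofReal_im, Complex.inv_im, zero_sub]
  rw [neg_div, neg_neg]
  refine div_pos hs (Complex.normSq_pos.2 ?_)
  rintro rfl; simp at hs

theorem tendsto_upper_neBot {s : ℂ} (hs : 0 ≤ s.im) : (𝓝[{y : ℂ | 0 < y.im}] s).NeBot :=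
  mem_closure_iff_nhdsWithin_neBot.1 (by rw [Complex.closure_setOfPred_lt_im]; exact hs)

/-- The rotation of the target projective line which shifts the critical values by one. -/
theorem Good.rotate (h : Good p q c x) (hc : StrictMono c) (hs : Sheets p q X) {y₀ : ℝ}
    (hy₀ : y₀ ∈ gap c 7) : ∃ p' q' x' X', ∃ r ε : ℝ, ε ≠ 0 ∧ Good p' q' (rot y₀ c) x' ∧
      Sheets p' q' X' ∧ SameKey (x ∘ Equiv.subRight 1) x' ∧ ∀ s : ℂ, 0 ≤ s.im → s ≠ 0 → ∀ i,
        X i (y₀ - 1 / s) - r ≠ 0 ∧ X' i s = ε / (X i (y₀ - 1 / s) - r) := by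
  have hg := h.gen_target (ne_of_mem_gap hy₀)
  have hq1 : (p - C y₀ * q).natDegree = 5 := by
    rw [natDegree_sub_eq_left_of_natDegree_lt, h.degp]
    exact (natDegree_C_mul_le _ _).trans_lt (by rw [h.degq, h.degp]; norm_num)
  obtain ⟨r, hr⟩ := exists_root_of_natDegree_five hq1
  obtain ⟨ε, u, hε, hu, x', hG⟩ := hg.exists_good_of_root hr
  have hinj : Function.Injective fun j => 1 / (y₀ - c j) := by
    intro i j hij
    have h1 := sub_ne_zero.2 (ne_of_mem_gap hy₀ i)
    have h2 := sub_ne_zero.2 (ne_of_mem_gap hy₀ j)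
    simp only [one_div, inv_inj] at hij
    exact hc.injective (by linarith)
  have hkey := ((hg.sameKey h.pos hinj (by simpa using hε) hu hG).2.2).perm (Equiv.subRight 1)
  have hG' := hG.perm (Equiv.subRight 1)
  set p' := C u * MFun.hom 5 (-q) (C r * Polynomial.X + C ε) (C 1 * Polynomial.X + C 0)
  set q' := C u * MFun.hom 5 (p - C y₀ * q) (C r * Polynomial.X + C ε)
    (C 1 * Polynomial.X + C 0)
  have hG'' : Good p' q' (rot y₀ c) (x' ∘ Equiv.subRight 1) := hG'
  obtain ⟨Z, hZ⟩ := Good.exists_sheets hG''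
  have hne : ∀ s : ℂ, 0 ≤ s.im → s ≠ 0 → ∀ i, X i (y₀ - 1 / s) - r ≠ 0 := by
    intro s hs1 hs0 i h0
    have h1 := hs.root (im_target (y₀ := y₀) hs1) i
    rw [sub_eq_zero.1 h0] at h1
    have h2 : (cx p).eval (r : ℂ) - y₀ * (cx q).eval (r : ℂ) = 0 := by
      rw [cx_eval_ofReal, cx_eval_ofReal]
      simp only [eval_sub, eval_mul, eval_C] at hr
      exact_mod_cast hr
    have h3 := h.q_ne_of_fam h1
    rw [eval_fam] at h1
    have h4 : (1 / s) * (cx q).eval (r : ℂ) = 0 := by linear_combination h1 - h2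
    exact mul_ne_zero (one_div_ne_zero hs0) h3 h4
  let Y : Fin 5 → ℂ → ℂ := fun i s => ε / (X i (y₀ - 1 / s) - r)
  have hεc : (ε : ℂ) ≠ 0 := by exact_mod_cast hε
  have hY0 : ∀ s : ℂ, 0 ≤ s.im → s ≠ 0 → ∀ i, Y i s ≠ 0 := fun s h1 h2 i =>
    div_ne_zero hεc (hne s h1 h2 i)
  have hYX : ∀ s : ℂ, 0 ≤ s.im → s ≠ 0 → ∀ i, (r * Y i s + ε) / Y i s = X i (y₀ - 1 / s) := by
    intro s h1 h2 i
    have := hne s h1 h2 i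
    simp only [Y]
    generalize X i (y₀ - 1 / s) = w at this ⊢
    field_simp
    ring
  have hroot : ∀ s : ℂ, 0 ≤ s.im → s ≠ 0 → ∀ i, (fam p' q' s).eval (Y i s) = 0 := by
    intro s h1 h2 i
    have hB : (cx (C 1 * Polynomial.X + C 0)).eval (Y i s) = Y i s := by simp
    have hA : (cx (C r * Polynomial.X + C ε)).eval (Y i s) = r * Y i s + ε := by simp
    have hB0 : (cx (C 1 * Polynomial.X + C 0)).eval (Y i s) ≠ 0 := by rw [hB]; exact hY0 s h1 h2 i
    have e1 := eval_hom (p := cx (-q)) (A := cx (C r * Polynomial.X + C ε))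
      (n := 5) ((natDegree_map_le).trans hg.degp) hB0
    have e2 := eval_hom (p := cx (p - C y₀ * q)) (A := cx (C r * Polynomial.X + C ε))
      (n := 5) ((natDegree_map_le).trans hg.degq) hB0
    rw [hA, hB, hYX s h1 h2 i] at e1 e2
    have h3 := hs.root (im_target (y₀ := y₀) h1) i
    rw [eval_fam] at h3
    rw [eval_fam]
    simp only [p', q', cx, Polynomial.map_mul, map_hom, map_C, eval_mul, eval_C] at e1 e2 ⊢
    rw [e1, e2]
    simp only [Polynomial.map_neg, Polynomial.map_sub, Polynomial.map_mul, map_C, eval_neg,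
      eval_sub, eval_mul, eval_C, Complex.coe_algebraMap]
    have h4 : s * (1 / s) = 1 := mul_one_div_cancel h2
    linear_combination (-(u : ℂ) * Y i s ^ 5 * s) * h3 +
      (u : ℂ) * Y i s ^ 5 * (cx q).eval (X i (y₀ - 1 / s)) * h4
  have hYc : ∀ i, ContinuousOn (Y i) {s | 0 ≤ s.im ∧ s ≠ 0} := by
    intro i
    refine continuousOn_const.div (ContinuousOn.sub ?_ continuousOn_const)
      fun s hs => hne s hs.1 hs.2 i
    refine (hs.cont i).comp (continuousOn_const.sub
      (continuousOn_const.div continuousOn_id fun s hs => hs.2)) fun s hs => im_target hs.1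
  set U : Set ℂ := {s | 0 < s.im}
  have hU : IsPreconnected U := (convex_halfSpace_im_gt 0).isPreconnected
  have hU0 : ∀ s ∈ U, 0 ≤ s.im ∧ s ≠ 0 := fun s hs => ⟨le_of_lt hs, by
    rintro rfl; simp [U] at hs⟩
  have hI : Complex.I ∈ U := by simp [U]
  have hex : ∀ s ∈ U, ∀ i, ∃ j, Y i s = Z j s := fun s hs i =>
    hZ.exists_eq (hU0 s hs).1 (hroot s (hU0 s hs).1 (hU0 s hs).2 i)
  choose ρ hρ using hex _ hI
  have hYU : ∀ i, ∀ s ∈ U, Y i s = Z (ρ i) s := fun i s hs' =>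
    eq_of_isPreconnected hU ((hYc i).mono hU0) (fun j => (hZ.cont j).mono fun s hs => (hU0 s hs).1)
      (fun s hs => Sheets.injective hG'' hZ (hU0 s hs).1 (ne_of_im_pos hs))
      (fun s hs => hex s hs i) hI (hρ i) hs'
  have hρi : Function.Injective ρ := by
    intro i j hij
    have h1 : Y i Complex.I = Y j Complex.I := by rw [hρ, hρ, hij]
    have h2 := hYX _ (hU0 _ hI).1 (hU0 _ hI).2
    refine Sheets.injective h hs (im_target (y₀ := y₀) (hU0 _ hI).1)
      (ne_of_im_pos (im_target_pos hI)) ?_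
    simp only
    rw [← h2, ← h2, h1]
  refine ⟨p', q', _, _, r, ε, hε, hG'',
    hZ.comp_perm (Equiv.ofBijective ρ (Finite.injective_iff_bijective.1 hρi)), hkey,
    fun s h1 h2 i => ⟨hne s h1 h2 i, ?_⟩⟩
  have := tendsto_upper_neBot h1
  have t1 : Tendsto (Y i) (𝓝[U] s) (𝓝 (Y i s)) := ((hYc i) s ⟨h1, h2⟩).mono_left
    (nhdsWithin_mono _ hU0)
  have t2 : Tendsto (Z (ρ i)) (𝓝[U] s) (𝓝 (Z (ρ i) s)) := ((hZ.cont (ρ i)) s h1).mono_left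
    (nhdsWithin_mono _ fun s hs => (hU0 s hs).1)
  exact tendsto_nhds_unique (t2.congr' (by
    filter_upwards [self_mem_nhdsWithin] with z hz using (hYU i z hz).symm)) t1

end

section

variable {p q : ℝ[X]} {c x : Fin 8 → ℝ} {X : Fin 5 → ℂ → ℂ} {w : Fin 8 → Equiv.Perm (Fin 5)}

/-- `w k` describes the action of complex conjugation on the sheets over the `k`-th gap. -/
def IsMon (X : Fin 5 → ℂ → ℂ) (c : Fin 8 → ℝ) (w : Fin 8 → Equiv.Perm (Fin 5)) : Prop :=
  ∀ k : Fin 8, ∀ y ∈ gap c k, ∀ i, starRingEnd ℂ (X i y) = X (w k i) y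

theorem exists_isMon (h : Good p q c x) (hc : StrictMono c) (hs : Sheets p q X) :
    ∃ w, IsMon X c w := by
  choose w hw using fun k : Fin 8 => hs.exists_perm h hc k.2.le
  exact ⟨w, hw⟩

theorem IsMon.of_mem (h : Good p q c x) (hc : StrictMono c) (hs : Sheets p q X)
    (hp : ∀ k : Fin 8, ∃ y ∈ gap c k, ∀ i, starRingEnd ℂ (X i y) = X (w k i) y) :
    IsMon X c w := by
  obtain ⟨w', hw'⟩ := exists_isMon h hc hs
  have : w = w' := by
    ext1 k
    obtain ⟨y, hy, hy'⟩ := hp k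
    exact hs.perm_unique h (ne_of_mem_gap hy) hy' (hw' k y hy)
  exact this ▸ hw'

theorem mem_gap_rot {k : Fin 8} {y₀ y : ℝ} (hy₀ : y₀ ∈ gap c 7)
    (hy : y ∈ gap c (k - 1 : Fin 8)) (hk : k = 0 → y₀ < y) : 1 / (y₀ - y) ∈ gap (rot y₀ c) k := by
  have h7 : y₀ < c 7 := hy₀.2 7 le_rfl
  have hl : ∀ j : Fin 8, j ≠ 0 → c (j - 1) < y₀ := fun j hj => hy₀.1 (j - 1) (by
    revert j; decide)
  by_cases h0 : k = 0
  · subst h0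
    refine ⟨fun j hj => absurd hj (Nat.not_lt_zero _), fun j _ => rot_lt ?_⟩
    have hk := hk rfl
    by_cases hj : j = 0
    · subst hj
      have := hy.2 7 le_rfl
      exact Or.inl ⟨mul_pos (by linarith) (sub_pos.2 h7), this⟩
    · exact Or.inr ⟨hl j hj, hk⟩
  · have hyk : y < c (k - 1) := hy.2 (k - 1) le_rfl
    have hy1 := hyk.trans (hl k h0)
    refine ⟨fun j hj => rot_lt ?_, fun j hj => rot_lt ?_⟩
    · by_cases hj0 : j = 0
      · subst hj0; exact Or.inr ⟨hy1, h7⟩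
      · have := hy.1 (j - 1) (by clear! c y; revert j k; decide)
        exact Or.inl ⟨mul_pos_of_neg_of_neg (by linarith) (by linarith), this⟩
    · have hj0 : j ≠ 0 := by rintro rfl; exact h0 (by ext; simpa using hj)
      have := hy.2 (j - 1) (by clear! c y; revert j k; decide)
      exact Or.inl ⟨mul_pos_of_neg_of_neg (by linarith) (by linarith [hl j hj0]), this⟩

theorem mem_gap_rot_last {y₀ y : ℝ} (hy₀ : y₀ ∈ gap c 7) (hy : y ∈ gap c 8) :
    1 / (y₀ - y) ∈ gap (rot y₀ c) 1 := by
  have h7 : y₀ < c 7 := hy₀.2 7 le_rfl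
  have h8 : c 7 < y := hy.1 7 (by decide)
  have hl : ∀ j : Fin 8, j ≠ 0 → c (j - 1) < y₀ := fun j hj => hy₀.1 (j - 1) (by
    revert j; decide)
  refine ⟨fun j hj => rot_lt ?_, fun j hj => rot_lt ?_⟩
  · obtain rfl : j = 0 := by ext; simpa using hj
    exact Or.inl ⟨mul_pos (sub_pos.2 h7) (by linarith), h8⟩
  · exact Or.inr ⟨hl j (by rintro rfl; simp at hj), by linarith⟩

theorem conj_target {X' : Fin 5 → ℂ → ℂ} {y₀ r ε y : ℝ} (hε : ε ≠ 0) (hy : y ≠ y₀)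
    (hX : ∀ s : ℂ, 0 ≤ s.im → s ≠ 0 → ∀ i,
      X i (y₀ - 1 / s) - r ≠ 0 ∧ X' i s = ε / (X i (y₀ - 1 / s) - r)) (i j : Fin 5) :
    starRingEnd ℂ (X i y) = X j y ↔
      starRingEnd ℂ (X' i ((1 / (y₀ - y) : ℝ) : ℂ)) = X' j ((1 / (y₀ - y) : ℝ) : ℂ) := by
  have h1 : (y₀ : ℂ) - 1 / ((1 / (y₀ - y) : ℝ) : ℂ) = y := by push_cast; simp
  have h2 : ((1 / (y₀ - y) : ℝ) : ℂ) ≠ 0 := by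
    exact_mod_cast one_div_ne_zero (sub_ne_zero.2 hy.symm)
  have h3 := hX _ (im_ofReal_nonneg _) h2 i
  have h4 := hX _ (im_ofReal_nonneg _) h2 j
  rw [h1] at h3 h4
  rw [h3.2, h4.2, map_div₀, map_sub, Complex.conj_ofReal, Complex.conj_ofReal]
  have h5 : starRingEnd ℂ (X i y) - r ≠ 0 := by
    have := (map_ne_zero (starRingEnd ℂ)).2 h3.1
    rwa [map_sub, Complex.conj_ofReal] at this
  rw [div_eq_div_iff h5 h4.1, mul_right_inj' (by exact_mod_cast hε), sub_left_inj, eq_comm]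

theorem Good.rotate_mon (h : Good p q c x) (hc : StrictMono c) (hs : Sheets p q X)
    (hw : IsMon X c w) {y₀ : ℝ} (hy₀ : y₀ ∈ gap c 7) : 
    (∃ p' q' x' X', Good p' q' (rot y₀ c) x' ∧ Sheets p' q' X' ∧
      SameKey (x ∘ Equiv.subRight 1) x' ∧
      IsMon X' (rot y₀ c) fun k => w (k - 1)) ∧
    ∀ y ∈ gap c 8, ∀ i, starRingEnd ℂ (X i y) = X (w 0 i) y := by
  obtain ⟨p', q', x', X', r, ε, hε, hG, hs', hkey, hX⟩ := h.rotate hc hs hy₀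
  have hc' := rot_strictMono hc hy₀
  have hm : IsMon X' (rot y₀ c) fun k => w (k - 1) := by
    refine IsMon.of_mem hG hc' hs' fun k => ?_
    obtain ⟨y, hy, hk⟩ : ∃ y ∈ gap c (k - 1 : Fin 8), k = 0 → y₀ < y := by
      by_cases h0 : k = 0
      · subst h0
        have h7 : y₀ < c 7 := hy₀.2 7 le_rfl
        obtain ⟨y, h1, h2⟩ := ((eventually_mem_gap_left hc 7).and
          (nhdsWithin_le_nhds (lt_mem_nhds h7))).exists
        exact ⟨y, h1, fun _ => h2⟩
      · obtain ⟨y, hy⟩ := gap_nonempty hc (k - 1 : Fin 8).2.le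
        exact ⟨y, hy, fun h => absurd h h0⟩
    have hyne : y ≠ y₀ := by
      rintro rfl
      have h0 : k ≠ 0 := fun h => (hk h).false
      have h1 := hy.2 (k - 1) le_rfl
      have h2 := hy₀.1 (k - 1) (by clear! y; revert k; decide)
      exact (h1.trans h2).false
    exact ⟨_, mem_gap_rot hy₀ hy hk, fun i => (conj_target hε hyne hX i _).1 (hw _ y hy i)⟩
  refine ⟨⟨p', q', x', X', hG, hs', hkey, hm⟩, fun y hy i => ?_⟩
  refine (conj_target hε ?_ hX i _).2 (hm 1 _ (mem_gap_rot_last hy₀ hy) i)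
  have h7 : y₀ < c 7 := hy₀.2 7 le_rfl
  have h8 : c 7 < y := hy.1 7 (by decide)
  exact ne_of_gt (h7.trans h8)

/-- Cyclic sequences of involutions of `Fin 5` moving by at most a transposition at a time. -/
structure Walk (w : Fin 8 → Equiv.Perm (Fin 5)) : Prop where
  inv : ∀ k, w k * w k = 1
  step : ∀ k, w (k + 1) = w k ∨ ∃ a b, a ≠ b ∧ w (k + 1) = Equiv.swap a b * w k

theorem IsMon.walk (h : Good p q c x) (hc : StrictMono c) (hs : Sheets p q X)
    (hw : IsMon X c w) : Walk w where
  inv k := by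
    obtain ⟨y, hy⟩ := gap_nonempty hc k.2.le
    exact hs.perm_mul_self h (ne_of_mem_gap hy) (hw k y hy)
  step k := by
    refine hs.crossing h hc k (hw k) ?_
    obtain ⟨y₀, hy₀⟩ := gap_nonempty hc (k := 7) (by norm_num)
    by_cases hk : k = 7
    · subst hk
      exact (h.rotate_mon hc hs hw hy₀).2
    · have : ((k : ℕ) + 1) = ((k + 1 : Fin 8) : ℕ) := by clear! y₀; revert k; decide
      rw [this]
      exact hw (k + 1)

end

/-- Morera's theorem across the real line. -/
theorem differentiable_of_im_ne_zero {f : ℂ → ℂ} (hf : Continuous f)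
    (hd : ∀ z : ℂ, z.im ≠ 0 → DifferentiableAt ℂ f z) : Differentiable ℂ f := by
  rw [← differentiableOn_univ,
    ← Complex.isConservativeOn_and_continuousOn_iff_isDifferentiableOn isOpen_univ]
  refine ⟨fun z w _ => ?_, hf.continuousOn⟩
  rw [← add_eq_zero_iff_eq_neg, Complex.wedgeIntegral_add_wedgeIntegral_eq]
  have h1 := Complex.integral_boundary_rect_eq_zero_of_continuousOn_of_differentiableOn f z
    (w.re : ℂ) hf.continuousOn fun u hu => by
      refine (hd u ?_).differentiableWithinAt
      have h2 := (Complex.mem_reProdIm.1 hu).2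
      simp only [Complex.ofReal_im, Set.mem_Ioo, inf_lt_iff, lt_sup_iff] at h2
      intro h0
      rw [h0] at h2
      rcases h2 with ⟨h | h, h' | h'⟩ <;> linarith
  have h2 := Complex.integral_boundary_rect_eq_zero_of_continuousOn_of_differentiableOn f
    (z.re : ℂ) w hf.continuousOn fun u hu => by
      refine (hd u ?_).differentiableWithinAt
      have h2 := (Complex.mem_reProdIm.1 hu).2
      simp only [Complex.ofReal_im, Set.mem_Ioo, inf_lt_iff, lt_sup_iff] at h2
      intro h0
      rw [h0] at h2
      rcases h2 with ⟨h | h, h' | h'⟩ <;> linarith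
  simp only [Complex.ofReal_im, Complex.ofReal_re] at h1 h2
  have h3 : ∀ a b c e : ℝ, (∫ t in a..b, f (e + t * Complex.I)) +
      (∫ t in b..c, f (e + t * Complex.I)) = ∫ t in a..c, f (e + t * Complex.I) := by
    intro a b c e
    have : Continuous fun t : ℝ => f (e + t * Complex.I) := by fun_prop
    exact intervalIntegral.integral_add_adjacent_intervals (this.intervalIntegrable _ _)
      (this.intervalIntegrable _ _)
  rw [← h3 z.im 0 w.im w.re, ← h3 z.im 0 w.im z.re]
  simp only [smul_eq_mul] at h1 h2 ⊢
  linear_combination h1 + h2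

theorem exists_polynomial_of_growth {f : ℂ → ℂ} (hf : Differentiable ℂ f) {B : ℝ} {n : ℕ}
    (hB : ∀ z, ‖f z‖ ≤ B * (1 + ‖z‖) ^ n) :
    ∃ P : ℂ[X], P.natDegree ≤ n ∧ ∀ z, f z = P.eval z := by
  have hB0 : 0 ≤ B := by
    have := (norm_nonneg _).trans (hB 0)
    simpa using this
  have h0 : ∀ m, n < m → iteratedDeriv m f 0 = 0 := by
    intro m hm
    have hlim : Tendsto (fun R : ℝ => m.factorial * (B * 2 ^ n) * R ^ (-(1 : ℝ))) atTop (𝓝 0) := by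
      simpa using (tendsto_rpow_neg_atTop one_pos).const_mul (m.factorial * (B * 2 ^ n) : ℝ)
    have : ‖iteratedDeriv m f 0‖ ≤ 0 := by
      refine ge_of_tendsto hlim ?_
      filter_upwards [eventually_ge_atTop 1] with R hR
      have hR0 : 0 < R := by linarith
      have h1 := Complex.norm_iteratedDeriv_le_of_forall_mem_sphere_norm_le m hR0
        (hf.diffContOnCl) (C := B * (2 * R) ^ n) (c := 0) (f := f) fun z hz => by
          refine (hB z).trans ?_
          rw [mem_sphere_zero_iff_norm] at hz
          gcongr
          linarith
      refine h1.trans ?_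
      rw [Real.rpow_neg_one, ← div_eq_mul_inv, div_le_div_iff₀ (by positivity) hR0, mul_pow]
      have : R ^ n * R ≤ R ^ m := by
        rw [← pow_succ]; exact pow_le_pow_right₀ hR hm
      calc _ = m.factorial * (B * 2 ^ n) * (R ^ n * R) := by ring
        _ ≤ _ := by gcongr
    exact norm_le_zero_iff.1 this
  refine ⟨∑ k ∈ Finset.range (n + 1), C ((k.factorial : ℂ)⁻¹ * iteratedDeriv k f 0) * X ^ k,
    ?_, fun z => ?_⟩
  · refine natDegree_sum_le_of_forall_le _ _ fun k hk => ?_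
    exact (natDegree_C_mul_X_pow_le _ _).trans (Nat.lt_succ_iff.1 (Finset.mem_range.1 hk))
  · rw [← Complex.taylorSeries_eq_of_entire' 0 z hf, tsum_eq_sum (s := Finset.range (n + 1))]
    · simp [eval_finsetSum]
    · intro k hk
      rw [h0 k (by simpa using hk)]
      simp

theorem exists_real_polynomial {P : ℂ[X]} (h : ∀ y : ℝ, (P.eval (y : ℂ)).im = 0) :
    ∃ Q : ℝ[X], P = cx Q ∧ Q.natDegree = P.natDegree := by
  have hm : ∃ Q : ℝ[X], P = cx Q := by
    refine ⟨∑ k ∈ Finset.range (P.natDegree + 1), C (P.coeff k).re * X ^ k, ?_⟩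
    refine Polynomial.eq_of_infinite_eval_eq _ _ ((Set.infinite_range_of_injective
      Complex.ofReal_injective).mono ?_)
    rintro _ ⟨y, rfl⟩
    change P.eval (y : ℂ) = _
    rw [cx_eval_ofReal, ← Complex.re_add_im (P.eval (y : ℂ)), h]
    simp only [Complex.ofReal_zero, zero_mul, add_zero, Complex.ofReal_inj]
    rw [P.eval_eq_sum_range, Complex.re_sum, eval_finsetSum]
    refine Finset.sum_congr rfl fun k _ => ?_
    rw [← Complex.ofReal_pow, Complex.re_mul_ofReal]
    simp
  obtain ⟨Q, rfl⟩ := hm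
  exact ⟨Q, rfl, (natDegree_map_eq_of_injective Complex.ofReal_injective _).symm⟩

/-- A function holomorphic in the upper half plane, continuous up to the real line, real there,
and of polynomial growth is a real polynomial. -/
theorem exists_polynomial_of_upper {g : ℂ → ℂ} (hc : ContinuousOn g {y | 0 ≤ y.im})
    (hd : ∀ y : ℂ, 0 < y.im → DifferentiableAt ℂ g y) (hr : ∀ y : ℝ, (g y).im = 0)
    {B : ℝ} {n : ℕ} (hB : ∀ y : ℂ, 0 ≤ y.im → ‖g y‖ ≤ B * (1 + ‖y‖) ^ n) :
    ∃ P : ℝ[X], P.natDegree ≤ n ∧ ∀ y : ℂ, 0 ≤ y.im → g y = (cx P).eval y := by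
  classical
  let f : ℂ → ℂ := fun y => if 0 ≤ y.im then g y else starRingEnd ℂ (g (starRingEnd ℂ y))
  have hg' : ContinuousOn (fun y => starRingEnd ℂ (g (starRingEnd ℂ y))) {y : ℂ | y.im ≤ 0} :=
    (Complex.continuous_conj.comp_continuousOn
      (hc.comp Complex.continuous_conj.continuousOn fun y hy => by simpa using hy))
  have hfc : Continuous f := by
    refine continuous_if (fun y hy => ?_) ?_ ?_
    · have h0 : y.im = 0 := by
        have := Complex.frontier_setOfPred_le_im 0
        rw [this] at hy; exact hy
      have h1 : y = (y.re : ℂ) := Complex.ext (by simp) (by simp [h0])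
      rw [h1, Complex.conj_ofReal]
      exact (Complex.conj_eq_iff_im.2 (hr _)).symm
    · exact hc.mono (closure_minimal (fun _ h => h)
        (isClosed_le continuous_const Complex.continuous_im))
    · refine hg'.mono ?_
      simp only [not_le]
      rw [Complex.closure_setOfPred_im_lt]
  have hfd : ∀ z : ℂ, z.im ≠ 0 → DifferentiableAt ℂ f z := by
    intro z hz
    rcases hz.lt_or_gt with h | h
    · have h1 : DifferentiableAt ℂ (starRingEnd ℂ ∘ g ∘ starRingEnd ℂ) z :=
        differentiableAt_conj_conj_iff.2 (hd _ (by simpa using h))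
      refine h1.congr_of_eventuallyEq ?_
      filter_upwards [Complex.continuous_im.continuousAt.eventually_lt_const h] with y hy
      exact if_neg (not_le.2 hy)
    · refine (hd z h).congr_of_eventuallyEq ?_
      filter_upwards [Complex.continuous_im.continuousAt.eventually_const_lt h] with y hy
      exact if_pos hy.le
  obtain ⟨P, hP, hPf⟩ := exists_polynomial_of_growth (differentiable_of_im_ne_zero hfc hfd)
    (B := B) (n := n) fun z => by
      by_cases h : 0 ≤ z.im
      · simp only [f, if_pos h]; exact hB z h
      · simp only [f, if_neg h, RCLike.norm_conj]
        refine (hB _ (by simpa using (not_le.1 h).le)).trans_eq ?_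
        rw [RCLike.norm_conj]
  have hPg : ∀ y : ℂ, 0 ≤ y.im → g y = P.eval y := fun y hy => by
    rw [← hPf]; exact (if_pos hy).symm
  obtain ⟨Q, rfl, hQ⟩ := exists_real_polynomial (P := P) fun y => by
    rw [← hPg _ (im_ofReal_nonneg y), hr]
  exact ⟨Q, hQ ▸ hP, hPg⟩

section

variable {p q : ℝ[X]} {c x : Fin 8 → ℝ} {X : Fin 5 → ℂ → ℂ} {w : Fin 8 → Equiv.Perm (Fin 5)}

theorem Sheets.differentiableAt (h : Good p q c x) (hs : Sheets p q X) (i : Fin 5) {y : ℂ}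
    (hy : 0 < y.im) : DifferentiableAt ℂ (X i) y := by
  have hn : {y : ℂ | 0 < y.im} ∈ 𝓝 y := (Complex.continuous_im.isOpen_preimage _ isOpen_Ioi).mem_nhds hy
  have hn' : {y : ℂ | 0 ≤ y.im} ∈ 𝓝 y := mem_of_superset hn fun z (hz : 0 < z.im) => hz.le
  have hq := h.q_ne_of_fam (hs.root hy.le i)
  have hd : HasDerivAt (fun r => (cx p).eval r / (cx q).eval r) _ (X i y) :=
    ((cx p).hasDerivAt _).div ((cx q).hasDerivAt _) hq
  refine (HasDerivAt.of_local_left_inverse ((hs.cont i).continuousAt hn') hd ?_ ?_).differentiableAt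
  · refine div_ne_zero (fun h0 => ?_) (pow_ne_zero _ hq)
    rw [derivative_map, derivative_map] at h0
    obtain ⟨j, hj⟩ := h.cx_wr_root h0
    have h1 := hs.root hy.le i
    rw [hj] at h1 hq
    have h2 := h.fam_val j
    rw [eval_fam] at h1 h2
    have h3 : (y - c j) * (cx q).eval (x j : ℂ) = 0 := by linear_combination h2 - h1
    exact mul_ne_zero (sub_ne_zero.2 (ne_of_im_pos hy j)) hq h3
  · filter_upwards [hn'] with z hz
    have h1 := hs.root hz i
    rw [eval_fam] at h1
    rw [div_eq_iff (h.q_ne_of_fam (hs.root hz i))]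
    linear_combination h1

theorem Sheets.exists_norm_le (h : Good p q c x) (hs : Sheets p q X) :
    ∃ B : ℝ, 0 ≤ B ∧ ∀ y : ℂ, 0 ≤ y.im → ∀ i, ‖X i y‖ ≤ B * (1 + ‖y‖) := by
  obtain ⟨B, hB, hB'⟩ := h.pre.exists_norm_root_le
  refine ⟨1 + B, by positivity, fun y hy i => (hB' y _ (hs.root hy i)).trans ?_⟩
  nlinarith [norm_nonneg y]

theorem IsMon.exists_conj (h : Good p q c x) (hc : StrictMono c) (hs : Sheets p q X)
    (hw : IsMon X c w) {y : ℝ} (hy : ∀ j, y ≠ c j) :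
    ∃ k, ∀ i, starRingEnd ℂ (X i y) = X (w k i) y := by
  obtain ⟨k, hk, hy'⟩ := (exists_gap hc y).resolve_left fun ⟨j, hj⟩ => hy j hj
  rcases hk.eq_or_lt with rfl | hk
  · obtain ⟨y₀, hy₀⟩ := gap_nonempty hc (k := 7) (by norm_num)
    exact ⟨0, (h.rotate_mon hc hs hw hy₀).2 y hy'⟩
  · exact ⟨⟨k, hk⟩, hw ⟨k, hk⟩ y hy'⟩

theorem im_eq_zero_of_dense {g : ℂ → ℂ} (hc : ContinuousOn g {y | 0 ≤ y.im}) (c : Fin 8 → ℝ)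
    (hr : ∀ y : ℝ, (∀ j, y ≠ c j) → (g y).im = 0) (y : ℝ) : (g y).im = 0 := by
  have hcont : Continuous fun y : ℝ => (g y).im := Complex.continuous_im.comp
    (hc.comp_continuous Complex.continuous_ofReal im_ofReal_nonneg)
  have hd : Dense (Set.range c)ᶜ := (Set.finite_range c).countable.dense_compl ℝ
  exact congr_fun (hcont.ext_on hd continuous_const fun z hz =>
    hr z fun j hj => hz ⟨j, hj.symm⟩) y

theorem IsMon.exists_prod_polynomial (h : Good p q c x) (hc : StrictMono c) (hs : Sheets p q X)
    (hw : IsMon X c w) {S : Finset (Fin 5)} (hS : ∀ k, ∀ i ∈ S, w k i ∈ S) (t : ℝ) :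
    ∃ P : ℝ[X], ∀ y : ℂ, 0 ≤ y.im → ∏ i ∈ S, (t - X i y) = (cx P).eval y := by
  have hcont : ContinuousOn (fun y => ∏ i ∈ S, (t - X i y)) {y | 0 ≤ y.im} :=
    continuousOn_finsetProd _ fun i _ => continuousOn_const.sub (hs.cont i)
  obtain ⟨B, hB0, hB⟩ := hs.exists_norm_le h
  refine (exists_polynomial_of_upper hcont (fun y hy => ?_)
    (im_eq_zero_of_dense hcont c fun y hy => ?_) (B := (|t| + B) ^ S.card) (n := S.card)
    fun y hy => ?_).imp fun P hP => hP.2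
  · exact DifferentiableAt.fun_finsetProd fun i _ =>
      (differentiableAt_const _).sub (hs.differentiableAt h i hy)
  · obtain ⟨k, hk⟩ := hw.exists_conj h hc hs hy
    rw [← Complex.conj_eq_iff_im, map_prod]
    simp only [map_sub, Complex.conj_ofReal, hk]
    refine Finset.prod_nbij (w k) (hS k) (w k).injective.injOn ?_ fun i _ => rfl
    exact fun j hj => (Finset.surjOn_of_injOn_of_card_le _ (hS k) (w k).injective.injOn le_rfl) hj
  · rw [norm_prod, ← mul_pow, ← Finset.prod_const]
    refine Finset.prod_le_prod (fun _ _ => norm_nonneg _) fun i _ => ?_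
    refine (norm_sub_le _ _).trans ?_
    have := hB y hy i
    rw [Complex.norm_real, Real.norm_eq_abs]
    nlinarith [norm_nonneg y, abs_nonneg t]

theorem IsMon.transitive (h : Good p q c x) (hc : StrictMono c) (hs : Sheets p q X)
    (hw : IsMon X c w) {S : Finset (Fin 5)} (hS : ∀ k, ∀ i ∈ S, w k i ∈ S) :
    S = ∅ ∨ S = Finset.univ := by
  have hS' : ∀ k, ∀ i ∈ Sᶜ, w k i ∈ Sᶜ := by
    intro k i hi
    rw [Finset.mem_compl] at hi ⊢
    intro hwi
    apply hi
    have := hS k _ hwi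
    have h1 := (hw.walk h hc hs).inv k
    rwa [← Equiv.Perm.mul_apply, h1] at this
  choose a ha using hw.exists_prod_polynomial h hc hs hS
  choose b hb using hw.exists_prod_polynomial h hc hs hS'
  have hab : ∀ t : ℝ, a t * b t = C (p.eval t) - Polynomial.X * C (q.eval t) := by
    intro t
    apply Polynomial.map_injective (algebraMap ℝ ℂ) Complex.ofReal_injective
    refine Polynomial.eq_of_infinite_eval_eq _ _ ((Set.infinite_range_of_injective
      Complex.ofReal_injective).mono ?_)
    rintro _ ⟨y, rfl⟩
    change eval (y : ℂ) _ = eval (y : ℂ) _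
    rw [Polynomial.map_mul, eval_mul, ← ha t _ (im_ofReal_nonneg y), ← hb t _ (im_ofReal_nonneg y),
      Finset.prod_mul_prod_compl]
    have h1 := congr_arg (eval (t : ℂ)) (hs.fac y (im_ofReal_nonneg y))
    rw [eval_prod] at h1
    simp only [eval_sub, eval_X, eval_C] at h1
    rw [← h1, eval_fam, cx_eval_ofReal, cx_eval_ofReal]
    simp only [Polynomial.map_sub, Polynomial.map_mul, map_C, map_X, eval_sub, eval_mul, eval_C,
      eval_X, Complex.coe_algebraMap]
  have hdeg : ∀ t : ℝ, q.eval t ≠ 0 → (a t).natDegree = 0 ∨ (b t).natDegree = 0 := by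
    intro t ht
    have h1 : (a t * b t).natDegree = 1 := by
      rw [hab, natDegree_sub_eq_right_of_natDegree_lt] <;> simp [ht]
    have h2 : a t * b t ≠ 0 := by rintro h0; simp [h0] at h1
    rw [natDegree_mul (left_ne_zero_of_mul h2) (right_ne_zero_of_mul h2)] at h1
    omega
  have hinf : {t : ℝ | q.eval t ≠ 0}.Infinite := by
    have : {t : ℝ | q.eval t ≠ 0} = (q.rootSet ℝ : Set ℝ)ᶜ := by
      ext t; simp [mem_rootSet, h.q_ne_zero]
    rw [this]
    exact (q.rootSet_finite ℝ).infinite_compl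
  have key : ∀ (T : Finset (Fin 5)) (f : ℝ → ℝ[X]),
      (∀ t : ℝ, ∀ y : ℂ, 0 ≤ y.im → ∏ i ∈ T, (t - X i y) = (cx (f t)).eval y) →
      {t : ℝ | (f t).natDegree = 0}.Infinite → T = ∅ := by
    intro T f hf hfin
    by_contra hT
    obtain ⟨i, hi⟩ := Finset.nonempty_iff_ne_empty.2 hT
    have h1 : (0 : ℝ) ≤ Complex.I.im := by simp
    have h2 : (0 : ℝ) ≤ (2 * Complex.I).im := by simp
    have heq : ∏ i ∈ T, (Polynomial.X - C (X i Complex.I)) =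
        ∏ i ∈ T, (Polynomial.X - C (X i (2 * Complex.I))) := by
      refine Polynomial.eq_of_infinite_eval_eq _ _
        ((hfin.image (f := Complex.ofReal) Complex.ofReal_injective.injOn).mono ?_)
      rintro _ ⟨t, ht, rfl⟩
      change eval (t : ℂ) _ = eval (t : ℂ) _
      simp only [eval_prod, eval_sub, eval_X, eval_C]
      rw [hf t _ h1, hf t _ h2, eq_C_of_natDegree_eq_zero ht]
      simp
    have h3 := congr_arg (eval (X i Complex.I)) heq
    rw [eval_prod, eval_prod, Finset.prod_eq_zero hi (by simp)] at h3
    obtain ⟨j, -, hj⟩ := Finset.prod_eq_zero_iff.1 h3.symm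
    simp only [eval_sub, eval_X, eval_C, sub_eq_zero] at hj
    have e1 := hs.root h1 i
    have e2 := hs.root h2 j
    rw [← hj] at e2
    have hq := h.q_ne_of_fam e1
    rw [eval_fam] at e1 e2
    have : Complex.I * (cx q).eval (X i Complex.I) = 0 := by linear_combination e1 - e2
    exact mul_ne_zero Complex.I_ne_zero hq this
  have hu : {t : ℝ | (a t).natDegree = 0}.Infinite ∨ {t : ℝ | (b t).natDegree = 0}.Infinite := by
    rw [← Set.infinite_union]
    exact hinf.mono fun t ht => hdeg t ht
  rcases hu with hu | hu
  · exact Or.inl (key S a ha hu)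
  · exact Or.inr (Finset.compl_eq_empty_iff S |>.1 (key Sᶜ b hb hu))

end

section

variable {p q p' q' : ℝ[X]} {c x x' : Fin 8 → ℝ} {X X' : Fin 5 → ℂ → ℂ}
  {w : Fin 8 → Equiv.Perm (Fin 5)}

theorem IsMon.exists_sum_polynomial (h : Good p q c x) (hc : StrictMono c) (hs : Sheets p q X)
    (hw : IsMon X c w) (h' : Good p' q' c x') (hs' : Sheets p' q' X') (hw' : IsMon X' c w)
    (t : ℝ) : ∃ P : ℝ[X], P.natDegree ≤ 5 ∧ ∀ y : ℂ, 0 ≤ y.im →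
      ∑ i, X' i y * ∏ j ∈ Finset.univ.erase i, (t - X j y) = (cx P).eval y := by
  have hcont : ContinuousOn (fun y => ∑ i, X' i y * ∏ j ∈ Finset.univ.erase i, (t - X j y))
      {y | 0 ≤ y.im} :=
    continuousOn_finsetSum _ fun i _ => (hs'.cont i).mul
      (continuousOn_finsetProd _ fun j _ => continuousOn_const.sub (hs.cont j))
  obtain ⟨B, hB0, hB⟩ := hs.exists_norm_le h
  obtain ⟨B', hB0', hB'⟩ := hs'.exists_norm_le h'
  refine exists_polynomial_of_upper hcont (fun y hy => ?_)
    (im_eq_zero_of_dense hcont c fun y hy => ?_) (B := 5 * (B' * (|t| + B) ^ 4)) (n := 5)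
    fun y hy => ?_
  · exact DifferentiableAt.fun_sum fun i _ => (hs'.differentiableAt h' i hy).mul
      (DifferentiableAt.fun_finsetProd fun i _ =>
        (differentiableAt_const _).sub (hs.differentiableAt h i hy))
  · obtain ⟨k, hk, hk'⟩ : ∃ k, (∀ i, starRingEnd ℂ (X i y) = X (w k i) y) ∧
        ∀ i, starRingEnd ℂ (X' i y) = X' (w k i) y := by
      obtain ⟨k, hk, hy'⟩ := (exists_gap hc y).resolve_left fun ⟨j, hj⟩ => hy j hj
      rcases hk.eq_or_lt with rfl | hk
      · obtain ⟨y₀, hy₀⟩ := gap_nonempty hc (k := 7) (by norm_num)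
        exact ⟨0, (h.rotate_mon hc hs hw hy₀).2 y hy', (h'.rotate_mon hc hs' hw' hy₀).2 y hy'⟩
      · exact ⟨⟨k, hk⟩, hw ⟨k, hk⟩ y hy', hw' ⟨k, hk⟩ y hy'⟩
    rw [← Complex.conj_eq_iff_im, map_sum]
    simp only [map_mul, map_prod, map_sub, Complex.conj_ofReal, hk, hk']
    refine Fintype.sum_equiv (w k) _ _ fun i => ?_
    congr 1
    refine Finset.prod_nbij (w k) (fun j hj => ?_) (w k).injective.injOn (fun j hj => ?_)
      fun _ _ => rfl
    · simpa using hj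
    · refine ⟨(w k).symm j, ?_, by simp⟩
      simp only [Finset.coe_erase, Finset.coe_univ, Set.mem_sdiff, Set.mem_univ,
        Set.mem_singleton_iff, true_and] at hj ⊢
      rwa [Equiv.symm_apply_eq]
  · refine (norm_sum_le _ _).trans ?_
    have : ∀ i ∈ Finset.univ, ‖X' i y * ∏ j ∈ Finset.univ.erase i, (t - X j y)‖ ≤
        B' * (1 + ‖y‖) * ((|t| + B) * (1 + ‖y‖)) ^ 4 := by
      intro i _
      rw [norm_mul, norm_prod]
      refine mul_le_mul (hB' y hy i) ?_ (Finset.prod_nonneg fun _ _ => norm_nonneg _)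
        (by positivity)
      have h4 : (Finset.univ.erase i).card = 4 := by simp
      rw [← h4, ← Finset.prod_const]
      refine Finset.prod_le_prod (fun _ _ => norm_nonneg _) fun i _ => ?_
      refine (norm_sub_le _ _).trans ?_
      have := hB y hy i
      rw [Complex.norm_real, Real.norm_eq_abs]
      nlinarith [norm_nonneg y, abs_nonneg t]
    refine (Finset.sum_le_card_nsmul _ _ _ this).trans_eq ?_
    simp only [Finset.card_univ, Fintype.card_fin, nsmul_eq_mul]
    push_cast; ring

theorem degree_sum_C_mul_lt {R ι : Type*} [CommRing R] [Fintype ι] (n : ℕ) (a : ι → R)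
    (f : ι → R[X]) (hf : ∀ i, (f i).degree < n) : (∑ i, C (a i) * f i).degree < n := by
  rw [← mem_degreeLT]
  refine Submodule.sum_mem _ fun i _ => ?_
  rw [← smul_eq_C_mul]
  exact Submodule.smul_mem _ _ (mem_degreeLT.2 (hf i))

theorem IsMon.exists_fraction (h : Good p q c x) (hc : StrictMono c) (hs : Sheets p q X)
    (hw : IsMon X c w) (h' : Good p' q' c x') (hs' : Sheets p' q' X') (hw' : IsMon X' c w) :
    ∃ A B : ℝ[X], B ≠ 0 ∧ ∀ y : ℂ, 0 ≤ y.im → ∀ i,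
      (cx A).eval (X i y) = X' i y * (cx B).eval (X i y) := by
  choose m hm5 hm using hw.exists_sum_polynomial h hc hs h' hs' hw'
  let v : Fin 5 → ℝ := fun k => (k : ℕ)
  have hv : Function.Injective v := fun a b hab => by
    have : ((a : ℕ) : ℝ) = ((b : ℕ) : ℝ) := hab
    exact Fin.ext (by exact_mod_cast this)
  let L : Fin 5 → ℝ[X] := fun k => Lagrange.basis Finset.univ v k
  refine ⟨∑ k, hom 5 (m (v k)) p q * L k, wr p q * q ^ 4, ?_, fun y hy i => ?_⟩
  · refine mul_ne_zero ?_ (pow_ne_zero _ h.q_ne_zero)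
    rw [h.wr_eq]
    exact mul_ne_zero (C_ne_zero.2 h.pos.ne') (Finset.prod_ne_zero_iff.2 fun j _ => X_sub_C_ne_zero _)
  have hr := hs.root hy i
  have hq := h.q_ne_of_fam hr
  have hd : (derivative (fam p q y)).eval (X i y) = ∏ j ∈ Finset.univ.erase i, (X i y - X j y) := by
    rw [hs.fac y hy, prod_X_sub_C_eval_derivative (fun i => X i y)]
  have hM : ∑ i, C (X' i y) * ∏ j ∈ Finset.univ.erase i, (Polynomial.X - C (X j y)) =
      ∑ k, C ((cx (m (v k))).eval y) * cx (L k) := by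
    refine Polynomial.eq_of_degrees_lt_of_eval_index_eq Finset.univ (v := fun k => (v k : ℂ))
      (fun a _ b _ hab => hv (Complex.ofReal_injective hab)) ?_ ?_ fun k _ => ?_
    · refine degree_sum_C_mul_lt _ _ _ fun i => ?_
      rw [degree_prod]
      simp only [degree_X_sub_C, Finset.sum_const, Finset.card_univ, Fintype.card_fin,
        Finset.card_erase_of_mem (Finset.mem_univ _)]
      norm_num
    · refine degree_sum_C_mul_lt _ _ _ fun k => ?_
      refine degree_map_le.trans_lt ?_
      rw [Lagrange.degree_basis hv.injOn (Finset.mem_univ _)]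
      simp only [Finset.card_univ, Fintype.card_fin]
      norm_num
    · simp only [eval_finsetSum, eval_mul, eval_C, eval_prod, eval_sub, eval_X]
      rw [hm _ _ hy, Finset.sum_eq_single k, cx_eval_ofReal]
      · simp only [L]
        rw [Lagrange.eval_basis_self hv.injOn (Finset.mem_univ _)]; simp
      · intro l _ hl
        rw [cx_eval_ofReal]
        simp only [L]
        rw [Lagrange.eval_basis_of_ne hl (Finset.mem_univ _)]; simp
      · simp
  have h1 := congr_arg (eval (X i y)) hM
  simp only [eval_finsetSum, eval_mul, eval_C, eval_prod, eval_sub, eval_X] at h1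
  rw [Finset.sum_eq_single i, ← hd] at h1
  rotate_left
  · intro j _ hj
    rw [Finset.prod_eq_zero (i := i) (by simp [hj.symm]) (by simp), mul_zero]
  · simp
  have hy' : (cx p).eval (X i y) / (cx q).eval (X i y) = y := by
    rw [eval_fam] at hr
    rw [div_eq_iff hq]
    linear_combination hr
  have h2 : ∀ k, (cx (hom 5 (m (v k)) p q)).eval (X i y) =
      (cx q).eval (X i y) ^ 5 * (cx (m (v k))).eval y := by
    intro k
    rw [cx, map_hom, eval_hom (natDegree_map_le.trans (hm5 _)) hq, hy']
  have h3 : (cx (wr p q)).eval (X i y) =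
      (cx q).eval (X i y) * (derivative (fam p q y)).eval (X i y) := by
    rw [eval_fam] at hr
    rw [derivative_fam, eval_fam]
    simp only [wr, cx, Polynomial.map_sub, Polynomial.map_mul, eval_sub, eval_mul] at hr ⊢
    linear_combination (-1 : ℂ) * eval (X i y) (map (algebraMap ℝ ℂ) (derivative q)) * hr
  have h4 : (cx (∑ k, hom 5 (m (v k)) p q * L k)).eval (X i y) =
      (cx q).eval (X i y) ^ 5 * ∑ k, (cx (m (v k))).eval y * (cx (L k)).eval (X i y) := by
    rw [cx, Polynomial.map_sum, eval_finsetSum, Finset.mul_sum]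
    refine Finset.sum_congr rfl fun k _ => ?_
    rw [Polynomial.map_mul, eval_mul, h2 k]; ring
  rw [h4, ← h1]
  simp only [cx, Polynomial.map_mul, eval_mul, Polynomial.map_pow, eval_pow] at h3 ⊢
  rw [h3]
  ring

theorem Sheets.finite_bad (h : Good p q c x) (hs : Sheets p q X) {P : ℂ[X]} (hP : P ≠ 0) :
    {y : ℂ | 0 < y.im ∧ ∃ i, P.eval (X i y) = 0}.Finite := by
  refine ((P.rootSet_finite ℂ).image fun r => (cx p).eval r / (cx q).eval r).subset ?_
  rintro y ⟨hy, i, hi⟩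
  have hr := hs.root hy.le i
  refine ⟨X i y, by simpa [mem_rootSet, hP] using hi, ?_⟩
  have hq := h.q_ne_of_fam hr
  rw [eval_fam] at hr
  simp only
  rw [div_eq_iff hq]
  linear_combination hr

end

section

variable {p q p' q' : ℝ[X]} {c x x' : Fin 8 → ℝ} {X X' : Fin 5 → ℂ → ℂ}
  {w : Fin 8 → Equiv.Perm (Fin 5)}

theorem Sheets.eq_of_eq (h : Good p q c x) (hs : Sheets p q X) {y z : ℂ} (hy : 0 ≤ y.im)
    (hz : 0 ≤ z.im) {i j : Fin 5} (hij : X i y = X j z) : y = z := by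
  have e1 := hs.root hy i
  have e2 := hs.root hz j
  rw [← hij] at e2
  have hq := h.q_ne_of_fam e1
  rw [eval_fam] at e1 e2
  have : (y - z) * (cx q).eval (X i y) = 0 := by linear_combination e2 - e1
  exact sub_eq_zero.1 ((mul_eq_zero.1 this).resolve_right hq)

theorem infinite_upper : {y : ℂ | 0 < y.im}.Infinite := by
  refine (Set.infinite_range_of_injective
    (f := fun n : ℕ => ((n : ℂ) + Complex.I)) fun a b hab => ?_).mono ?_
  · simpa using hab
  · rintro _ ⟨n, rfl⟩; simp

theorem wr_ne_zero_of_isCoprime {A B : ℝ[X]} (hAB : IsCoprime A B)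
    (hn : A.natDegree ≠ 0 ∨ B.natDegree ≠ 0) : wr A B ≠ 0 := by
  intro h0
  rw [wr, sub_eq_zero] at h0
  have h1 : A ∣ derivative A := hAB.dvd_of_dvd_mul_right (h0 ▸ dvd_mul_right _ _)
  have h2 : B ∣ derivative B := hAB.symm.dvd_of_dvd_mul_left (h0 ▸ dvd_mul_left _ _)
  rw [dvd_derivative_iff] at h1 h2
  rcases hn with hn | hn
  · exact hn (derivative_eq_zero.1 h1)
  · exact hn (derivative_eq_zero.1 h2)

theorem eval_ne_zero_of_isCoprime {A B : ℝ[X]} (hco : IsCoprime A B) {r : ℂ}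
    (h1 : (cx B).eval r = 0) : (cx A).eval r ≠ 0 := by
  intro h2
  obtain ⟨u, v, huv⟩ := hco
  have := congr_arg (fun P => (cx P).eval r) huv
  simp only [cx, Polynomial.map_add, Polynomial.map_mul, eval_add, eval_mul, Polynomial.map_one,
    eval_one] at this h1 h2
  rw [h1, h2] at this
  simp at this

theorem cx_ne_zero {P : ℝ[X]} (hP : P ≠ 0) : cx P ≠ 0 :=
  (Polynomial.map_ne_zero_iff Complex.ofReal_injective).2 hP

theorem exists_coprime_factors (A₀ : ℝ[X]) {B₀ : ℝ[X]} (hB₀ : B₀ ≠ 0) :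
    ∃ A B G : ℝ[X], G ≠ 0 ∧ IsCoprime A B ∧ G * A = A₀ ∧ G * B = B₀ := by
  classical
  have hG : EuclideanDomain.gcd A₀ B₀ ≠ 0 :=
    fun h0 => hB₀ (EuclideanDomain.gcd_eq_zero_iff.1 h0).2
  obtain ⟨A, hA⟩ := EuclideanDomain.gcd_dvd_left A₀ B₀
  obtain ⟨B, hB⟩ := EuclideanDomain.gcd_dvd_right A₀ B₀
  refine ⟨A, B, _, hG, ⟨EuclideanDomain.gcdA A₀ B₀, EuclideanDomain.gcdB A₀ B₀, ?_⟩,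
    hA.symm, hB.symm⟩
  have h1 := EuclideanDomain.gcd_eq_gcd_ab A₀ B₀
  apply mul_left_cancel₀ hG
  linear_combination -h1 - EuclideanDomain.gcdA A₀ B₀ * hA - EuclideanDomain.gcdB A₀ B₀ * hB

theorem IsMon.exists_coprime_fraction (h : Good p q c x) (hc : StrictMono c) (hs : Sheets p q X)
    (hw : IsMon X c w) (h' : Good p' q' c x') (hs' : Sheets p' q' X') (hw' : IsMon X' c w) :
    ∃ A B G : ℝ[X], G ≠ 0 ∧ IsCoprime A B ∧ ∀ y : ℂ, 0 ≤ y.im → ∀ i, (cx G).eval (X i y) ≠ 0 →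
      (cx A).eval (X i y) = X' i y * (cx B).eval (X i y) := by
  obtain ⟨A₀, B₀, hB₀, hAB₀⟩ := hw.exists_fraction h hc hs h' hs' hw'
  obtain ⟨A, B, G, hG, hco, eA, eB⟩ := exists_coprime_factors A₀ hB₀
  refine ⟨A, B, G, hG, hco, fun y hy i hGi => ?_⟩
  have := hAB₀ y hy i
  rw [← eA, ← eB] at this
  simp only [cx, Polynomial.map_mul, eval_mul] at this hGi ⊢
  exact mul_left_cancel₀ hGi (by linear_combination this)

theorem Sheets.hom_eq_of_fraction (h : Good p q c x) (hs : Sheets p q X)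
    (h' : Good p' q' c x') (hs' : Sheets p' q' X') {A B G : ℝ[X]} (hG : G ≠ 0)
    (hco : IsCoprime A B) (hAB : ∀ y : ℂ, 0 ≤ y.im → ∀ i, (cx G).eval (X i y) ≠ 0 →
      (cx A).eval (X i y) = X' i y * (cx B).eval (X i y)) :
    hom 5 p' A B * q = hom 5 q' A B * p := by
  have hbadG := hs.finite_bad h (cx_ne_zero hG)
  apply Polynomial.map_injective (algebraMap ℝ ℂ) Complex.ofReal_injective
  refine Polynomial.eq_of_infinite_eval_eq _ _ (((infinite_upper.sdiff hbadG).image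
    (f := X 0) ?_).mono ?_)
  · rintro y ⟨hy, -⟩ z ⟨hz, -⟩ hyz
    exact hs.eq_of_eq h (le_of_lt hy) (le_of_lt hz) hyz
  · rintro _ ⟨y, ⟨hy, hy'⟩, rfl⟩
    have hy0 : 0 < y.im := hy
    have hGi : (cx G).eval (X 0 y) ≠ 0 := fun h0 => hy' ⟨hy, 0, h0⟩
    have h1 := hAB y hy0.le 0 hGi
    have hB : (cx B).eval (X 0 y) ≠ 0 := fun h0 => eval_ne_zero_of_isCoprime hco h0 (by rw [h1, h0, mul_zero])
    have h2 : (cx A).eval (X 0 y) / (cx B).eval (X 0 y) = X' 0 y := by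
      rw [h1, mul_div_assoc, div_self hB, mul_one]
    have e1 := eval_hom (n := 5) (p := cx p') (A := cx A) (natDegree_map_le.trans h'.degp.le) hB
    have e2 := eval_hom (n := 5) (p := cx q') (A := cx A)
      (natDegree_map_le.trans (h'.degq.le.trans (by norm_num))) hB
    rw [h2] at e1 e2
    change eval _ _ = eval _ _
    have e3 := hs.root hy0.le 0
    have e4 := hs'.root hy0.le 0
    rw [eval_fam] at e3 e4
    rw [Polynomial.map_mul, Polynomial.map_mul, eval_mul, eval_mul, map_hom, map_hom]
    simp only [cx] at e1 e2 e3 e4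
    rw [e1, e2]
    linear_combination (eval (X 0 y) (map (algebraMap ℝ ℂ) B)) ^ 5 *
      (eval (X 0 y) (map (algebraMap ℝ ℂ) q) * e4 - eval (X' 0 y) (map (algebraMap ℝ ℂ) q') * e3)

theorem Sheets.natDegree_fraction_ne_zero (h : Good p q c x) (hs : Sheets p q X)
    (h' : Good p' q' c x') (hs' : Sheets p' q' X') {A B G : ℝ[X]} (hG : G ≠ 0)
    (hco : IsCoprime A B) (hAB : ∀ y : ℂ, 0 ≤ y.im → ∀ i, (cx G).eval (X i y) ≠ 0 →
      (cx A).eval (X i y) = X' i y * (cx B).eval (X i y)) :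
    A.natDegree ≠ 0 ∨ B.natDegree ≠ 0 := by
  have hbadG := hs.finite_bad h (cx_ne_zero hG)
  have hX' : Set.InjOn (X' 0) {y | 0 < y.im} := fun y hy z hz hyz =>
    hs'.eq_of_eq h' (le_of_lt hy) (le_of_lt hz) hyz
  by_contra! hcon
  obtain ⟨α, hα⟩ := natDegree_eq_zero.1 hcon.1
  obtain ⟨β, hβ⟩ := natDegree_eq_zero.1 hcon.2
  have hinf := (infinite_upper.sdiff hbadG).image (f := X' 0) (hX'.mono Set.sdiff_subset)
  refine hinf ((Set.finite_singleton ((α : ℂ) / β)).subset ?_)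
  rintro _ ⟨y, ⟨hy, hy'⟩, rfl⟩
  have hy0 : 0 < y.im := hy
  have h1 := hAB y hy0.le 0 fun h0 => hy' ⟨hy, 0, h0⟩
  have hB := eval_ne_zero_of_isCoprime hco (r := X 0 y)
  rw [← hα, ← hβ] at h1 hB
  simp only [cx, map_C, eval_C, Complex.coe_algebraMap] at h1 hB
  rw [h1] at hB
  have hβ0 : (β : ℂ) ≠ 0 := fun h0 => hB h0 (by rw [h0, mul_zero])
  rw [Set.mem_singleton_iff, h1, mul_div_assoc, div_self hβ0, mul_one]

theorem Sheets.natDegree_fraction_le (h : Good p q c x) (hs : Sheets p q X)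
    (h' : Good p' q' c x') (hs' : Sheets p' q' X') {A B G : ℝ[X]} (hG : G ≠ 0)
    (hco : IsCoprime A B) (hAB : ∀ y : ℂ, 0 ≤ y.im → ∀ i, (cx G).eval (X i y) ≠ 0 →
      (cx A).eval (X i y) = X' i y * (cx B).eval (X i y)) (hW : wr A B ≠ 0)
    (hid : hom 5 p' A B * q = hom 5 q' A B * p) {d : ℕ} (hd : d = max A.natDegree B.natDegree) :
    d ≤ 1 := by
  have hbadG := hs.finite_bad h (cx_ne_zero hG)
  have hbadW := hs.finite_bad h (cx_ne_zero hW)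
  have hX' : Set.InjOn (X' 0) {y | 0 < y.im} := fun y hy z hz hyz =>
    hs'.eq_of_eq h' (le_of_lt hy) (le_of_lt hz) hyz
  by_contra! hd2
  have hcoef : A.coeff d ≠ 0 ∨ B.coeff d ≠ 0 := by
    rcases max_choice A.natDegree B.natDegree with h0 | h0
    · left; rw [hd, h0]; exact leadingCoeff_ne_zero.2 fun h1 => by
        rw [hd, h0, h1, natDegree_zero] at hd2; omega
    · right; rw [hd, h0]; exact leadingCoeff_ne_zero.2 fun h1 => by
        rw [hd, h0, h1, natDegree_zero] at hd2; omega
  have hbadD : {y : ℂ | 0 < y.im ∧ (A.coeff d : ℂ) = X' 0 y * B.coeff d}.Finite := by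
    refine Set.Finite.of_finite_image ((Set.finite_singleton
      ((A.coeff d : ℂ) / B.coeff d)).subset ?_) (f := X' 0) (hX'.mono fun y hy => hy.1)
    rintro _ ⟨y, ⟨-, hy⟩, rfl⟩
    have hB : (B.coeff d : ℂ) ≠ 0 := by
      intro h0
      rw [h0, mul_zero] at hy
      rcases hcoef with h1 | h1
      · exact h1 (by exact_mod_cast hy)
      · exact h1 (by exact_mod_cast h0)
    rw [Set.mem_singleton_iff, hy, mul_div_assoc, div_self hB, mul_one]
  obtain ⟨y, hy, hy'⟩ := (infinite_upper.sdiff ((hbadG.union hbadW).union hbadD)).nonempty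
  have hy0 : 0 < y.im := hy
  have hG' : ∀ i, (cx G).eval (X i y) ≠ 0 := fun i h0 => hy' (Or.inl (Or.inl ⟨hy, i, h0⟩))
  have hW' : ∀ i, (cx (wr A B)).eval (X i y) ≠ 0 := fun i h0 =>
    hy' (Or.inl (Or.inr ⟨hy, i, h0⟩))
  have hD' : (A.coeff d : ℂ) ≠ X' 0 y * B.coeff d := fun h0 => hy' (Or.inr ⟨hy, h0⟩)
  set s := X' 0 y with hs0
  set F : ℂ[X] := cx A - C s * cx B with hF
  have hFd : F.natDegree = d := by
    refine le_antisymm ?_ (le_natDegree_of_ne_zero ?_)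
    · refine (natDegree_sub_le _ _).trans (hd ▸ max_le_max natDegree_map_le ?_)
      exact (natDegree_C_mul_le _ _).trans natDegree_map_le
    · simpa [hF, sub_eq_zero] using hD'
  have hroot : ∀ r, F.eval r = 0 → r = X 0 y := by
    intro r hr
    have hr' : (cx A).eval r = s * (cx B).eval r := by
      simpa [hF, sub_eq_zero] using hr
    have hB : (cx B).eval r ≠ 0 := fun h0 => eval_ne_zero_of_isCoprime hco h0 (by rw [hr', h0, mul_zero])
    have h2 : (cx A).eval r / (cx B).eval r = s := by
      rw [hr', mul_div_assoc, div_self hB, mul_one]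
    have e1 := eval_hom (n := 5) (p := cx p') (A := cx A) (natDegree_map_le.trans h'.degp.le) hB
    have e2 := eval_hom (n := 5) (p := cx q') (A := cx A)
      (natDegree_map_le.trans (h'.degq.le.trans (by norm_num))) hB
    rw [h2] at e1 e2
    have e3 := congr_arg (fun P => (cx P).eval r) hid
    simp only [cx, Polynomial.map_mul, eval_mul, map_hom] at e1 e2 e3
    rw [e1, e2] at e3
    have e4 := hs'.root hy0.le 0
    have hq' : (cx q').eval s ≠ 0 := h'.q_ne_of_fam e4
    rw [eval_fam] at e4
    have e5 : (fam p q y).eval r = 0 := by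
      rw [eval_fam]
      have : (cx B).eval r ^ 5 * (cx q').eval s * ((cx p).eval r - y * (cx q).eval r) = 0 := by
        simp only [cx] at e4 ⊢
        linear_combination (eval r (map (algebraMap ℝ ℂ) B)) ^ 5 *
          eval r (map (algebraMap ℝ ℂ) q) * e4 - e3
      exact (mul_eq_zero.1 this).resolve_left (mul_ne_zero (pow_ne_zero _ hB) hq')
    obtain ⟨i, rfl⟩ := hs.exists_eq hy0.le e5
    have h5 := hAB y hy0.le i (hG' i)
    rw [hr'] at h5
    have h6 : X' 0 y = X' i y := mul_right_cancel₀ hB h5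
    rw [hs'.injective h' hy0.le (ne_of_im_pos hy0) h6]
  have hF0 : F.eval (X 0 y) = 0 := by
    simp only [hF, eval_sub, eval_mul, eval_C, hAB y hy0.le 0 (hG' 0), sub_self, s]
  obtain ⟨R, hR⟩ := dvd_iff_isRoot.2 hF0
  have hR0 : R ≠ 0 := by rintro rfl; rw [mul_zero] at hR; rw [hR, natDegree_zero] at hFd; omega
  have hRd : R.degree ≠ 0 := by
    have h1 := congr_arg natDegree hR
    rw [natDegree_mul (X_sub_C_ne_zero _) hR0, natDegree_X_sub_C, hFd] at h1
    intro h2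
    rw [natDegree_eq_zero_iff_degree_le_zero.2 h2.le] at h1
    omega
  obtain ⟨r, hr⟩ := IsAlgClosed.exists_root R hRd
  have hr0 : r = X 0 y := hroot r (by rw [hR, eval_mul, hr.eq_zero, mul_zero])
  rw [hr0] at hr
  have hder : (derivative F).eval (X 0 y) = 0 := by
    rw [hR]; simp [hr.eq_zero]
  apply hW' 0
  have h7 := hAB y hy0.le 0 (hG' 0)
  simp only [hF, cx, derivative_sub, derivative_C_mul, derivative_map, eval_sub, eval_mul,
    eval_C] at hder
  simp only [cx, wr, Polynomial.map_sub, Polynomial.map_mul, eval_sub, eval_mul] at h7 ⊢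
  linear_combination eval (X 0 y) (map (algebraMap ℝ ℂ) B) * hder -
    eval (X 0 y) (map (algebraMap ℝ ℂ) (derivative B)) * h7

/-- Generic pairs with the same critical values and the same monodromy differ by a Möbius change
of variable. -/
theorem IsMon.exists_moebius (h : Good p q c x) (hc : StrictMono c) (hs : Sheets p q X)
    (hw : IsMon X c w) (h' : Good p' q' c x') (hs' : Sheets p' q' X') (hw' : IsMon X' c w) :
    ∃ a b e d : ℝ, a * d - b * e ≠ 0 ∧
      hom 5 p' (C a * Polynomial.X + C b) (C e * Polynomial.X + C d) * q =
        hom 5 q' (C a * Polynomial.X + C b) (C e * Polynomial.X + C d) * p := by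
  obtain ⟨A, B, G, hG, hco, hAB⟩ := hw.exists_coprime_fraction h hc hs h' hs' hw'
  have hid := hs.hom_eq_of_fraction h h' hs' hG hco hAB
  have hW := wr_ne_zero_of_isCoprime hco (hs.natDegree_fraction_ne_zero h h' hs' hG hco hAB)
  have hd := hs.natDegree_fraction_le h h' hs' hG hco hAB hW hid rfl
  have hA1 := eq_X_add_C_of_natDegree_le_one ((le_max_left _ _).trans hd)
  have hB1 := eq_X_add_C_of_natDegree_le_one ((le_max_right _ _).trans hd)
  refine ⟨A.coeff 1, A.coeff 0, B.coeff 1, B.coeff 0, fun h0 => hW ?_, ?_⟩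
  · rw [wr, hA1, hB1]
    have : C (A.coeff 1 * B.coeff 0 - A.coeff 0 * B.coeff 1) = 0 := by rw [h0, C_0]
    simp only [C_sub, C_mul] at this
    simp only [derivative_add, derivative_mul, derivative_C, derivative_X]
    linear_combination this
  · rw [← hA1, ← hB1]; exact hid

end

section

variable {ι : Type*} {l : Filter ι} {P Q : ι → ℝ[X]} {p q : ℝ[X]} {c x : Fin 8 → ℝ}
  {X : Fin 5 → ℂ → ℂ} {w : Fin 8 → Equiv.Perm (Fin 5)}

/-- Coefficientwise convergence of pairs `P n, Q n` to `p, q`. -/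
structure Lim (l : Filter ι) (P Q : ι → ℝ[X]) (p q : ℝ[X]) : Prop where
  pre : Pre p q
  pre_seq : ∀ᶠ n in l, Pre (P n) (Q n)
  limp : ∀ i, Tendsto (fun n => (P n).coeff i) l (𝓝 (p.coeff i))
  limq : ∀ i, Tendsto (fun n => (Q n).coeff i) l (𝓝 (q.coeff i))

theorem Pre.eval_fam_eq (h : Pre p q) (y r : ℂ) : (fam p q y).eval r =
    ∑ i ∈ Finset.range 6, ((p.coeff i : ℂ) - y * q.coeff i) * r ^ i := by
  rw [eval_eq_sum_range' (n := 6) (by rw [h.fam_natDegree]; norm_num)]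
  refine Finset.sum_congr rfl fun i _ => ?_
  simp [fam, cx]

namespace Lim

theorem eventually_sub_lt (h : Lim l P Q p q) (R : ℝ) {ε : ℝ} (hε : 0 < ε) :
    ∀ᶠ n in l, ∀ y r : ℂ, ‖y‖ ≤ R → ‖r‖ ≤ R →
      ‖(fam (P n) (Q n) y).eval r - (fam p q y).eval r‖ < ε := by
  have h0 : Tendsto (fun n => ∑ i ∈ Finset.range 6, (|(P n).coeff i - p.coeff i| +
      R * |(Q n).coeff i - q.coeff i|) * R ^ i) l (𝓝 0) := by
    have : (0 : ℝ) = ∑ i ∈ Finset.range 6, (|p.coeff i - p.coeff i| +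
      R * |q.coeff i - q.coeff i|) * R ^ i := by simp
    rw [this]
    refine tendsto_finsetSum _ fun i _ => Tendsto.mul_const _ (Tendsto.add ?_ ?_)
    · exact ((h.limp i).sub_const _).abs
    · exact (((h.limq i).sub_const _).abs).const_mul _
  filter_upwards [h.pre_seq, h0.eventually (gt_mem_nhds hε)] with n hn hlt y r hy hr
  refine lt_of_le_of_lt ?_ hlt
  rw [hn.eval_fam_eq, h.pre.eval_fam_eq, ← Finset.sum_sub_distrib]
  refine (norm_sum_le _ _).trans (Finset.sum_le_sum fun i _ => ?_)
  have e : (((P n).coeff i : ℂ) - y * (Q n).coeff i) * r ^ i -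
      ((p.coeff i : ℂ) - y * q.coeff i) * r ^ i =
      ((((P n).coeff i - p.coeff i : ℝ) : ℂ) - y * (((Q n).coeff i - q.coeff i : ℝ) : ℂ)) *
        r ^ i := by push_cast; ring
  rw [e, norm_mul, norm_pow]
  have hR : 0 ≤ R := (norm_nonneg _).trans hy
  gcongr
  refine (norm_sub_le _ _).trans ?_
  rw [norm_mul, Complex.norm_real, Complex.norm_real, Real.norm_eq_abs, Real.norm_eq_abs]
  gcongr

theorem exists_bound (h : Lim l P Q p q) : ∃ B : ℝ, 0 ≤ B ∧ ∀ᶠ n in l, ∀ y r : ℂ,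
    (fam (P n) (Q n) y).eval r = 0 → ‖r‖ ≤ 1 + B * (1 + ‖y‖) := by
  refine ⟨∑ i ∈ Finset.range 5, ((|p.coeff i| + 1) + (|q.coeff i| + 1)), by positivity, ?_⟩
  have hp : ∀ᶠ n in l, ∀ i ∈ Finset.range 5, |(P n).coeff i| < |p.coeff i| + 1 :=
    (eventually_all_finset _).2 fun i _ => (h.limp i).abs.eventually (gt_mem_nhds (lt_add_one _))
  have hq : ∀ᶠ n in l, ∀ i ∈ Finset.range 5, |(Q n).coeff i| < |q.coeff i| + 1 :=
    (eventually_all_finset _).2 fun i _ => (h.limq i).abs.eventually (gt_mem_nhds (lt_add_one _))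
  filter_upwards [h.pre_seq, hp, hq] with n hn hp hq y r hr
  have hb : ∀ i < 5, (|p.coeff i| + 1) + (|q.coeff i| + 1) ≤
      ∑ i ∈ Finset.range 5, ((|p.coeff i| + 1) + (|q.coeff i| + 1)) := fun i hi =>
    Finset.single_le_sum (f := fun i => (|p.coeff i| + 1) + (|q.coeff i| + 1))
      (fun i _ => by positivity) (Finset.mem_range.2 hi)
  refine hn.norm_root_le (by positivity) (fun i hi => ?_) (fun i hi => ?_) hr
  · have := hp i (Finset.mem_range.2 hi)
    linarith [hb i hi, abs_nonneg (q.coeff i)]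
  · have := hq i (Finset.mem_range.2 hi)
    linarith [hb i hi, abs_nonneg (p.coeff i)]

theorem eventually_of_root (h : Lim l P Q p q) (R : ℝ) {ε : ℝ} (hε : 0 < ε) :
    ∀ᶠ n in l, ∀ y r : ℂ, ‖y‖ ≤ R → (fam (P n) (Q n) y).eval r = 0 →
      ‖(fam p q y).eval r‖ < ε := by
  obtain ⟨B, hB, hb⟩ := h.exists_bound
  filter_upwards [hb, h.eventually_sub_lt (max R (1 + B * (1 + R))) hε] with n hb hn y r hy hr
  have h1 : ‖r‖ ≤ 1 + B * (1 + R) := (hb y r hr).trans (by gcongr)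
  have := hn y r (hy.trans (le_max_left _ _)) (h1.trans (le_max_right _ _))
  rwa [hr, zero_sub, norm_neg] at this

theorem eventually_of_root' (h : Lim l P Q p q) (R : ℝ) {ε : ℝ} (hε : 0 < ε) :
    ∀ᶠ n in l, ∀ y r : ℂ, ‖y‖ ≤ R → (fam p q y).eval r = 0 →
      ‖(fam (P n) (Q n) y).eval r‖ < ε := by
  obtain ⟨B, hB, hb⟩ := h.pre.exists_norm_root_le
  filter_upwards [h.eventually_sub_lt (max R (1 + B * (1 + R))) hε] with n hn y r hy hr
  have h1 : ‖r‖ ≤ 1 + B * (1 + R) := (hb y r hr).trans (by gcongr)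
  have := hn y r (hy.trans (le_max_left _ _)) (h1.trans (le_max_right _ _))
  rwa [hr, sub_zero] at this

end Lim

/-- The union of the segments joining a hub `h` to the real points `y k`. -/
def hubStar (h : ℂ) (y : Fin 8 → ℝ) : Set ℂ := ⋃ k, segment ℝ h (y k : ℂ)

theorem isCompact_hubStar (h : ℂ) (y : Fin 8 → ℝ) : IsCompact (hubStar h y) := by
  refine isCompact_iUnion fun k => ?_
  rw [← convexHull_pair (𝕜 := ℝ)]
  exact Set.Finite.isCompact_convexHull (𝕜 := ℝ) (Set.toFinite _)

theorem isPreconnected_hubStar (h : ℂ) (y : Fin 8 → ℝ) : IsPreconnected (hubStar h y) :=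
  isPreconnected_iUnion ⟨h, Set.mem_iInter.2 fun _ => left_mem_segment ℝ _ _⟩
    fun k => (convex_segment h (y k : ℂ)).isPreconnected

theorem hub_mem_hubStar (h : ℂ) (y : Fin 8 → ℝ) : h ∈ hubStar h y :=
  Set.mem_iUnion.2 ⟨0, left_mem_segment ℝ _ _⟩

theorem tip_mem_hubStar (h : ℂ) (y : Fin 8 → ℝ) (k : Fin 8) : (y k : ℂ) ∈ hubStar h y :=
  Set.mem_iUnion.2 ⟨k, right_mem_segment ℝ _ _⟩

theorem mem_hubStar {h z : ℂ} (hh : 0 < h.im) {y : Fin 8 → ℝ} (hz : z ∈ hubStar h y) :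
    (∃ k, z = y k) ∨ 0 < z.im ∧ z.im ≤ h.im := by
  obtain ⟨k, a, b, ha, hb, hab, rfl⟩ := Set.mem_iUnion.1 hz
  rcases ha.eq_or_lt with rfl | ha
  · left; refine ⟨k, ?_⟩
    rw [zero_add] at hab; simp [hab]
  · right
    have : a ≤ 1 := by linarith
    simp only [Complex.add_im, Complex.smul_im, Complex.ofReal_im, smul_eq_mul, mul_zero, add_zero]
    exact ⟨by positivity, by nlinarith⟩

theorem im_nonneg_of_mem_hubStar {h z : ℂ} (hh : 0 < h.im) {y : Fin 8 → ℝ}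
    (hz : z ∈ hubStar h y) : 0 ≤ z.im := by
  rcases mem_hubStar hh hz with ⟨k, rfl⟩ | h1
  · simp
  · exact h1.1.le

theorem isOpen_gap (c : Fin 8 → ℝ) (k : ℕ) : IsOpen (gap c k) := by
  simp only [gap, Set.ofPred_and, Set.ofPred_forall]
  exact (isOpen_iInter_of_finite fun j => isOpen_iInter_of_finite fun _ =>
    isOpen_lt continuous_const continuous_id).inter
      (isOpen_iInter_of_finite fun j => isOpen_iInter_of_finite fun _ =>
    isOpen_lt continuous_id continuous_const)

theorem exists_hubStar (hc : StrictMono c) {bad : Set ℂ} (hbad : bad.Finite) :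
    ∃ (h : ℂ) (y : Fin 8 → ℝ), 0 < h.im ∧ (∀ k : Fin 8, y k ∈ gap c k) ∧
      ∀ z ∈ hubStar h y, z ∉ bad := by
  have h1 : ∀ k : Fin 8, ∃ y ∈ gap c k, (y : ℂ) ∉ bad := by
    intro k
    obtain ⟨y, hy⟩ := gap_nonempty hc k.2.le
    have hinf := infinite_of_mem_nhds y ((isOpen_gap c k).mem_nhds hy)
    obtain ⟨z, hz, hz'⟩ := (hinf.sdiff (hbad.preimage
      Complex.ofReal_injective.injOn)).nonempty
    exact ⟨z, hz, hz'⟩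
  choose y hy hyb using h1
  have h2 : ∀ᶠ t : ℝ in 𝓝[>] 0, 0 < t ∧ ∀ b ∈ bad, 0 < b.im → t < b.im := by
    refine (eventually_mem_nhdsWithin).and ((eventually_all_finite hbad).2 fun b _ => ?_)
    by_cases hb : 0 < b.im
    · filter_upwards [nhdsWithin_le_nhds (gt_mem_nhds hb)] with t ht _ using ht
    · simp [hb]
  obtain ⟨t, ht, htb⟩ := h2.exists
  have hi : (t * Complex.I : ℂ).im = t := by simp
  refine ⟨t * Complex.I, y, by rwa [hi], hy, fun z hz hzb => ?_⟩
  rcases mem_hubStar (by rwa [hi]) hz with ⟨k, rfl⟩ | ⟨h3, h4⟩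
  · exact hyb k hzb
  · rw [hi] at h4
    exact (htb z hzb h3).not_ge h4

theorem exists_pos_le_of_isCompact {α : Type*} [TopologicalSpace α] {K : Set α}
    (hK : IsCompact K) {f : α → ℝ}
    (hf : ContinuousOn f K) (hpos : ∀ y ∈ K, 0 < f y) : ∃ δ > 0, ∀ y ∈ K, δ ≤ f y := by
  rcases K.eq_empty_or_nonempty with rfl | hne
  · exact ⟨1, one_pos, by simp⟩
  · obtain ⟨y, hy, hm⟩ := hK.exists_isMinOn hne hf
    exact ⟨f y, hpos y hy, fun z hz => hm hz⟩

theorem lt_of_isPreconnected {K : Set ℂ} (hK : IsPreconnected K) {f : ℂ → ℝ}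
    (hf : ContinuousOn f K) {δ : ℝ} (hne : ∀ y ∈ K, f y ≠ δ) {a b : ℂ} (ha : a ∈ K) (hb : b ∈ K)
    (h : f a < δ) : f b < δ := by
  by_contra! hcon
  obtain ⟨y, hy, hy'⟩ := hK.intermediate_value ha hb hf ⟨h.le, hcon⟩
  exact hne y hy hy'

end

section

variable {ι : Type*} {l : Filter ι} {P Q : ι → ℝ[X]} {p q : ℝ[X]} {c x : Fin 8 → ℝ}
  {X : Fin 5 → ℂ → ℂ} {w : Fin 8 → Equiv.Perm (Fin 5)}

theorem hubStar_subset {h : ℂ} (hh : 0 < h.im) (y : Fin 8 → ℝ) :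
    hubStar h y ⊆ {z : ℂ | 0 ≤ z.im} :=
  fun _ hz => im_nonneg_of_mem_hubStar hh hz

theorem eventually_mem_gap {cN : ι → Fin 8 → ℝ} (hcN : Tendsto cN l (𝓝 c)) {y : ℝ} {k : ℕ}
    (hy : y ∈ gap c k) : ∀ᶠ n in l, y ∈ gap (cN n) k := by
  have ht : ∀ j, Tendsto (fun n => cN n j) l (𝓝 (c j)) := fun j => (tendsto_pi_nhds.1 hcN) j
  refine ((eventually_all.2 fun j => ?_).and (eventually_all.2 fun j => ?_))
  · by_cases hj : (j : ℕ) < k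
    · filter_upwards [(ht j).eventually (gt_mem_nhds (hy.1 j hj))] with n hn _ using hn
    · simp [hj]
  · by_cases hj : k ≤ (j : ℕ)
    · filter_upwards [(ht j).eventually (lt_mem_nhds (hy.2 j hj))] with n hn _ using hn
    · simp [hj]

theorem Good.exists_separation (h : Good p q c x) (hs : Sheets p q X) {K : Set ℂ}
    (hK : IsCompact K) (hK0 : K ⊆ {z : ℂ | 0 ≤ z.im}) (hKc : ∀ z ∈ K, ∀ j, z ≠ c j) :
    ∃ δ > 0, ∀ i j, i ≠ j → ∀ z ∈ K, 3 * δ ≤ dist (X i z) (X j z) := by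
  have h1 : ∀ᶠ δ : ℝ in 𝓝[>] 0, ∀ i j, i ≠ j → ∀ z ∈ K, 3 * δ ≤ dist (X i z) (X j z) := by
    refine eventually_all.2 fun i => eventually_all.2 fun j => ?_
    by_cases hij : i = j
    · simp [hij]
    obtain ⟨δ, hδ, hδ'⟩ := exists_pos_le_of_isCompact hK
      (f := fun z => dist (X i z) (X j z))
      (continuous_dist.comp_continuousOn (((hs.cont i).mono hK0).prodMk ((hs.cont j).mono hK0)))
      (fun z hz => dist_pos.2 fun he => hij (hs.injective h (hK0 hz) (hKc z hz) he))
    filter_upwards [nhdsWithin_le_nhds (gt_mem_nhds (show (0 : ℝ) < δ / 3 by positivity))]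
      with t ht _ z hz
    linarith [hδ' z hz]
  obtain ⟨δ, h2, h3⟩ := (h1.and eventually_mem_nhdsWithin).exists
  exact ⟨δ, h3, h2⟩

/-- Two systems of functions that are uniformly close on a hub star, one of them well
separated. -/
theorem exists_perm_of_close {X' : Fin 5 → ℂ → ℂ} {h : ℂ} {y : Fin 8 → ℝ} {δ : ℝ} (hδ : 0 < δ)
    (hX : ∀ i, ContinuousOn (X i) (hubStar h y)) (hX' : ∀ i, ContinuousOn (X' i) (hubStar h y))
    (hsep : ∀ i j, i ≠ j → ∀ z ∈ hubStar h y, 3 * δ ≤ dist (X i z) (X j z))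
    (h1 : ∀ i, ∀ z ∈ hubStar h y, ∃ j, dist (X' i z) (X j z) < δ)
    (h2 : ∀ j, ∀ z ∈ hubStar h y, ∃ i, dist (X j z) (X' i z) < δ) :
    ∃ ρ : Equiv.Perm (Fin 5), ∀ i, ∀ z ∈ hubStar h y, dist (X' i z) (X (ρ i) z) < 3 / 2 * δ := by
  have hh := hub_mem_hubStar h y
  choose ρ hρ using fun i => h1 i h hh
  have hsur : Function.Surjective ρ := by
    intro j
    obtain ⟨i, hi⟩ := h2 j h hh
    refine ⟨i, ?_⟩
    by_contra hne
    have := hsep j (ρ i) (Ne.symm hne) h hh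
    linarith [dist_triangle (X j h) (X' i h) (X (ρ i) h), hρ i]
  refine ⟨Equiv.ofBijective ρ (Finite.injective_iff_surjective.2 hsur |>.bijective_of_finite),
    fun i z hz => ?_⟩
  refine lt_of_isPreconnected (isPreconnected_hubStar h y)
    (f := fun z => dist (X' i z) (X (ρ i) z)) (continuous_dist.comp_continuousOn ((hX' i).prodMk (hX _))) (fun z hz he => ?_) hh hz
    (by show dist (X' i h) (X (ρ i) h) < _; linarith [hρ i])
  obtain ⟨j, hj⟩ := h1 i z hz
  by_cases hji : j = ρ i
  · rw [hji, he] at hj; linarith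
  · have := hsep j (ρ i) hji z hz
    have h3 := dist_triangle (X j z) (X' i z) (X (ρ i) z)
    rw [dist_comm (X j z) (X' i z)] at h3
    linarith

theorem Lim.eventually_isMon (hL : Lim l P Q p q) (h : Good p q c x) (hc : StrictMono c)
    (hs : Sheets p q X) (hw : IsMon X c w) {cN : ι → Fin 8 → ℝ} (hcN : Tendsto cN l (𝓝 c)) :
    ∀ᶠ n in l, ∀ x' X', StrictMono (cN n) → Good (P n) (Q n) (cN n) x' → Sheets (P n) (Q n) X' →
      ∃ ρ : Equiv.Perm (Fin 5), IsMon X' (cN n) fun k => ρ⁻¹ * w k * ρ := by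
  obtain ⟨h₀, y, hh, hy, hbad⟩ := exists_hubStar hc (Set.finite_range fun j => (c j : ℂ))
  have hK0 := hubStar_subset hh y
  have hKc := isCompact_hubStar h₀ y
  obtain ⟨δ, hδ, hsep⟩ := h.exists_separation hs hKc hK0
    (fun z hz j he => hbad z hz ⟨j, he.symm⟩)
  obtain ⟨R, hR⟩ := hKc.isBounded.exists_norm_le
  have hδ5 : 0 < δ ^ 5 := by positivity
  filter_upwards [hL.pre_seq, hL.eventually_of_root R hδ5, hL.eventually_of_root' R hδ5,
    eventually_all.2 fun k : Fin 8 => eventually_mem_gap hcN (hy k)]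
    with n hpre hn1 hn2 hn3 x' X' hcn h' hs'
  obtain ⟨ρ, hρ⟩ := exists_perm_of_close (X := X) (X' := X') (h := h₀) (y := y) hδ
    (fun i => (hs.cont i).mono hK0) (fun i => (hs'.cont i).mono hK0) hsep
    (fun i z hz => by
      have h1 := hn1 z (X' i z) (hR z hz) (hs'.root (hK0 hz) i)
      rw [← hL.pre.fam_natDegree z] at h1
      obtain ⟨r, hr, hr'⟩ := exists_root_near (hL.pre.fam_monic z) hδ.le h1
      obtain ⟨j, rfl⟩ := hs.exists_eq (hK0 hz) hr
      exact ⟨j, hr'⟩)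
    (fun i z hz => by
      have h1 := hn2 z (X i z) (hR z hz) (hs.root (hK0 hz) i)
      rw [← hpre.fam_natDegree z] at h1
      obtain ⟨r, hr, hr'⟩ := exists_root_near (hpre.fam_monic z) hδ.le h1
      obtain ⟨j, rfl⟩ := hs'.exists_eq (hK0 hz) hr
      exact ⟨j, hr'⟩)
  refine ⟨ρ, IsMon.of_mem h' hcn hs' fun k => ⟨y k, hn3 k, fun i => ?_⟩⟩
  obtain ⟨j, hj⟩ := hs'.exists_conj (y k) i
  have hk := tip_mem_hubStar h₀ y k
  have e : w k (ρ i) = ρ j := by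
    by_contra hne
    have h1 := hsep _ _ hne _ hk
    have h2 := hρ i _ hk
    have h3 := hρ j _ hk
    rw [← Complex.dist_conj_conj, hj, hw k _ (hy k), dist_comm] at h2
    linarith [dist_triangle (X (w k (ρ i)) (y k)) (X' j (y k)) (X (ρ j) (y k))]
  rw [hj]
  simp [e]

end

section

variable {ι : Type*} {l : Filter ι} {P Q : ι → ℝ[X]} {p q : ℝ[X]} {c x : Fin 8 → ℝ}
  {X : Fin 5 → ℂ → ℂ} {w : Fin 8 → Equiv.Perm (Fin 5)}

theorem cx_eval_conj (p : ℝ[X]) (r : ℂ) :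
    (cx p).eval (starRingEnd ℂ r) = starRingEnd ℂ ((cx p).eval r) := by
  have := fam_conj p 0 0 r
  simpa [fam, cx] using this

theorem fam_mul (G p q : ℝ[X]) (y : ℂ) : fam (G * p) (G * q) y = cx G * fam p q y := by
  simp only [fam, cx, Polynomial.map_mul]; ring

theorem finite_common (G p q : ℝ[X]) (hG : G ≠ 0)
    (hcop : ∀ r : ℂ, (cx G).eval r = 0 → (cx p).eval r = 0 → (cx q).eval r ≠ 0) :
    {y : ℂ | ∃ r, (cx G).eval r = 0 ∧ (fam p q y).eval r = 0}.Finite := by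
  have hG' : cx G ≠ 0 := cx_ne_zero hG
  refine (((cx G).roots.toFinset.finite_toSet).image
    fun r => (cx p).eval r / (cx q).eval r).subset ?_
  rintro y ⟨r, hr, hr'⟩
  refine ⟨r, by simpa [hG'] using hr, ?_⟩
  rw [eval_fam, sub_eq_zero] at hr'
  have hq : (cx q).eval r ≠ 0 := fun h0 => hcop r hr (by rw [hr', h0, mul_zero]) h0
  simp only
  rw [hr', mul_div_cancel_right₀ _ hq]

theorem eventually_near_root {f : ℂ[X]} {r : ℂ} (hr : f.eval r = 0) {δ : ℝ} (hδ : 0 < δ) :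
    ∃ ε > 0, ∀ z, dist r z < ε → ‖f.eval z‖ < δ := by
  have hc : ContinuousAt (fun z => ‖f.eval z‖) r := by fun_prop
  have h := hc.eventually (gt_mem_nhds (show ‖f.eval r‖ < δ by rwa [hr, norm_zero]))
  obtain ⟨ε, hε, h'⟩ := Metric.eventually_nhds_iff.1 h
  exact ⟨ε, hε, fun z hz => h' (by rwa [dist_comm])⟩

theorem Lim.eventually_exists_near (hL : Lim l P Q p q) {y r : ℂ} (hr : (fam p q y).eval r = 0)
    {ε : ℝ} (hε : 0 < ε) : ∀ᶠ n in l, ∃ z, (fam (P n) (Q n) y).eval z = 0 ∧ dist r z < ε := by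
  filter_upwards [hL.pre_seq, hL.eventually_of_root' ‖y‖ (pow_pos hε 5)] with n hpre hn
  have h1 := hn y r le_rfl hr
  rw [← hpre.fam_natDegree y] at h1
  exact exists_root_near (hpre.fam_monic y) hε.le h1

theorem Lim.not_degenerate [l.NeBot] {G p q : ℝ[X]} (hL : Lim l P Q (G * p) (G * q))
    (hc : StrictMono c) {cN : ι → Fin 8 → ℝ} (hcN : Tendsto cN l (𝓝 c))
    (hgood : ∀ᶠ n in l, StrictMono (cN n) ∧ ∃ x', Good (P n) (Q n) (cN n) x')
    (hG : 0 < G.natDegree) (hp : 0 < p.natDegree)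
    (hcop : ∀ r : ℂ, (cx G).eval r = 0 → (cx p).eval r = 0 → (cx q).eval r ≠ 0) : False := by
  have hG0 : G ≠ 0 := by rintro rfl; simp at hG
  have hp0 : p ≠ 0 := by rintro rfl; simp at hp
  obtain ⟨h₀, y, hh, hy, hbad⟩ := exists_hubStar hc (finite_common G p q hG0 hcop)
  have hK0 := hubStar_subset hh y
  have hKc := isCompact_hubStar h₀ y
  obtain ⟨R, hR⟩ := hKc.isBounded.exists_norm_le
  obtain ⟨B, hB, hb⟩ := hL.exists_bound
  obtain ⟨δ, hδ, hsep⟩ : ∃ δ > 0, ∀ z ∈ hubStar h₀ y, ∀ r : ℂ, ‖r‖ ≤ 1 + B * (1 + R) →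
      2 * δ ≤ ‖(cx G).eval r‖ + ‖(fam p q z).eval r‖ := by
    obtain ⟨δ, hδ, h1⟩ := exists_pos_le_of_isCompact
      (hKc.prod (isCompact_closedBall (0 : ℂ) (1 + B * (1 + R))))
      (f := fun a => ‖(cx G).eval a.2‖ + ‖(fam p q a.1).eval a.2‖)
      (by simp only [eval_fam]; fun_prop)
      (fun a ha => by
        by_contra! hle
        have h2 : ‖(cx G).eval a.2‖ = 0 := by
          linarith [norm_nonneg ((cx G).eval a.2), norm_nonneg ((fam p q a.1).eval a.2)]
        have h3 : ‖(fam p q a.1).eval a.2‖ = 0 := by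
          linarith [norm_nonneg ((cx G).eval a.2), norm_nonneg ((fam p q a.1).eval a.2)]
        exact hbad _ ha.1 ⟨_, norm_eq_zero.1 h2, norm_eq_zero.1 h3⟩)
    refine ⟨δ / 2, by positivity, fun z hz r hr => ?_⟩
    have := h1 (z, r) ⟨hz, by simpa using hr⟩
    simp only at this
    linarith
  obtain ⟨r₀, hr₀⟩ : ∃ r, (cx G).eval r = 0 := by
    refine Complex.exists_root (natDegree_pos_iff_degree_pos.1 ?_)
    rwa [cx, natDegree_map]
  obtain ⟨r₁, hr₁⟩ : ∃ r, (fam p q h₀).eval r = 0 := by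
    refine Complex.exists_root (natDegree_pos_iff_degree_pos.1 ?_)
    have h1 := hL.pre.fam_natDegree h₀
    have h2 : fam (G * p) (G * q) h₀ ≠ 0 := (hL.pre.fam_monic h₀).ne_zero
    rw [fam_mul] at h1 h2
    rw [natDegree_mul (left_ne_zero_of_mul h2) (right_ne_zero_of_mul h2), cx, natDegree_map] at h1
    have h3 := hL.pre.degp
    rw [natDegree_mul hG0 hp0] at h3
    omega
  obtain ⟨ε₀, hε₀, hn₀⟩ := eventually_near_root hr₀ hδ
  obtain ⟨ε₁, hε₁, hn₁⟩ := eventually_near_root hr₁ hδ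
  obtain ⟨n, ⟨hcn, x', h'⟩, hb, hn1, hgap, ⟨z₀, hz₀, hd₀⟩, z₁, hz₁, hd₁⟩ :=
    (hgood.and <| hb.and <| (hL.eventually_of_root R (show 0 < δ * δ by positivity)).and <|
    (eventually_all.2 fun k : Fin 8 => eventually_mem_gap hcN (hy k)).and <|
    (hL.eventually_exists_near (y := h₀) (r := r₀) (by rw [fam_mul, eval_mul, hr₀, zero_mul])
      hε₀).and <|
    hL.eventually_exists_near (y := h₀) (r := r₁) (by rw [fam_mul, eval_mul, hr₁, mul_zero])
      hε₁).exists
  obtain ⟨X', hs'⟩ := h'.exists_sheets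
  obtain ⟨w', hw'⟩ := exists_isMon h' hcn hs'
  have hroot : ∀ z ∈ hubStar h₀ y, ∀ i, ‖(cx G).eval (X' i z)‖ * ‖(fam p q z).eval (X' i z)‖ < δ * δ
      ∧ 2 * δ ≤ ‖(cx G).eval (X' i z)‖ + ‖(fam p q z).eval (X' i z)‖ := by
    intro z hz i
    have h1 := hs'.root (hK0 hz) i
    refine ⟨?_, hsep z hz _ ((hb z _ h1).trans (by have := hR z hz; gcongr))⟩
    have := hn1 z _ (hR z hz) h1
    rwa [fam_mul, eval_mul, norm_mul] at this
  have hcont : ∀ i, ContinuousOn (fun z => ‖(cx G).eval (X' i z)‖) (hubStar h₀ y) := fun i =>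
    ((cx G).continuous.comp_continuousOn ((hs'.cont i).mono hK0)).norm
  have hne : ∀ i, ∀ z ∈ hubStar h₀ y, ‖(cx G).eval (X' i z)‖ ≠ δ := by
    intro i z hz he
    obtain ⟨h1, h2⟩ := hroot z hz i
    rw [he] at h1 h2
    have := lt_of_mul_lt_mul_left h1 hδ.le
    linarith
  have hlt : ∀ i, ∀ a ∈ hubStar h₀ y, ∀ b ∈ hubStar h₀ y, ‖(cx G).eval (X' i a)‖ < δ →
      ‖(cx G).eval (X' i b)‖ < δ := fun i a ha b hb' h =>
    lt_of_isPreconnected (isPreconnected_hubStar h₀ y) (hcont i) (hne i) ha hb' h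
  have hhub := hub_mem_hubStar h₀ y
  rcases hw'.transitive h' hcn hs'
      (S := Finset.univ.filter fun i => ‖(cx G).eval (X' i h₀)‖ < δ) (fun k i hi => by
    have hk := tip_mem_hubStar h₀ y k
    simp only [Finset.mem_filter, Finset.mem_univ, true_and] at hi ⊢
    refine hlt _ _ hk _ hhub ?_
    rw [← hw' k _ (hgap k), cx_eval_conj, RCLike.norm_conj]
    exact hlt _ _ hhub _ hk hi) with hS | hS
  · obtain ⟨i, rfl⟩ := hs'.exists_eq hh.le hz₀
    exact Finset.filter_eq_empty_iff.1 hS (Finset.mem_univ i) (hn₀ _ hd₀)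
  · obtain ⟨i, rfl⟩ := hs'.exists_eq hh.le hz₁
    have h4 := Finset.filter_eq_self.1 hS i (Finset.mem_univ i)
    linarith [(hroot _ hhub i).2, hn₁ _ hd₁]

end

section

variable {p q : ℝ[X]} {c x : Fin 8 → ℝ} {X : Fin 5 → ℂ → ℂ} {w : Fin 8 → Equiv.Perm (Fin 5)}

/-- The polynomial `p (α X + β) / α ^ 5`. -/
noncomputable def affine (α β : ℝ) (p : ℝ[X]) : ℝ[X] :=
  C (α ^ 5)⁻¹ * p.comp (C α * Polynomial.X + C β)

theorem natDegree_affine {α : ℝ} (hα : 0 < α) (β : ℝ) (p : ℝ[X]) :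
    (affine α β p).natDegree = p.natDegree := by
  rw [affine, natDegree_C_mul (by positivity), natDegree_comp, natDegree_linear hα.ne', mul_one]

theorem leadingCoeff_affine {α : ℝ} (hα : 0 < α) (β : ℝ) (p : ℝ[X]) :
    (affine α β p).leadingCoeff = (α ^ 5)⁻¹ * (p.leadingCoeff * α ^ p.natDegree) := by
  rw [affine, leadingCoeff_mul, leadingCoeff_C, leadingCoeff_comp (by
    rw [natDegree_linear hα.ne']; norm_num), leadingCoeff_linear hα.ne']

theorem prod_comp_linear {K : Type*} [Field K] {n : ℕ} (r : Fin n → K) {α : K} (hα : α ≠ 0)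
    (β : K) : (∏ j, (Polynomial.X - C (r j))).comp (C α * Polynomial.X + C β) =
      C (α ^ n) * ∏ j, (Polynomial.X - C ((r j - β) / α)) := by
  have : ∀ j, (Polynomial.X - C (r j)).comp (C α * Polynomial.X + C β) =
      C α * (Polynomial.X - C ((r j - β) / α)) := by
    intro j
    rw [mul_sub, ← C_mul, mul_div_cancel₀ _ hα]
    simp only [sub_comp, X_comp, C_comp, C_sub]; ring
  rw [prod_comp, Finset.prod_congr rfl fun j _ => this j, Finset.prod_mul_distrib]
  simp

theorem wr_affine (α β : ℝ) (p q : ℝ[X]) : wr (affine α β p) (affine α β q) =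
    C ((α ^ 5)⁻¹ ^ 2 * α) * (wr p q).comp (C α * Polynomial.X + C β) := by
  simp only [wr, affine, derivative_C_mul, derivative_comp, sub_comp, mul_comp, C_mul, C_pow,
    derivative_add, derivative_C, derivative_X, mul_one, add_zero]
  ring

theorem Good.affine (h : Good p q c x) {α : ℝ} (hα : 0 < α) (β : ℝ) :
    Good (affine α β p) (affine α β q) c fun j => (x j - β) / α where
  monic := by
    rw [Monic, leadingCoeff_affine hα, h.monic.leadingCoeff, h.degp]
    field_simp
  degp := by rw [natDegree_affine hα, h.degp]
  degq := by rw [natDegree_affine hα, h.degq]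
  pos := by
    rw [leadingCoeff_affine hα]
    have := h.pos
    positivity
  wr_eq := by
    rw [wr_affine, h.wr_eq, leadingCoeff_affine hα, mul_comp, C_comp, prod_comp_linear _ hα.ne',
      ← mul_assoc, ← mul_assoc, ← C_mul, ← C_mul, h.degq]
    congr 2
    field_simp
  xinj i j hij := h.xinj (by
    have := hα.ne'
    field_simp at hij
    linarith)
  val j := by
    simp only [MFun.affine, eval_mul, eval_C, eval_comp, eval_add, eval_X]
    rw [mul_div_cancel₀ _ hα.ne', sub_add_cancel, h.val j]
    ring

theorem Sheets.affine (hs : Sheets p q X) {α : ℝ} (hα : 0 < α) (β : ℝ) :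
    Sheets (affine α β p) (affine α β q) fun i y => (X i y - β) / α where
  cont i := ((hs.cont i).sub continuousOn_const).div_const _
  fac y hy := by
    have e : fam (MFun.affine α β p) (MFun.affine α β q) y =
        C ((α : ℂ) ^ 5)⁻¹ * (fam p q y).comp (C (α : ℂ) * Polynomial.X + C (β : ℂ)) := by
      simp only [fam, cx, MFun.affine, Polynomial.map_mul, map_C, Polynomial.map_comp,
        Polynomial.map_add, map_X, sub_comp, mul_comp, C_comp]
      simp
      ring
    have hα' : (α : ℂ) ≠ 0 := by exact_mod_cast hα.ne'
    rw [e, hs.fac y hy, prod_comp_linear _ hα', ← mul_assoc, ← C_mul, inv_mul_cancel₀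
      (pow_ne_zero 5 hα'), C_1, one_mul]

theorem IsMon.affine (hw : IsMon X c w) (α β : ℝ) :
    IsMon (fun i y => (X i y - β) / α) c w := by
  intro k y hy i
  simp only [map_div₀, map_sub, Complex.conj_ofReal, hw k y hy i]

theorem coeff_affine_scale (α : ℝ) (p : ℝ[X]) (i : ℕ) :
    (affine α 0 p).coeff i = (α ^ 5)⁻¹ * (p.coeff i * α ^ i) := by
  rw [affine, coeff_C_mul, C_0, add_zero, comp_C_mul_X_coeff]

theorem coeff_four_affine_shift (hm : p.Monic) (hd : p.natDegree = 5) (β : ℝ) :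
    (affine 1 β p).coeff 4 = p.coeff 4 + 5 * β := by
  have h5 : p.coeff 5 = 1 := by rw [← hd]; exact hm.coeff_natDegree
  rw [affine, C_1, one_mul, one_pow, inv_one, C_1, one_mul, comp, eval₂_eq_sum_range, hd]
  simp only [finsetSum_coeff, coeff_C_mul, coeff_X_add_C_pow]
  simp [Finset.sum_range_succ, h5, Nat.choose]
  ring

/-- The size of the lower coefficients of a pair. -/
noncomputable def size (p q : ℝ[X]) : ℝ := ∑ i ∈ Finset.range 5, (|p.coeff i| + |q.coeff i|)

theorem size_affine_scale {α : ℝ} (hα : 0 < α) (p q : ℝ[X]) :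
    size (affine α 0 p) (affine α 0 q) =
      ∑ i ∈ Finset.range 5, (|p.coeff i| + |q.coeff i|) * α⁻¹ ^ (5 - i) := by
  refine Finset.sum_congr rfl fun i hi => ?_
  rw [coeff_affine_scale, coeff_affine_scale, abs_mul, abs_mul, abs_mul, abs_mul,
    abs_of_pos (show 0 < (α ^ 5)⁻¹ by positivity), abs_of_pos (show 0 < α ^ i by positivity)]
  have : (α ^ 5)⁻¹ * α ^ i = α⁻¹ ^ (5 - i) := by
    have h5 : α ^ 5 = α ^ i * α ^ (5 - i) := by
      rw [← pow_add]; congr 1; have := Finset.mem_range.1 hi; omega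
    rw [h5, inv_pow]; field_simp
  rw [← this]; ring

theorem exists_scale (h : 0 < size p q) : ∃ α > 0, size (affine α 0 p) (affine α 0 q) = 1 := by
  set s := size p q with hs
  have hf : Continuous fun t : ℝ =>
      ∑ i ∈ Finset.range 5, (|p.coeff i| + |q.coeff i|) * t ^ (5 - i) := by fun_prop
  have hle : (fun t : ℝ => ∑ i ∈ Finset.range 5, (|p.coeff i| + |q.coeff i|) * t ^ (5 - i)) 0 ≤ 1
      := by simp [Finset.sum_range_succ]
  have hge : 1 ≤ (fun t : ℝ => ∑ i ∈ Finset.range 5, (|p.coeff i| + |q.coeff i|) * t ^ (5 - i))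
      (1 + s⁻¹) := by
    have h1 : (1 : ℝ) ≤ 1 + s⁻¹ := by have := inv_pos.2 h; linarith
    have h2 : s * (1 + s⁻¹) ≤ ∑ i ∈ Finset.range 5, (|p.coeff i| + |q.coeff i|) *
        (1 + s⁻¹) ^ (5 - i) := by
      rw [hs, size, Finset.sum_mul]
      refine Finset.sum_le_sum fun i hi => ?_
      gcongr
      exact le_self_pow₀ h1 (by have := Finset.mem_range.1 hi; omega)
    have h3 : s * (1 + s⁻¹) = s + 1 := by field_simp
    simp only
    linarith
  obtain ⟨t, ht, h1⟩ := intermediate_value_Icc (show (0 : ℝ) ≤ 1 + s⁻¹ by positivity)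
    hf.continuousOn ⟨hle, hge⟩
  have ht0 : 0 < t := by
    refine lt_of_le_of_ne ht.1 fun h0 => ?_
    subst h0
    simp [Finset.sum_range_succ] at h1
  refine ⟨t⁻¹, by positivity, ?_⟩
  rw [size_affine_scale (by positivity), inv_inv]
  exact h1

/-- `w` is realized over the critical values `c`, with critical points ordered as in `x₀`. -/
def Realized (w : Fin 8 → Equiv.Perm (Fin 5)) (x₀ c : Fin 8 → ℝ) : Prop :=
  ∃ p q x X, Good p q c x ∧ Sheets p q X ∧ IsMon X c w ∧ ∀ a b, x a < x b ↔ x₀ a < x₀ b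

theorem Realized.exists_gauge {x₀ : Fin 8 → ℝ} (h : Realized w x₀ c) :
    ∃ p q x X, (Good p q c x ∧ Sheets p q X ∧ IsMon X c w ∧ ∀ a b, x a < x b ↔ x₀ a < x₀ b) ∧
      p.coeff 4 = 0 ∧ size p q = 1 := by
  have key : ∀ {α β : ℝ} {p q x X}, 0 < α → (Good p q c x ∧ Sheets p q X ∧ IsMon X c w ∧
      ∀ a b, x a < x b ↔ x₀ a < x₀ b) → ∃ x X, (Good (affine α β p) (affine α β q) c x ∧
        Sheets (affine α β p) (affine α β q) X ∧ IsMon X c w ∧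
      ∀ a b, x a < x b ↔ x₀ a < x₀ b) := by
    rintro α β p q x X hα ⟨h1, h2, h3, h4⟩
    refine ⟨_, _, h1.affine hα β, h2.affine hα β, h3.affine α β, fun a b => ?_⟩
    rw [← h4 a b, div_lt_div_iff_of_pos_right hα, sub_lt_sub_iff_right]
  obtain ⟨p, q, x, X, h⟩ := h
  have e4 := coeff_four_affine_shift h.1.monic h.1.degp (-p.coeff 4 / 5)
  obtain ⟨x', X', h'⟩ := key (β := -p.coeff 4 / 5) one_pos h
  have hpos : 0 < size (affine 1 (-p.coeff 4 / 5) p) (affine 1 (-p.coeff 4 / 5) q) := by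
    have h4 := h'.1.pos
    rw [leadingCoeff, h'.1.degq] at h4
    refine Finset.sum_pos' (fun i _ => by positivity) ⟨4, by simp, ?_⟩
    have := abs_pos.2 h4.ne'
    positivity
  obtain ⟨α, hα, h1⟩ := exists_scale hpos
  obtain ⟨x'', X'', h''⟩ := key (β := 0) hα h'
  refine ⟨_, _, _, _, h'', ?_, h1⟩
  rw [coeff_affine_scale, e4]; ring

end

section

variable {ι : Type*} {l : Filter ι} {P Q : ι → ℝ[X]} {p q : ℝ[X]} {c x : Fin 8 → ℝ}
  {X : Fin 5 → ℂ → ℂ} {w : Fin 8 → Equiv.Perm (Fin 5)}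

theorem exists_tendsto_of_bounded (u : Ultrafilter ι) {f : ι → ℝ} {B : ℝ}
    (h : ∀ᶠ a in u, |f a| ≤ B) : ∃ L, Tendsto f u (𝓝 L) := by
  obtain ⟨L, -, hL⟩ := (isCompact_Icc (a := -B) (b := B)).ultrafilter_le_nhds' (u.map f)
    (by
      rw [Ultrafilter.mem_map]
      filter_upwards [h] with a ha using abs_le.1 ha)
  exact ⟨L, hL⟩

theorem tendsto_eval {F : ι → ℝ[X]} {f : ℝ[X]} (hF : ∀ᶠ n in l, (F n).natDegree ≤ 5)
    (hf : f.natDegree ≤ 5) (h : ∀ i, Tendsto (fun n => (F n).coeff i) l (𝓝 (f.coeff i)))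
    {t : ι → ℝ} {t₀ : ℝ} (ht : Tendsto t l (𝓝 t₀)) :
    Tendsto (fun n => (F n).eval (t n)) l (𝓝 (f.eval t₀)) := by
  rw [eval_eq_sum_range' (n := 6) (by omega)]
  refine Tendsto.congr' (f₁ := fun n => ∑ i ∈ Finset.range 6, (F n).coeff i * t n ^ i) ?_
    (tendsto_finsetSum _ fun i _ => (h i).mul (ht.pow i))
  filter_upwards [hF] with n hn
  rw [eval_eq_sum_range' (n := 6) (by omega)]

theorem exists_degenerate (hpre : Pre p q) (h4 : p.coeff 4 = 0) (hsize : size p q = 1)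
    (hnc : ¬ IsCoprime p q) : ∃ G p₁ q₁ : ℝ[X], p = G * p₁ ∧ q = G * q₁ ∧ 0 < G.natDegree ∧
      0 < p₁.natDegree ∧ ∀ r : ℂ, (cx G).eval r = 0 → (cx p₁).eval r = 0 →
        (cx q₁).eval r ≠ 0 := by
  have hp0 := hpre.monic.ne_zero
  by_cases hq : q = 0
  · subst hq
    obtain ⟨r, hr⟩ := exists_root_of_natDegree_five hpre.degp
    obtain ⟨p₁, h1, h2⟩ := exists_eq_pow_rootMultiplicity_mul_and_not_dvd p hp0 r
    have hm : 0 < p.rootMultiplicity r := (rootMultiplicity_pos hp0).2 hr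
    have h5 := hpre.degp
    have hm1 := hpre.monic
    generalize p.rootMultiplicity r = m at *
    have hG : ((Polynomial.X - C r) ^ m).Monic := (monic_X_sub_C r).pow m
    have hGd : ((Polynomial.X - C r) ^ m).natDegree = m := by
      rw [natDegree_pow, natDegree_X_sub_C, mul_one]
    have hp1 : p₁.Monic := hG.of_mul_monic_left (h1 ▸ hm1)
    refine ⟨_, p₁, 0, h1, (mul_zero _).symm, by rwa [hGd], ?_, ?_⟩
    · by_contra! h0
      have hp1' : p₁ = 1 := (Monic.natDegree_eq_zero hp1).1 (by omega)
      rw [hp1', mul_one] at h1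
      rw [h1, hGd] at h5
      subst h5
      have hr0 : r = 0 := by
        rw [h1, sub_eq_add_neg, ← C_neg, coeff_X_add_C_pow] at h4
        simpa using h4
      subst hr0
      rw [h1] at hsize
      simp [size, Finset.sum_range_succ, coeff_X_pow] at hsize
    · intro r' hr' hr''
      exfalso
      have e : r' = r := by
        have : (cx ((Polynomial.X - C r) ^ m)).eval r' = (r' - r) ^ m := by simp [cx]
        rw [this] at hr'
        exact sub_eq_zero.1 (pow_eq_zero_iff hm.ne' |>.1 hr')
      rw [e, cx_eval_ofReal] at hr''
      exact h2 (dvd_iff_isRoot.2 (by exact_mod_cast hr''))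
  · obtain ⟨A, B, G, hG, hco, rfl, rfl⟩ := exists_coprime_factors p hq
    refine ⟨G, A, B, rfl, rfl, ?_, ?_, fun r _ h1 h2 => ?_⟩
    · by_contra! h0
      obtain ⟨u, hu⟩ := natDegree_eq_zero.1 (Nat.le_zero.1 h0)
      have hu0 : u ≠ 0 := by rintro rfl; simp at hu; exact hG hu.symm
      have hu' : IsUnit G := by rw [← hu]; exact isUnit_C.2 hu0.isUnit
      exact hnc ((isCoprime_mul_unit_left_left hu' _ _).2
        ((isCoprime_mul_unit_left_right hu' _ _).2 hco))
    · by_contra! h0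
      have h5 := hpre.degp
      have hA : A ≠ 0 := right_ne_zero_of_mul hp0
      have hB : B ≠ 0 := right_ne_zero_of_mul hq
      have h6 := hpre.degq
      rw [natDegree_mul hG hA] at h5
      rw [natDegree_mul hG hB] at h6
      omega
    · exact eval_ne_zero_of_isCoprime hco h2 h1

theorem Lim.good [l.NeBot] (hL : Lim l P Q p q) (hco : IsCoprime p q) (hc : StrictMono c)
    {cN xN : ι → Fin 8 → ℝ} (hcN : Tendsto cN l (𝓝 c)) (hxN : ∀ j, Tendsto (fun n => xN n j) l
      (𝓝 (x j))) (h : ∀ᶠ n in l, Good (P n) (Q n) (cN n) (xN n)) : Good p q c x := by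
  have hP5 : ∀ᶠ n in l, (P n).natDegree ≤ 5 := hL.pre_seq.mono fun n hn => hn.degp.le
  have hQ5 : ∀ᶠ n in l, (Q n).natDegree ≤ 5 := hL.pre_seq.mono fun n hn => hn.degq.trans (by simp)
  have hp5 : p.natDegree ≤ 5 := hL.pre.degp.le
  have hq5 : q.natDegree ≤ 5 := hL.pre.degq.trans (by simp)
  have hder : ∀ {F : ι → ℝ[X]} {f : ℝ[X]}, (∀ i, Tendsto (fun n => (F n).coeff i) l
      (𝓝 (f.coeff i))) → ∀ i, Tendsto (fun n => (derivative (F n)).coeff i) l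
      (𝓝 ((derivative f).coeff i)) := by
    intro F f hF i
    simp only [coeff_derivative]
    exact (hF _).mul_const _
  have hwr : wr p q = C (q.coeff 4) * ∏ j, (Polynomial.X - C (x j)) := by
    refine Polynomial.funext fun t => ?_
    have h1 : Tendsto (fun n => (wr (P n) (Q n)).eval t) l (𝓝 ((wr p q).eval t)) := by
      simp only [wr, eval_sub, eval_mul]
      have ht : Tendsto (fun _ : ι => t) l (𝓝 t) := tendsto_const_nhds
      refine ((tendsto_eval ?_ ?_ (hder hL.limp) ht).mul (tendsto_eval hQ5 hq5 hL.limq ht)).sub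
        ((tendsto_eval hP5 hp5 hL.limp ht).mul (tendsto_eval ?_ ?_ (hder hL.limq) ht))
      · exact hP5.mono fun n hn => (natDegree_derivative_le _).trans (by omega)
      · exact (natDegree_derivative_le _).trans (by omega)
      · exact hQ5.mono fun n hn => (natDegree_derivative_le _).trans (by omega)
      · exact (natDegree_derivative_le _).trans (by omega)
    refine tendsto_nhds_unique h1 ?_
    simp only [eval_mul, eval_C, eval_prod, eval_sub, eval_X]
    refine Tendsto.congr' (f₁ := fun n => (Q n).coeff 4 * ∏ j, (t - xN n j)) ?_
      ((hL.limq 4).mul (tendsto_finsetProd _ fun j _ => tendsto_const_nhds.sub (hxN j)))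
    filter_upwards [h] with n hn
    rw [hn.wr_eq, leadingCoeff, hn.degq]
    simp [eval_prod]
  have hq4 : 0 < q.coeff 4 := by
    refine lt_of_le_of_ne (ge_of_tendsto (hL.limq 4) ?_) fun h0 => ?_
    · filter_upwards [h] with n hn
      have := hn.pos
      rw [leadingCoeff, hn.degq] at this
      exact this.le
    · rw [← h0, C_0, zero_mul] at hwr
      exact wr_ne_zero_of_isCoprime hco (Or.inl (by rw [hL.pre.degp]; norm_num)) hwr
  have hd4 : q.natDegree = 4 := le_antisymm hL.pre.degq (le_natDegree_of_ne_zero hq4.ne')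
  have hval : ∀ j, p.eval (x j) = c j * q.eval (x j) := by
    intro j
    refine tendsto_nhds_unique (tendsto_eval hP5 hp5 hL.limp (hxN j)) ?_
    refine Tendsto.congr' ?_ (((tendsto_pi_nhds.1 hcN) j).mul
      (tendsto_eval hQ5 hq5 hL.limq (hxN j)))
    filter_upwards [h] with n hn
    exact (hn.val j).symm
  refine ⟨hL.pre.monic, hL.pre.degp, hd4, by rwa [leadingCoeff, hd4], by rw [hwr, leadingCoeff, hd4],
    fun i j hij => ?_, hval⟩
  by_contra hne
  have h1 := hval i
  have h2 := hval j
  rw [← hij, h1] at h2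
  have h3 : q.eval (x i) = 0 := by
    have h4 : c i ≠ c j := fun h => hne (hc.injective h)
    have h5 : (c i - c j) * q.eval (x i) = 0 := by linear_combination h2
    exact (mul_eq_zero.1 h5).resolve_left (sub_ne_zero.2 h4)
  rw [h3, mul_zero] at h1
  refine eval_ne_zero_of_isCoprime (r := (x i : ℂ)) hco ?_ ?_
  · rw [cx_eval_ofReal, h3, Complex.ofReal_zero]
  · rw [cx_eval_ofReal, h1, Complex.ofReal_zero]

theorem IsMon.unique {v : Fin 8 → Equiv.Perm (Fin 5)} (h : Good p q c x) (hc : StrictMono c)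
    (hs : Sheets p q X) (hw : IsMon X c w) (hv : IsMon X c v) : w = v := by
  funext k
  ext1 i
  obtain ⟨y, hy⟩ := gap_nonempty hc k.2.le
  exact hs.injective h (im_ofReal_nonneg y) (ne_of_mem_gap' hy)
    ((hw k y hy i).symm.trans (hv k y hy i))

theorem IsMon.comp_perm (hw : IsMon X c w) (ρ : Equiv.Perm (Fin 5)) :
    IsMon (fun i => X (ρ i)) c fun k => ρ⁻¹ * w k * ρ := by
  intro k y hy i
  simp [hw k y hy]

theorem exists_lim_of_bounded (u : Ultrafilter ι) (hpre : ∀ᶠ n in u, Pre (P n) (Q n))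
    (hsize : ∀ᶠ n in u, size (P n) (Q n) = 1) : ∃ p q, Lim u P Q p q ∧ size p q = 1 := by
  have hle : ∀ᶠ n in u, ∀ i < 5, |(P n).coeff i| ≤ 1 ∧ |(Q n).coeff i| ≤ 1 := by
    filter_upwards [hsize] with n hn i hi
    have h1 := Finset.single_le_sum (f := fun i => |(P n).coeff i| + |(Q n).coeff i|)
      (fun i _ => by positivity) (Finset.mem_range.2 hi)
    rw [size] at hn
    rw [hn] at h1
    constructor <;> linarith [abs_nonneg ((P n).coeff i), abs_nonneg ((Q n).coeff i)]
  have hlp : ∀ i : ℕ, ∃ L, i < 5 → Tendsto (fun n => (P n).coeff i) u (𝓝 L) := by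
    intro i
    by_cases hi : i < 5
    · obtain ⟨L, hL⟩ := exists_tendsto_of_bounded u (hle.mono fun n hn => (hn i hi).1)
      exact ⟨L, fun _ => hL⟩
    · exact ⟨0, fun h => absurd h hi⟩
  have hlq : ∀ i : ℕ, ∃ L, i < 5 → Tendsto (fun n => (Q n).coeff i) u (𝓝 L) := by
    intro i
    by_cases hi : i < 5
    · obtain ⟨L, hL⟩ := exists_tendsto_of_bounded u (hle.mono fun n hn => (hn i hi).2)
      exact ⟨L, fun _ => hL⟩
    · exact ⟨0, fun h => absurd h hi⟩
  choose a ha using hlp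
  choose b hb using hlq
  have hcf : ∀ (a : ℕ → ℝ) (i : ℕ), (∑ k ∈ Finset.range 5, monomial k (a k)).coeff i =
      if i < 5 then a i else 0 := by
    intro a i
    simp [finsetSum_coeff, coeff_monomial]
  have hdeg : ∀ a : ℕ → ℝ, (∑ k ∈ Finset.range 5, monomial k (a k)).degree < 5 := fun a =>
    (degree_lt_iff_coeff_zero _ 5).2 fun i hi => by rw [hcf, if_neg (by omega)]
  have hmon := monic_X_pow_add (n := 5) (p := ∑ k ∈ Finset.range 5, monomial k (a k))
    (hdeg a)
  have hnd : (Polynomial.X ^ 5 + ∑ k ∈ Finset.range 5, monomial k (a k)).natDegree = 5 := by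
    have : (Polynomial.X ^ 5 + ∑ k ∈ Finset.range 5, monomial k (a k)).degree = 5 := by
      rw [degree_add_eq_left_of_degree_lt (by rw [degree_X_pow]; exact hdeg a), degree_X_pow]
      rfl
    exact natDegree_eq_of_degree_eq_some this
  have hL : Lim u P Q (Polynomial.X ^ 5 + ∑ k ∈ Finset.range 5, monomial k (a k))
      (∑ k ∈ Finset.range 5, monomial k (b k)) := by
    refine ⟨⟨hmon, hnd, ?_⟩, hpre, fun i => ?_, fun i => ?_⟩
    · exact natDegree_le_iff_coeff_eq_zero.2 fun i hi => by rw [hcf, if_neg (by omega)]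
    · rw [coeff_add, hcf, coeff_X_pow]
      by_cases hi : i < 5
      · rw [if_pos hi, if_neg hi.ne, zero_add]
        exact ha i hi
      · rw [if_neg hi, add_zero]
        refine tendsto_const_nhds.congr' ?_
        filter_upwards [hpre] with n hn
        by_cases h5 : i = 5
        · rw [if_pos h5, h5, ← hn.degp]; exact hn.monic.coeff_natDegree.symm
        · rw [if_neg h5, coeff_eq_zero_of_natDegree_lt]
          rw [hn.degp]; omega
    · rw [hcf]
      by_cases hi : i < 5
      · rw [if_pos hi]; exact hb i hi
      · rw [if_neg hi]
        refine tendsto_const_nhds.congr' ?_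
        filter_upwards [hpre] with n hn
        rw [coeff_eq_zero_of_natDegree_lt]
        have := hn.degq; omega
  refine ⟨_, _, hL, tendsto_nhds_unique (tendsto_finsetSum _ fun i _ =>
    ((hL.limp i).abs.add (hL.limq i).abs)) ?_⟩
  refine tendsto_const_nhds.congr' ?_
  filter_upwards [hsize] with n hn
  exact hn.symm

end

section

variable {ι : Type*} {l : Filter ι} {P Q : ι → ℝ[X]} {p q : ℝ[X]} {c x x₀ : Fin 8 → ℝ}
  {X : Fin 5 → ℂ → ℂ} {w : Fin 8 → Equiv.Perm (Fin 5)}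

theorem Lim.exists_tendsto {u : Ultrafilter ι} (hL : Lim u P Q p q) {cN xN : ι → Fin 8 → ℝ}
    (hcN : Tendsto cN u (𝓝 c)) (h : ∀ᶠ n in u, Good (P n) (Q n) (cN n) (xN n)) :
    ∃ x : Fin 8 → ℝ, ∀ j, Tendsto (fun n => xN n j) u (𝓝 (x j)) := by
  obtain ⟨B, hB, hb⟩ := hL.exists_bound
  have : ∀ j, ∃ L, Tendsto (fun n => xN n j) u (𝓝 L) := by
    intro j
    refine exists_tendsto_of_bounded (B := 1 + B * (1 + (|c j| + 1))) u ?_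
    have hj := ((tendsto_pi_nhds.1 hcN) j).abs
    filter_upwards [hb, h, hj.eventually (gt_mem_nhds (lt_add_one _))] with n hb hn hlt
    have h1 := hb _ _ (hn.fam_val j)
    rw [Complex.norm_real, Complex.norm_real, Real.norm_eq_abs, Real.norm_eq_abs] at h1
    refine h1.trans ?_
    gcongr
  choose x hx using this
  exact ⟨x, hx⟩

theorem order_of_tendsto [l.NeBot] {xN : ι → Fin 8 → ℝ}
    (hx : ∀ j, Tendsto (fun n => xN n j) l (𝓝 (x j))) (hinj : Function.Injective x)
    (h : ∀ᶠ n in l, ∀ a b, xN n a < xN n b ↔ x₀ a < x₀ b) (a b : Fin 8) :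
    x a < x b ↔ x₀ a < x₀ b := by
  constructor
  · intro hab
    obtain ⟨n, h1, h2⟩ := (h.and ((hx a).eventually_lt (hx b) hab)).exists
    exact (h1 a b).1 h2
  · intro hab
    refine lt_of_le_of_ne (le_of_tendsto_of_tendsto (hx a) (hx b) ?_) fun he => ?_
    · filter_upwards [h] with n hn using ((hn a b).2 hab).le
    · exact hab.ne (congrArg x₀ (hinj he))

theorem Realized.of_limit {u : Ultrafilter (Fin 8 → ℝ)} (hu : ↑u ≤ 𝓝 c) (hc : StrictMono c)
    (h : ∀ᶠ c' in u, StrictMono c' ∧ Realized w x₀ c') : Realized w x₀ c := by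
  have h1 : ∀ c', ∃ p q x X, Realized w x₀ c' →
      (Good p q c' x ∧ Sheets p q X ∧ IsMon X c' w ∧ ∀ a b, x a < x b ↔ x₀ a < x₀ b) ∧
      p.coeff 4 = 0 ∧ size p q = 1 := by
    intro c'
    by_cases hR : Realized w x₀ c'
    · obtain ⟨p, q, x, X, h⟩ := hR.exists_gauge
      exact ⟨p, q, x, X, fun _ => h⟩
    · exact ⟨0, 0, 0, 0, fun h => absurd h hR⟩
  choose P Q xN XN hall using h1
  have hgood : ∀ᶠ n in u, Good (P n) (Q n) n (xN n) := h.mono fun n hn => (hall n hn.2).1.1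
  have hcN : Tendsto (fun n : Fin 8 → ℝ => n) u (𝓝 c) := hu
  obtain ⟨p, q, hL, hsize⟩ := exists_lim_of_bounded u (hgood.mono fun n hn => hn.pre)
    (h.mono fun n hn => (hall n hn.2).2.2)
  have h4 : p.coeff 4 = 0 := tendsto_nhds_unique (hL.limp 4)
    (tendsto_const_nhds.congr' (h.mono fun n hn => (hall n hn.2).2.1.symm))
  have hco : IsCoprime p q := by
    by_contra hnc
    obtain ⟨G, p₁, q₁, rfl, rfl, hG, hp, hcop⟩ := exists_degenerate hL.pre h4 hsize hnc
    exact hL.not_degenerate hc hcN (by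
      filter_upwards [h, hgood] with n h1 h2 using ⟨h1.1, _, h2⟩) hG hp hcop
  obtain ⟨x, hx⟩ := hL.exists_tendsto hcN hgood
  have hg := hL.good hco hc hcN hx hgood
  obtain ⟨X, hs⟩ := hg.exists_sheets
  obtain ⟨v, hv⟩ := exists_isMon hg hc hs
  obtain ⟨n, hn, hmon⟩ := (h.and (hL.eventually_isMon hg hc hs hv hcN)).exists
  obtain ⟨⟨h2, h3, h5, -⟩, -⟩ := hall n hn.2
  obtain ⟨ρ, hρ⟩ := hmon _ _ hn.1 h2 h3
  have e := IsMon.unique h2 hn.1 h3 h5 hρ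
  refine ⟨p, q, x, _, hg, hs.comp_perm ρ, ?_, order_of_tendsto hx hg.xinj
    (h.mono fun n hn => (hall n hn.2).1.2.2.2)⟩
  rw [e]
  exact hv.comp_perm ρ

/-- A pair with double contact at eight points is good. -/
theorem Good.of_contact (hm : p.Monic) (hp : p.natDegree = 5) (hq : q.natDegree = 4)
    (hpos : 0 < q.leadingCoeff) (hx : Function.Injective x)
    (hval : ∀ j, p.eval (x j) = c j * q.eval (x j))
    (hder : ∀ j, (derivative p).eval (x j) = c j * (derivative q).eval (x j)) :
    Good p q c x := by
  refine ⟨hm, hp, hq, hpos, ?_, hx, hval⟩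
  have hdvd : ∏ j, (Polynomial.X - C (x j)) ∣ wr p q := by
    refine Finset.prod_dvd_of_coprime (fun i _ j _ hij => ?_) fun j _ => ?_
    · exact pairwise_coprime_X_sub_C hx hij
    · refine dvd_iff_isRoot.2 ?_
      rw [IsRoot, wr, eval_sub, eval_mul, eval_mul, hval, hder]; ring
  have h5 : p.coeff 5 = 1 := by rw [← hp]; exact hm.coeff_natDegree
  have hdeg : (wr p q).natDegree ≤ 8 := by
    refine (natDegree_sub_le_of_le (natDegree_mul_le_of_le (n := 4) (m := 4) ?_ ?_)
      (natDegree_mul_le_of_le (n := 3) (m := 5) ?_ ?_)) <;>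
    first
    | exact hq.le
    | exact hp.le
    | exact (natDegree_derivative_le _).trans (by omega)
  have hco : (wr p q).coeff 8 = q.leadingCoeff := by
    have e1 : (derivative p * q).coeff (4 + 4) = (derivative p).coeff 4 * q.coeff 4 :=
      coeff_mul_add_eq_of_natDegree_le ((natDegree_derivative_le _).trans (by omega)) hq.le
    have e2 : (p * derivative q).coeff (5 + 3) = p.coeff 5 * (derivative q).coeff 3 :=
      coeff_mul_add_eq_of_natDegree_le hp.le ((natDegree_derivative_le _).trans (by omega))
    rw [wr, coeff_sub, show 8 = 4 + 4 from rfl, e1, show 4 + 4 = 5 + 3 from rfl, e2,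
      coeff_derivative, coeff_derivative, h5, leadingCoeff, hq]
    norm_num
    ring
  obtain ⟨R, hR⟩ := hdvd
  have hmon : (∏ j, (Polynomial.X - C (x j))).Monic := monic_prod_of_monic _ _ fun j _ =>
    monic_X_sub_C _
  have h8 : (∏ j, (Polynomial.X - C (x j))).natDegree = 8 := natDegree_prod_eight x
  have hR0 : R ≠ 0 := by
    rintro rfl
    rw [hR, mul_zero, coeff_zero] at hco
    exact hpos.ne hco
  have hRd : R.natDegree = 0 := by
    rw [hR, hmon.natDegree_mul' hR0, h8] at hdeg
    omega
  obtain ⟨k, rfl⟩ := natDegree_eq_zero.1 hRd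
  have hk : k = q.leadingCoeff := by
    have h9 := hmon.coeff_natDegree
    rw [h8] at h9
    rw [← hco, hR, coeff_mul_C, h9, one_mul]
  rw [hR, hk, mul_comm]

end

section

variable {ι : Type*} {l : Filter ι} {P Q : ι → ℝ[X]} {p q : ℝ[X]} {c x x₀ : Fin 8 → ℝ}
  {X : Fin 5 → ℂ → ℂ} {w : Fin 8 → Equiv.Perm (Fin 5)}

theorem Good.isCoprime (h : Good p q c x) : IsCoprime p q := by
  rw [← isCoprime_map Complex.ofRealHom, isCoprime_iff_aeval_ne_zero_of_isAlgClosed ℂ ℂ]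
  intro r
  by_contra! hr
  simp only [coe_aeval_eq_eval] at hr
  exact h.not_both_zero r hr.1 hr.2

theorem Good.exists_tangent (h : Good p q c x) (s : Fin 8 → ℝ) : ∃ A B : ℝ[X],
    A.natDegree ≤ 4 ∧ B.natDegree ≤ 4 ∧ ∀ j, A.eval (x j) - c j * B.eval (x j) = s j := by
  obtain ⟨a, b, hab⟩ := h.isCoprime
  set H := Lagrange.interpolate Finset.univ x (fun j => s j * q.eval (x j)) with hH
  have hHe : ∀ j, H.eval (x j) = s j * q.eval (x j) := fun j =>
    Lagrange.eval_interpolate_at_node _ h.xinj.injOn (Finset.mem_univ j)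
  have hHd : H.natDegree ≤ 8 := by
    have := Lagrange.degree_interpolate_lt (s := Finset.univ)
      (fun j => s j * q.eval (x j)) h.xinj.injOn
    rw [← hH, Finset.card_univ, Fintype.card_fin] at this
    exact natDegree_le_of_degree_le this.le
  have hp0 := h.monic.ne_zero
  have hA : (H * b %ₘ p).natDegree ≤ 4 := by
    have := natDegree_modByMonic_lt (H * b) h.monic (by
      intro h1; have := h.degp; rw [h1] at this; simp at this)
    rw [h.degp] at this
    omega
  have hdiv := modByMonic_add_div (H * b) p
  have key : p * (-(H * a + q * (H * b /ₘ p))) = (H * b %ₘ p) * q - H := by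
    linear_combination (-H) * hab - q * hdiv
  refine ⟨_, -(H * a + q * (H * b /ₘ p)), hA, ?_, fun j => ?_⟩
  · by_cases hB : -(H * a + q * (H * b /ₘ p)) = 0
    · rw [hB]; simp
    · have h1 : ((H * b %ₘ p) * q - H).natDegree ≤ 8 :=
        natDegree_sub_le_of_le (natDegree_mul_le_of_le hA h.degq.le) hHd
      rw [← key, natDegree_mul hp0 hB, h.degp] at h1
      omega
  · have h1 := congrArg (Polynomial.eval (x j)) key
    rw [eval_mul, eval_sub, eval_mul, hHe, h.val] at h1
    refine mul_right_cancel₀ (h.q_eval_ne j) ?_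
    linear_combination -h1

/-- The polynomial of degree at most `4` with given coefficients. -/
noncomputable def poly (a : Fin 5 → ℝ) : ℝ[X] := ∑ i : Fin 5, C (a i) * Polynomial.X ^ (i : ℕ)

theorem coeff_poly (a : Fin 5 → ℝ) (k : ℕ) : (poly a).coeff k = if h : k < 5 then a ⟨k, h⟩ else 0 := by
  simp only [poly, finsetSum_coeff, coeff_C_mul, coeff_X_pow]
  split_ifs with h
  · rw [Finset.sum_eq_single ⟨k, h⟩]
    · simp
    · intro b _ hb
      rw [if_neg (fun he => hb (Fin.ext he.symm)), mul_zero]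
    · simp
  · refine Finset.sum_eq_zero fun i _ => ?_
    rw [if_neg (by have := i.2; omega), mul_zero]

theorem poly_coeff {A : ℝ[X]} (hA : A.natDegree ≤ 4) : poly (fun i => A.coeff i) = A := by
  ext k
  rw [coeff_poly]
  split_ifs with h
  · rfl
  · rw [coeff_eq_zero_of_natDegree_lt (by omega)]

theorem natDegree_poly_le (a : Fin 5 → ℝ) : (poly a).natDegree ≤ 4 :=
  natDegree_le_iff_coeff_eq_zero.2 fun k hk => by rw [coeff_poly, dif_neg (by omega)]

theorem eval_poly (a : Fin 5 → ℝ) (r : ℝ) : (poly a).eval r = ∑ i : Fin 5, a i * r ^ (i : ℕ) := by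
  simp [poly, eval_finsetSum]

theorem eval_derivative_poly (a : Fin 5 → ℝ) (r : ℝ) :
    (derivative (poly a)).eval r = ∑ i : Fin 5, a i * ((i : ℕ) * r ^ ((i : ℕ) - 1)) := by
  simp [poly, eval_finsetSum, derivative_X_pow]

theorem poly_add_smul (a b : Fin 5 → ℝ) (t : ℝ) : poly (a + t • b) = poly a + C t * poly b := by
  simp only [poly, Finset.mul_sum, ← Finset.sum_add_distrib]
  refine Finset.sum_congr rfl fun i _ => ?_
  simp only [Pi.add_apply, Pi.smul_apply, smul_eq_mul, C_add, C_mul]; ring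

/-- Parameters: the lower coefficients of `p`, those of `q`, the contact points and values. -/
abbrev Param : Type := (Fin 5 → ℝ) × (Fin 5 → ℝ) × (Fin 8 → ℝ) × (Fin 8 → ℝ)

/-- The monic quintic with given lower coefficients. -/
noncomputable def quintic (a : Fin 5 → ℝ) : ℝ[X] := Polynomial.X ^ 5 + poly a

theorem quintic_add_smul (a b : Fin 5 → ℝ) (t : ℝ) :
    quintic (a + t • b) = quintic a + C t * poly b := by
  rw [quintic, poly_add_smul, quintic, add_assoc]

theorem pre_quintic (a b : Fin 5 → ℝ) : Pre (quintic a) (poly b) := by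
  have h1 : (poly a).degree < 5 := by
    refine lt_of_le_of_lt (degree_le_of_natDegree_le (natDegree_poly_le a)) ?_
    norm_num
  refine ⟨monic_X_pow_add (n := 5) h1, ?_, natDegree_poly_le b⟩
  have : (quintic a).degree = 5 := by
    rw [quintic, degree_add_eq_left_of_degree_lt (by rw [degree_X_pow]; exact h1), degree_X_pow]
    rfl
  exact natDegree_eq_of_degree_eq_some this

theorem exists_quintic (h : Pre p q) : ∃ a b, quintic a = p ∧ poly b = q := by
  refine ⟨fun i => p.coeff i, fun i => q.coeff i, ?_, poly_coeff h.degq⟩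
  ext k
  rw [quintic, coeff_add, coeff_poly, coeff_X_pow]
  rcases lt_trichotomy k 5 with hk | rfl | hk
  · rw [if_neg (by omega), dif_pos hk, zero_add]
  · rw [if_pos rfl, dif_neg (by omega), add_zero, ← h.degp]
    exact h.monic.coeff_natDegree.symm
  · rw [if_neg (by omega), dif_neg (by omega), coeff_eq_zero_of_natDegree_lt (by rw [h.degp]; omega),
      zero_add]

/-- The contact equations. -/
noncomputable def contact (v : Param) : (Fin 8 → ℝ) × (Fin 8 → ℝ) × (Fin 8 → ℝ) :=
  (fun j => (quintic v.1).eval (v.2.2.1 j) - v.2.2.2 j * (poly v.2.1).eval (v.2.2.1 j),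
    fun j => (derivative (quintic v.1)).eval (v.2.2.1 j) -
      v.2.2.2 j * (derivative (poly v.2.1)).eval (v.2.2.1 j), v.2.2.2)

theorem contDiff_contact : ContDiff ℝ 1 contact := by
  refine ContDiff.prodMk ?_ (ContDiff.prodMk ?_ (by fun_prop)) <;> refine contDiff_pi.2 fun j => ?_
  · simp only [quintic, eval_add, eval_pow, eval_X, eval_poly]
    fun_prop
  · simp only [quintic, derivative_add, derivative_X_pow, eval_add, eval_mul, eval_pow, eval_X,
      eval_C, eval_derivative_poly]
    fun_prop

theorem hasDerivAt_eval_add (A B : ℝ[X]) (r s : ℝ) :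
    HasDerivAt (fun t => (A + C t * B).eval (r + t * s))
      ((derivative A).eval r * s + B.eval r) 0 := by
  have h1 : HasDerivAt (fun t : ℝ => r + t * s) s 0 := by
    simpa using ((hasDerivAt_id (0 : ℝ)).mul_const s).const_add r
  have hA := (A.hasDerivAt (r + 0 * s)).comp (0 : ℝ) h1
  have hB := (B.hasDerivAt (r + 0 * s)).comp (0 : ℝ) h1
  have := hA.add ((hasDerivAt_id (0 : ℝ)).mul hB)
  simp only [zero_mul, add_zero, id, one_mul] at this
  refine this.congr_of_eventuallyEq (Eventually.of_forall fun t => ?_) |>.congr_deriv ?_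
  · simp
  · simp

theorem hasDerivAt_contact (A B F G : ℝ[X]) (r s k m : ℝ) :
    HasDerivAt (fun t => (A + C t * B).eval (r + t * s) -
      (k + t * m) * (F + C t * G).eval (r + t * s))
      ((derivative A).eval r * s + B.eval r - (m * F.eval r + k * ((derivative F).eval r * s +
        G.eval r))) 0 := by
  have h1 : HasDerivAt (fun t : ℝ => k + t * m) m 0 := by
    simpa using ((hasDerivAt_id (0 : ℝ)).mul_const m).const_add k
  have := (hasDerivAt_eval_add A B r s).sub (h1.mul (hasDerivAt_eval_add F G r s))
  refine this.congr_deriv ?_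
  simp

theorem Good.val_derivative (h : Good p q c x) (j : Fin 8) :
    (derivative p).eval (x j) = c j * (derivative q).eval (x j) := by
  have h1 := h.wr_eval j
  rw [wr, eval_sub, eval_mul, eval_mul, h.val] at h1
  refine mul_right_cancel₀ (h.q_eval_ne j) ?_
  linear_combination h1

theorem Good.val_derivative2 (h : Good p q c x) (j : Fin 8) :
    (derivative (derivative p)).eval (x j) - c j * (derivative (derivative q)).eval (x j) ≠ 0 := by
  intro h0
  refine h.wr_deriv_eval_ne j ?_
  rw [derivative_wr, eval_sub, eval_mul, eval_mul, h.val]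
  linear_combination q.eval (x j) * h0

theorem Good.map_contact {a b : Fin 5 → ℝ} (h : Good (quintic a) (poly b) c x) :
    map contact (𝓝 (a, b, x, c)) = 𝓝 (0, 0, c) := by
  have hst := (contDiff_contact.contDiffAt (x := (a, b, x, c))).hasStrictFDerivAt one_ne_zero
  have h0 : contact (a, b, x, c) = (0, 0, c) := by
    refine Prod.ext (funext fun j => ?_) (Prod.ext (funext fun j => ?_) rfl)
    · exact sub_eq_zero.2 (h.val j)
    · exact sub_eq_zero.2 (h.val_derivative j)
  rw [← h0]
  refine hst.map_nhds_eq_of_surj (LinearMap.range_eq_top.2 ?_)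
  rintro ⟨u, v, γ⟩
  obtain ⟨A, B, hA, hB, hAB⟩ := h.exists_tangent fun j => u j + γ j * (poly b).eval (x j)
  have h2 := h.val_derivative2
  set ξ : Fin 8 → ℝ := fun j => (v j + γ j * (derivative (poly b)).eval (x j) -
    ((derivative A).eval (x j) - c j * (derivative B).eval (x j))) /
      ((derivative (derivative (quintic a))).eval (x j) -
        c j * (derivative (derivative (poly b))).eval (x j)) with hξ
  have hξ' : ∀ j, ξ j * ((derivative (derivative (quintic a))).eval (x j) -
        c j * (derivative (derivative (poly b))).eval (x j)) =
      v j + γ j * (derivative (poly b)).eval (x j) -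
    ((derivative A).eval (x j) - c j * (derivative B).eval (x j)) := fun j =>
    div_mul_cancel₀ _ (h2 j)
  refine ⟨(fun i => A.coeff i, fun i => B.coeff i, ξ, γ), ?_⟩
  have hline := (hst.hasFDerivAt.hasLineDerivAt (fun i => A.coeff i, fun i => B.coeff i, ξ, γ))
  refine HasDerivAt.unique hline ?_
  refine HasDerivAt.prodMk (hasDerivAt_pi.2 fun j => ?_)
    (HasDerivAt.prodMk (hasDerivAt_pi.2 fun j => ?_) (hasDerivAt_pi.2 fun j => ?_))
  · simp only [Prod.smul_mk, Prod.mk_add_mk, quintic_add_smul, poly_add_smul, poly_coeff hA,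
      poly_coeff hB, Pi.add_apply, Pi.smul_apply, smul_eq_mul]
    refine (hasDerivAt_contact _ _ _ _ _ _ _ _).congr_deriv ?_
    rw [h.val_derivative j]
    linear_combination hAB j
  · simp only [Prod.smul_mk, Prod.mk_add_mk, quintic_add_smul, poly_add_smul, poly_coeff hA,
      poly_coeff hB, Pi.add_apply, Pi.smul_apply, smul_eq_mul, derivative_add, derivative_C_mul]
    refine (hasDerivAt_contact _ _ _ _ _ _ _ _).congr_deriv ?_
    linear_combination hξ' j
  · simp only [Prod.smul_mk, Prod.mk_add_mk, Pi.add_apply, Pi.smul_apply, smul_eq_mul]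
    simpa using ((hasDerivAt_id (0 : ℝ)).mul_const (γ j)).const_add (c j)

end

section

variable {p q : ℝ[X]} {c c' x x₀ : Fin 8 → ℝ} {X : Fin 5 → ℂ → ℂ} {w : Fin 8 → Equiv.Perm (Fin 5)}

theorem coeff_quintic (a : Fin 5 → ℝ) (k : ℕ) :
    (quintic a).coeff k = (if k = 5 then 1 else 0) + (poly a).coeff k := by
  rw [quintic, coeff_add, coeff_X_pow]

theorem continuous_coeff_poly (k : ℕ) : Continuous fun a : Fin 5 → ℝ => (poly a).coeff k := by
  simp only [coeff_poly]
  split_ifs <;> fun_prop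

theorem lim_param (a b : Fin 5 → ℝ) (y z : Fin 8 → ℝ) :
    Lim (𝓝 ((a, b, y, z) : Param)) (fun v => quintic v.1) (fun v => poly v.2.1)
      (quintic a) (poly b) where
  pre := pre_quintic a b
  pre_seq := Eventually.of_forall fun v => pre_quintic v.1 v.2.1
  limp i := by
    simp only [coeff_quintic]
    exact (continuous_const.add ((continuous_coeff_poly i).comp continuous_fst)).tendsto _
  limq i := ((continuous_coeff_poly i).comp (continuous_fst.comp continuous_snd)).tendsto
    (x := ((a, b, y, z) : Param))

theorem Good.coeff_four_pos (h : Good p q c x) : 0 < q.coeff 4 := by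
  have := h.pos
  rwa [leadingCoeff, h.degq] at this

theorem Good.eventually_order (h : Good p q c x) (a b : Fin 5 → ℝ) :
    ∀ᶠ v in 𝓝 ((a, b, x, c) : Param), ∀ i j, v.2.2.1 i < v.2.2.1 j ↔ x i < x j := by
  have hc : ∀ i : Fin 8, Continuous fun v : Param => v.2.2.1 i := by fun_prop
  refine eventually_all.2 fun i => eventually_all.2 fun j => ?_
  rcases lt_trichotomy (x i) (x j) with hij | hij | hij
  · filter_upwards [((hc i).tendsto (a, b, x, c)).eventually_lt ((hc j).tendsto _) hij] with v hv
    exact iff_of_true hv hij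
  · rw [h.xinj hij]; simp
  · filter_upwards [((hc j).tendsto (a, b, x, c)).eventually_lt ((hc i).tendsto _) hij] with v hv
    exact iff_of_false hv.le.not_gt hij.le.not_gt

theorem Realized.eventually (hc : StrictMono c) (h : Realized w x₀ c) :
    ∀ᶠ c' in 𝓝 c, StrictMono c' → Realized w x₀ c' := by
  obtain ⟨p, q, x, X, hg, hs, hw, ho⟩ := h
  obtain ⟨a, b, rfl, rfl⟩ := exists_quintic hg.pre
  have hcN : Tendsto (fun v : Param => v.2.2.2) (𝓝 (a, b, x, c)) (𝓝 c) :=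
    (continuous_snd.comp (continuous_snd.comp continuous_snd)).tendsto (a, b, x, c)
  have hpos : ∀ᶠ v in 𝓝 ((a, b, x, c) : Param), 0 < (poly v.2.1).coeff 4 :=
    ((lim_param a b x c).limq 4).eventually_const_lt hg.coeff_four_pos
  have hev := ((lim_param a b x c).eventually_isMon hg hc hs hw hcN).and
    (hpos.and (hg.eventually_order a b))
  have him := image_mem_map (m := contact) hev
  rw [hg.map_contact] at him
  have hT : Tendsto (fun c' : Fin 8 → ℝ => ((0, 0, c') : (Fin 8 → ℝ) × (Fin 8 → ℝ) × (Fin 8 → ℝ)))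
      (𝓝 c) (𝓝 (0, 0, c)) := by
    exact (continuous_const.prodMk (continuous_const.prodMk continuous_id)).tendsto c
  filter_upwards [hT him] with c' hc' hmono
  obtain ⟨v, ⟨hv1, hv2, hv3⟩, hv⟩ := hc'
  have e1 := congrArg Prod.fst hv
  have e2 := congrArg (fun t => t.2.1) hv
  obtain rfl : v.2.2.2 = c' := congrArg (fun t => t.2.2) hv
  have hpre := pre_quintic v.1 v.2.1
  have hdeg : (poly v.2.1).natDegree = 4 :=
    le_antisymm hpre.degq (le_natDegree_of_ne_zero hv2.ne')
  have hg' : Good (quintic v.1) (poly v.2.1) v.2.2.2 v.2.2.1 := by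
    refine Good.of_contact hpre.monic hpre.degp hdeg (by rwa [leadingCoeff, hdeg]) ?_
      (fun j => sub_eq_zero.1 (congrFun e1 j)) (fun j => sub_eq_zero.1 (congrFun e2 j))
    intro i j hij
    by_contra hne
    rcases lt_or_gt_of_ne (hg.xinj.ne hne) with hl | hl
    · exact ((hv3 _ _).2 hl).ne hij
    · exact ((hv3 _ _).2 hl).ne' hij
  obtain ⟨X', hs'⟩ := hg'.exists_sheets
  obtain ⟨ρ, hρ⟩ := hv1 _ X' hmono hg' hs'
  refine ⟨_, _, _, _, hg', hs'.comp_perm ρ⁻¹, ?_, fun i j => (hv3 i j).trans (ho i j)⟩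
  convert hρ.comp_perm ρ⁻¹ using 2 with k
  group

theorem convex_strictMono : Convex ℝ {c : Fin 8 → ℝ | StrictMono c} := by
  intro c hc d hd s t hs ht hst i j hij
  have h1 := hc hij
  have h2 := hd hij
  simp only [Pi.add_apply, Pi.smul_apply, smul_eq_mul]
  rcases hs.eq_or_lt with rfl | hs
  · have : t = 1 := by linarith
    subst this; linarith
  · nlinarith

theorem isOpen_strictMono : IsOpen {c : Fin 8 → ℝ | StrictMono c} := by
  have : {c : Fin 8 → ℝ | StrictMono c} = ⋂ i, ⋂ j, ⋂ (_ : i < j), {c | c i < c j} := by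
    ext c; simp [StrictMono]
  rw [this]
  refine isOpen_iInter_of_finite fun i => isOpen_iInter_of_finite fun j =>
    isOpen_iInter_of_finite fun _ => isOpen_lt (by fun_prop) (by fun_prop)

theorem Realized.transport (hc : StrictMono c) (hc' : StrictMono c') (h : Realized w x₀ c) :
    Realized w x₀ c' := by
  have hpre := convex_strictMono.isPreconnected
  have := hpre.subset_of_closure_inter_subset (u := {c | StrictMono c ∧ Realized w x₀ c}) ?_
    ⟨c, hc, hc, h⟩ ?_ 
  · exact (this hc').2
  · refine isOpen_iff_mem_nhds.2 fun d hd => ?_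
    filter_upwards [isOpen_strictMono.mem_nhds hd.1, hd.2.eventually hd.1] with e he he'
    exact ⟨he, he' he⟩
  · rintro d ⟨hd, hd'⟩
    obtain ⟨u, hu, hud⟩ := mem_closure_iff_ultrafilter.1 hd
    exact ⟨hd', Realized.of_limit hud hd' hu⟩

end

section

variable {p q p' q' : ℝ[X]} {c c' x x' x₀ x₁ : Fin 8 → ℝ} {X X' : Fin 5 → ℂ → ℂ}
  {w v : Fin 8 → Equiv.Perm (Fin 5)}

theorem Realized.exists_shift (hc : StrictMono c) (h : Realized w x₀ c) :
    ∃ x₁, SameKey (x₀ ∘ Equiv.subRight 1) x₁ ∧ Realized (fun k => w (k - 1)) x₁ c := by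
  obtain ⟨p, q, x, X, hg, hs, hw, ho⟩ := h
  obtain ⟨y₀, hy₀⟩ := gap_nonempty hc (k := 7) (by norm_num)
  obtain ⟨p', q', x', X', hg', hs', hkey, hw'⟩ := (hg.rotate_mon hc hs hw hy₀).1
  refine ⟨x', ((sameKey_of_order ho).symm.perm _).trans hkey, ?_⟩
  exact Realized.transport (rot_strictMono hc hy₀) hc
    ⟨p', q', x', X', hg', hs', hw', fun _ _ => Iff.rfl⟩

theorem exists_scalar_of_mul_eq {P Q : ℝ[X]} (h : Good p q c x) (hP : P.natDegree ≤ 5)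
    (he : P * q = Q * p) : ∃ u : ℝ, P = C u * p ∧ Q = C u * q := by
  have hdvd : p ∣ P := h.isCoprime.dvd_of_dvd_mul_right (Dvd.intro_left Q he.symm)
  obtain ⟨k, rfl⟩ := hdvd
  have hk : k.natDegree = 0 := by
    by_cases hk0 : k = 0
    · rw [hk0, natDegree_zero]
    · rw [h.monic.natDegree_mul' hk0, h.degp] at hP; omega
  obtain ⟨u, rfl⟩ := natDegree_eq_zero.1 hk
  refine ⟨u, mul_comm _ _, ?_⟩
  exact mul_right_cancel₀ h.monic.ne_zero (by linear_combination -he)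

theorem Good.gen (h : Good p q c x) : Gen p q q.leadingCoeff c x where
  degp := h.degp.le
  degq := h.degq.le.trans (by norm_num)
  ne := h.pos.ne'
  wr_eq := h.wr_eq
  xinj := h.xinj
  val := h.val

theorem Good.exists_smul (h : Good p q c x) (h' : Good p' q' c' x') {a b e d : ℝ}
    (hD : a * d - b * e ≠ 0)
    (he : hom 5 p' (C a * Polynomial.X + C b) (C e * Polynomial.X + C d) * q =
      hom 5 q' (C a * Polynomial.X + C b) (C e * Polynomial.X + C d) * p) :
    ∃ u : ℝ, u ≠ 0 ∧
      p = C u * hom 5 p' (C a * Polynomial.X + C b) (C e * Polynomial.X + C d) ∧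
      q = C u * hom 5 q' (C a * Polynomial.X + C b) (C e * Polynomial.X + C d) := by
  obtain ⟨u, hu1, hu2⟩ := exists_scalar_of_mul_eq h
    (natDegree_hom_le _ _ (natDegree_lin_le _ _) (natDegree_lin_le _ _)) he
  have hB : (C e * Polynomial.X + C d : ℝ[X]) ≠ 0 := by
    intro h0
    have h1 := congrArg (fun f => f.coeff 1) h0
    have h2 := congrArg (fun f => f.coeff 0) h0
    simp at h1 h2
    rw [h1, h2] at hD; simp at hD
  have hu : u ≠ 0 := by
    rintro rfl
    obtain ⟨t, ht⟩ : ∃ t : ℝ, (C e * Polynomial.X + C d : ℝ[X]).eval t ≠ 0 := by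
      by_contra! hB'
      exact hB (Polynomial.funext fun t => by rw [hB', eval_zero])
    have h1 := congrArg (Polynomial.eval t) hu1
    have h2 := congrArg (Polynomial.eval t) hu2
    rw [eval_hom h'.degp.le ht, C_0, zero_mul, eval_zero] at h1
    rw [eval_hom (h'.degq.le.trans (by norm_num)) ht, C_0, zero_mul, eval_zero] at h2
    replace h1 := (mul_eq_zero.1 h1).resolve_left (pow_ne_zero _ ht)
    replace h2 := (mul_eq_zero.1 h2).resolve_left (pow_ne_zero _ ht)
    refine h'.not_both_zero (((C a * Polynomial.X + C b : ℝ[X]).eval t /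
      (C e * Polynomial.X + C d : ℝ[X]).eval t : ℝ) : ℂ) ?_ ?_ <;> rw [cx_eval_ofReal]
    · exact_mod_cast h1
    · exact_mod_cast h2
  refine ⟨u⁻¹, inv_ne_zero hu, ?_, ?_⟩
  · rw [hu1, ← mul_assoc, ← C_mul, inv_mul_cancel₀ hu, C_1, one_mul]
  · rw [hu2, ← mul_assoc, ← C_mul, inv_mul_cancel₀ hu, C_1, one_mul]

theorem IsMon.exists_moebius_smul (h : Good p q c x) (hc : StrictMono c) (hs : Sheets p q X)
    (hw : IsMon X c w) (h' : Good p' q' c x') (hs' : Sheets p' q' X') (hw' : IsMon X' c w) :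
    ∃ a b e d u : ℝ, a * d - b * e ≠ 0 ∧ u ≠ 0 ∧
      p = C u * hom 5 p' (C a * Polynomial.X + C b) (C e * Polynomial.X + C d) ∧
      q = C u * hom 5 q' (C a * Polynomial.X + C b) (C e * Polynomial.X + C d) := by
  obtain ⟨a, b, e, d, hD, he⟩ := IsMon.exists_moebius h hc hs hw h' hs' hw'
  obtain ⟨u, hu⟩ := Good.exists_smul h h' hD he
  exact ⟨a, b, e, d, u, hD, hu⟩

/-- The key is determined by the walk up to conjugation. -/
theorem Realized.sameKey (hc : StrictMono c) (h : Realized w x₀ c)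
    (h' : Realized v x₁ c) {ρ : Equiv.Perm (Fin 5)} (hv : ∀ k, v k = ρ⁻¹ * w k * ρ) :
    SameKey x₀ x₁ := by
  obtain ⟨p, q, x, X, hg, hs, hw, ho⟩ := h
  obtain ⟨p', q', x', X', hg', hs', hw', ho'⟩ := h'
  obtain rfl : v = _ := funext hv
  obtain ⟨a, b, e, d, u, hD, hu, rfl, rfl⟩ := IsMon.exists_moebius_smul hg' hc hs' hw' hg
    (hs.comp_perm ρ) (hw.comp_perm ρ)
  have := (hg.gen.sameKey hg.pos hc.injective hD hu hg').2.2
  exact (sameKey_of_order ho).symm.trans (this.trans (sameKey_of_order ho'))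

end

section

variable {p q p' q' : ℝ[X]} {c x x' : Fin 8 → ℝ} {X X' : Fin 5 → ℂ → ℂ}
  {w v : Fin 8 → Equiv.Perm (Fin 5)}

theorem cx_lin_eval (a b : ℝ) (z : ℂ) :
    (cx (C a * Polynomial.X + C b)).eval z = a * z + b := by simp

theorem hom_eval_of_eq_zero {R : Type*} [CommRing R] (f : R[X]) {A B : R[X]} {z : R}
    (hB : B.eval z = 0) : (hom 5 f A B).eval z = f.coeff 5 * A.eval z ^ 5 := by
  simp [hom, Finset.sum_range_succ, hB]

theorem lin_ne_zero {a b e d : ℝ} (hD : a * d - b * e ≠ 0) {z : ℂ} (hz : (e : ℂ) * z + d = 0) :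
    (a : ℂ) * z + b ≠ 0 := by
  intro h
  refine hD ?_
  have h1 : ((a * d - b * e : ℝ) : ℂ) = 0 := by
    have he : (e : ℂ) * ((a : ℂ) * z + b) - a * (e * z + d) = 0 := by rw [h, hz]; simp
    push_cast; linear_combination -he
  exact_mod_cast h1

/-- Roots of the fibre polynomials transform under a Möbius change of variable. -/
theorem Good.root_of_moebius (h : Good p q c x) {a b e d u : ℝ} (hD : a * d - b * e ≠ 0)
    (hu : u ≠ 0) {y z : ℂ}
    (hz : (fam (C u * hom 5 p (C a * Polynomial.X + C b) (C e * Polynomial.X + C d))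
      (C u * hom 5 q (C a * Polynomial.X + C b) (C e * Polynomial.X + C d)) y).eval z = 0) :
    (e : ℂ) * z + d ≠ 0 ∧ (fam p q y).eval ((a * z + b) / (e * z + d)) = 0 := by
  have huc : (u : ℂ) ≠ 0 := by exact_mod_cast hu
  have hz' : (hom 5 (cx p) (cx (C a * Polynomial.X + C b))
        (cx (C e * Polynomial.X + C d))).eval z -
      y * (hom 5 (cx q) (cx (C a * Polynomial.X + C b))
        (cx (C e * Polynomial.X + C d))).eval z = 0 := by
    simp only [eval_fam, cx, Polynomial.map_mul, map_hom, eval_mul, map_C, eval_C] at hz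
    refine (mul_eq_zero.1 (?_ : (u : ℂ) * _ = 0)).resolve_left huc
    rw [← hz]
    simp only [Complex.coe_algebraMap, cx]
    ring
  have hB : (e : ℂ) * z + d ≠ 0 := by
    intro h0
    have hB0 : (cx (C e * Polynomial.X + C d)).eval z = 0 := by rw [cx_lin_eval, h0]
    rw [hom_eval_of_eq_zero _ hB0, hom_eval_of_eq_zero _ hB0, cx_lin_eval, coeff_map, coeff_map,
      coeff_eq_zero_of_natDegree_lt (show q.natDegree < 5 by rw [h.degq]; norm_num),
      ← h.degp, h.monic.coeff_natDegree, h.degp] at hz'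
    simp only [map_one, map_zero, one_mul, zero_mul, mul_zero, sub_zero] at hz'
    exact lin_ne_zero hD h0 (pow_eq_zero_iff (by norm_num)|>.1 hz')
  refine ⟨hB, ?_⟩
  have hB0 : (cx (C e * Polynomial.X + C d)).eval z ≠ 0 := by rwa [cx_lin_eval]
  rw [eval_hom (by rw [natDegree_map, h.degp]) hB0,
    eval_hom (by rw [natDegree_map, h.degq]; norm_num) hB0, cx_lin_eval, cx_lin_eval] at hz'
  rw [eval_fam]
  refine (mul_eq_zero.1 (?_ : ((e : ℂ) * z + d) ^ 5 * _ = 0)).resolve_left (pow_ne_zero _ hB)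
  rw [← hz']; ring

theorem conj_lin_div (a b e d : ℝ) (z : ℂ) :
    starRingEnd ℂ ((a * z + b) / (e * z + d)) =
      (a * starRingEnd ℂ z + b) / (e * starRingEnd ℂ z + d) := by simp

theorem lin_div_inj {a b e d : ℝ} (hD : a * d - b * e ≠ 0) {z z' : ℂ}
    (h : (e : ℂ) * z + d ≠ 0) (h' : (e : ℂ) * z' + d ≠ 0)
    (he : (a * z + b) / (e * z + d) = (a * z' + b) / (e * z' + d)) : z = z' := by
  rw [div_eq_div_iff h h'] at he
  have hDc : ((a * d - b * e : ℝ) : ℂ) ≠ 0 := by exact_mod_cast hD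
  refine sub_eq_zero.1 ((mul_eq_zero.1 (?_ : ((a * d - b * e : ℝ) : ℂ) * _ = 0)).resolve_left hDc)
  push_cast; linear_combination he

theorem isPreconnected_upper_diff (c : Fin 8 → ℝ) :
    IsPreconnected {y : ℂ | 0 ≤ y.im ∧ ∀ j, y ≠ c j} := by
  refine IsPreconnected.subset_closure (s := {y : ℂ | 0 < y.im})
    (convex_halfSpace_im_gt 0).isPreconnected
    (fun y hy => ⟨le_of_lt hy, fun j => ne_of_im_pos hy j⟩) ?_
  rw [Complex.closure_setOfPred_lt_im]
  exact fun y hy => hy.1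

/-- The walk of a Möbius-equivalent pair is conjugate to the original one. -/
theorem IsMon.conj_of_moebius (h : Good p q c x) (hc : StrictMono c) (hs : Sheets p q X)
    (hw : IsMon X c w) {a b e d u : ℝ} (hD : a * d - b * e ≠ 0) (hu : u ≠ 0)
    (h' : Good (C u * hom 5 p (C a * Polynomial.X + C b) (C e * Polynomial.X + C d))
      (C u * hom 5 q (C a * Polynomial.X + C b) (C e * Polynomial.X + C d)) c x')
    (hs' : Sheets (C u * hom 5 p (C a * Polynomial.X + C b) (C e * Polynomial.X + C d))
      (C u * hom 5 q (C a * Polynomial.X + C b) (C e * Polynomial.X + C d)) X')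
    (hv : IsMon X' c v) : ∃ ρ : Equiv.Perm (Fin 5), ∀ k, v k = ρ⁻¹ * w k * ρ := by
  have hr := fun (y : ℂ) (hy : 0 ≤ y.im) i => h.root_of_moebius hD hu (hs'.root hy i)
  have hI : (0 : ℝ) < Complex.I.im := by simp
  choose ρ hρ using fun i => hs.exists_eq hI.le (hr Complex.I hI.le i).2
  have key : ∀ y : ℂ, 0 ≤ y.im → (∀ j, y ≠ c j) → ∀ i,
      (a * X' i y + b) / (e * X' i y + d) = X (ρ i) y := by
    intro y hy hyc i
    refine eq_of_isPreconnected (isPreconnected_upper_diff c)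
      (g := fun y => (a * X' i y + b) / (e * X' i y + d)) (f := X) ?_ ?_ ?_ ?_
      (y₀ := Complex.I) ⟨hI.le, fun j => ne_of_im_pos hI j⟩ (hρ i) ⟨hy, hyc⟩
    · have hX : ContinuousOn (X' i) {y : ℂ | 0 ≤ y.im ∧ ∀ j, y ≠ c j} :=
        (hs'.cont i).mono fun y hy => hy.1
      exact ((continuousOn_const.mul hX).add continuousOn_const).div
        ((continuousOn_const.mul hX).add continuousOn_const) fun y hy => (hr y hy.1 i).1
    · exact fun i => (hs.cont i).mono fun y hy => hy.1
    · exact fun y hy => hs.injective h hy.1 hy.2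
    · exact fun y hy => hs.exists_eq hy.1 (hr y hy.1 i).2
  have hinj : Function.Injective ρ := by
    intro i j hij
    refine hs'.injective h' hI.le (fun j => ne_of_im_pos hI j)
      (lin_div_inj hD (hr _ hI.le i).1 (hr _ hI.le j).1 ?_)
    rw [hρ, hρ, hij]
  refine ⟨Equiv.ofBijective ρ (Finite.injective_iff_bijective.1 hinj), fun k => ?_⟩
  rw [mul_assoc, eq_inv_mul_iff_mul_eq]
  ext1 i
  obtain ⟨y, hy⟩ := gap_nonempty hc k.2.le
  have hy0 := im_ofReal_nonneg y
  refine hs.injective h hy0 (ne_of_mem_gap' hy) ?_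
  have h1 := key y hy0 (ne_of_mem_gap' hy)
  simp only [Equiv.Perm.mul_apply, Equiv.ofBijective_apply]
  rw [← h1, ← hw k y hy, ← hv k y hy, ← h1, conj_lin_div]

end

section

variable {p q p' q' : ℝ[X]} {c x x' : Fin 8 → ℝ}

/-- `p' / q'` is `p / q` precomposed with a Möbius transformation. -/
def Rel (p q p' q' : ℝ[X]) : Prop :=
  ∃ a b e d : ℝ, a * d - b * e ≠ 0 ∧ ∀ᶠ t in cofinite,
    p'.eval t * q.eval ((a * t + b) / (e * t + d)) = q'.eval t * p.eval ((a * t + b) / (e * t + d))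

theorem eventually_eval_ne {f : ℝ[X]} (hf : f ≠ 0) : ∀ᶠ t in cofinite, f.eval t ≠ 0 := by
  rw [eventually_cofinite]
  simpa using f.finite_setOfPred_isRoot hf

theorem lin_poly_ne_zero {a b e d : ℝ} (hD : a * d - b * e ≠ 0) :
    (C e * X + C d : ℝ[X]) ≠ 0 := by
  intro h0
  have h1 := congrArg (fun f => f.coeff 1) h0
  have h2 := congrArg (fun f => f.coeff 0) h0
  simp at h1 h2
  rw [h1, h2] at hD; simp at hD

theorem eventually_lin_ne {a b e d : ℝ} (hD : a * d - b * e ≠ 0) :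
    ∀ᶠ t in cofinite, e * t + d ≠ 0 := by
  simpa using eventually_eval_ne (lin_poly_ne_zero hD)

theorem tendsto_moebius {a b e d : ℝ} (hD : a * d - b * e ≠ 0) :
    Tendsto (fun t => (a * t + b) / (e * t + d)) cofinite cofinite := by
  intro s hs
  rw [mem_cofinite] at hs
  have hf := eventually_cofinite.1 (eventually_lin_ne hD)
  refine ((Set.Finite.of_injOn (s := {t | e * t + d ≠ 0 ∧ (a * t + b) / (e * t + d) ∈ sᶜ})
    (fun t ht => ht.2) ?_ hs).union hf).subset ?_
  · rintro t ⟨ht, -⟩ t' ⟨ht', -⟩ he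
    dsimp only at he
    rw [div_eq_div_iff ht ht'] at he
    refine sub_eq_zero.1 ((mul_eq_zero.1 (?_ : (a * d - b * e) * _ = 0)).resolve_left hD)
    linear_combination he
  · intro t ht
    by_cases h : e * t + d = 0
    · exact Or.inr (by simpa using h)
    · exact Or.inl ⟨h, ht⟩

theorem Rel.symm (h : Rel p q p' q') : Rel p' q' p q := by
  obtain ⟨a, b, e, d, hD, h⟩ := h
  have hD' : d * a - (-b) * (-e) ≠ 0 := by convert hD using 1; ring
  refine ⟨d, -b, -e, a, hD', ?_⟩
  filter_upwards [(tendsto_moebius hD').eventually h, eventually_lin_ne hD',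
    (tendsto_moebius hD').eventually (eventually_lin_ne hD)] with t ht h1 h2
  have : (a * ((d * t + -b) / (-e * t + a)) + b) / (e * ((d * t + -b) / (-e * t + a)) + d) = t := by
    have hr := div_mul_cancel₀ (d * t + -b) h1
    rw [div_eq_iff h2]
    linear_combination hr
  rw [this] at ht
  linarith

theorem Rel.trans {p'' q'' : ℝ[X]} (h : Rel p q p' q') (h' : Rel p' q' p'' q'') (hq : q' ≠ 0) :
    Rel p q p'' q'' := by
  obtain ⟨a, b, e, d, hD, h⟩ := h
  obtain ⟨a', b', e', d', hD', h'⟩ := h'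
  refine ⟨a * a' + b * e', a * b' + b * d', e * a' + d * e', e * b' + d * d', ?_, ?_⟩
  · have := mul_ne_zero hD hD'
    convert this using 1; ring
  filter_upwards [h', (tendsto_moebius hD').eventually h, eventually_lin_ne hD',
    (tendsto_moebius hD').eventually (eventually_lin_ne hD),
    (tendsto_moebius hD').eventually (eventually_eval_ne hq)] with t h1 h2 h3 h4 h5
  have he : ((a * a' + b * e') * t + (a * b' + b * d')) / ((e * a' + d * e') * t +
      (e * b' + d * d')) = (a * ((a' * t + b') / (e' * t + d')) + b) /
        (e * ((a' * t + b') / (e' * t + d')) + d) := by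
    have h6 : (e * a' + d * e') * t + (e * b' + d * d') =
        (e' * t + d') * (e * ((a' * t + b') / (e' * t + d')) + d) := by field_simp; ring
    have h7 : (a * a' + b * e') * t + (a * b' + b * d') =
        (e' * t + d') * (a * ((a' * t + b') / (e' * t + d')) + b) := by field_simp; ring
    rw [h6, h7, mul_div_mul_left _ _ h3]
  rw [he]
  refine mul_left_cancel₀ h5 ?_
  linear_combination (eval ((a * ((a' * t + b') / (e' * t + d')) + b) /
        (e * ((a' * t + b') / (e' * t + d')) + d)) q) * h1 + q''.eval t * h2

theorem lin_eval (a b t : ℝ) : (C a * X + C b : ℝ[X]).eval t = a * t + b := by simp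

theorem rel_iff (hp : p.natDegree ≤ 5) (hq : q.natDegree ≤ 5) : Rel p q p' q' ↔
    ∃ a b e d : ℝ, a * d - b * e ≠ 0 ∧ p' * hom 5 q (C a * X + C b) (C e * X + C d) =
      q' * hom 5 p (C a * X + C b) (C e * X + C d) := by
  constructor
  · rintro ⟨a, b, e, d, hD, h⟩
    refine ⟨a, b, e, d, hD, ?_⟩
    refine eq_of_infinite_eval_eq _ _ (Set.Infinite.mono (s := {t | e * t + d ≠ 0 ∧
      p'.eval t * q.eval ((a * t + b) / (e * t + d)) =
        q'.eval t * p.eval ((a * t + b) / (e * t + d))}) ?_ ?_)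
    · rintro t ⟨h1, h2⟩
      have h1' : (C e * X + C d : ℝ[X]).eval t ≠ 0 := by rwa [lin_eval]
      rw [Set.mem_ofPred_eq, eval_mul, eval_mul, eval_hom hp h1', eval_hom hq h1', lin_eval,
        lin_eval]
      linear_combination (e * t + d) ^ 5 * h2
    · have := (eventually_lin_ne hD).and h
      exact frequently_cofinite_iff_infinite.1 this.frequently
  · rintro ⟨a, b, e, d, hD, h⟩
    refine ⟨a, b, e, d, hD, ?_⟩
    filter_upwards [eventually_lin_ne hD] with t ht
    have h1' : (C e * X + C d : ℝ[X]).eval t ≠ 0 := by rwa [lin_eval]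
    have h2 := congrArg (eval t) h
    rw [eval_mul, eval_mul, eval_hom hp h1', eval_hom hq h1', lin_eval, lin_eval] at h2
    refine mul_left_cancel₀ (pow_ne_zero 5 ht) ?_
    linear_combination h2

theorem Good.smul_of_rel (h : Good p q c x) (h' : Good p' q' c x') (hr : Rel p q p' q') :
    ∃ a b e d u : ℝ, a * d - b * e ≠ 0 ∧ u ≠ 0 ∧
      p' = C u * hom 5 p (C a * X + C b) (C e * X + C d) ∧
      q' = C u * hom 5 q (C a * X + C b) (C e * X + C d) := by
  obtain ⟨a, b, e, d, hD, he⟩ := (rel_iff h.degp.le (h.degq.le.trans (by norm_num))).1 hr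
  obtain ⟨u, hu⟩ := Good.exists_smul h' h hD (by linear_combination -he)
  exact ⟨a, b, e, d, u, hD, hu⟩

theorem rel_of_smul (hp : p.natDegree ≤ 5) (hq : q.natDegree ≤ 5) {a b e d u : ℝ}
    (hD : a * d - b * e ≠ 0) : Rel p q (C u * hom 5 p (C a * X + C b) (C e * X + C d))
      (C u * hom 5 q (C a * X + C b) (C e * X + C d)) :=
  (rel_iff hp hq).2 ⟨a, b, e, d, hD, by ring⟩

theorem aeval_div {A B : ℝ[X]} (hB : B ≠ 0) {n : ℕ} (hp : p.natDegree ≤ n) :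
    aeval (algebraMap ℝ[X] (RatFunc ℝ) A / algebraMap ℝ[X] (RatFunc ℝ) B) p =
      algebraMap ℝ[X] (RatFunc ℝ) (hom n p A B) / algebraMap ℝ[X] (RatFunc ℝ) B ^ n := by
  have hB' : algebraMap ℝ[X] (RatFunc ℝ) B ≠ 0 := by simpa using hB
  rw [aeval_eq_sum_range' (Nat.lt_succ_of_le hp), hom, map_sum, Finset.sum_div]
  refine Finset.sum_congr rfl fun k hk => ?_
  have hk' : k ≤ n := Nat.lt_succ_iff.1 (Finset.mem_range.1 hk)
  rw [map_mul, map_mul, map_pow, map_pow, div_pow, Algebra.smul_def,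
    IsScalarTower.algebraMap_apply ℝ ℝ[X] (RatFunc ℝ), Polynomial.algebraMap_eq,
    eq_div_iff (pow_ne_zero _ hB'), mul_assoc, mul_assoc]
  congr 1
  rw [div_mul_eq_mul_div, div_eq_iff (pow_ne_zero _ hB'), mul_assoc, ← pow_add, Nat.sub_add_cancel hk']

theorem hom_ne_zero {f : ℝ[X]} (hf : f ≠ 0) (h5 : f.natDegree ≤ 5) {a b e d : ℝ}
    (hD : a * d - b * e ≠ 0) : hom 5 f (C a * X + C b) (C e * X + C d) ≠ 0 := by
  obtain ⟨t, h1, h2⟩ := ((eventually_lin_ne hD).and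
    ((tendsto_moebius hD).eventually (eventually_eval_ne hf))).exists
  intro h0
  have h1' : (C e * X + C d : ℝ[X]).eval t ≠ 0 := by rwa [lin_eval]
  have h3 := congrArg (eval t) h0
  rw [eval_hom h5 h1', lin_eval, lin_eval, eval_zero] at h3
  exact (mul_ne_zero (pow_ne_zero _ h1) h2) h3

theorem mobiusEquiv_iff {f g : RatFunc ℝ} (hp : f.num.natDegree ≤ 5)
    (hq : f.denom.natDegree ≤ 5) : MobiusEquiv f g ↔ Rel f.num f.denom g.num g.denom := by
  rw [rel_iff hp hq, MobiusEquiv]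
  refine exists_congr fun a => exists_congr fun b => exists_congr fun e => exists_congr fun d => ?_
  refine and_congr_right fun hD => ?_
  have hB := lin_poly_ne_zero hD
  have hB' : algebraMap ℝ[X] (RatFunc ℝ) (C e * X + C d) ≠ 0 :=
    (map_ne_zero_iff _ (RatFunc.algebraMap_injective ℝ)).2 hB
  have hd : algebraMap ℝ[X] (RatFunc ℝ) (hom 5 f.denom (C a * X + C b) (C e * X + C d)) ≠ 0 :=
    (map_ne_zero_iff _ (RatFunc.algebraMap_injective ℝ)).2 (hom_ne_zero f.denom_ne_zero hq hD)
  have hg : algebraMap ℝ[X] (RatFunc ℝ) g.denom ≠ 0 := by simpa using g.denom_ne_zero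
  simp only [exists_eq_left]
  rw [aeval_div hB hp, aeval_div hB hq, div_div_div_cancel_right₀ (pow_ne_zero _ hB')]
  conv_lhs => lhs; rw [← RatFunc.num_div_denom g]
  rw [div_eq_div_iff hg hd, ← map_mul, ← map_mul]
  rw [(RatFunc.algebraMap_injective ℝ).eq_iff, mul_comm (hom 5 f.num _ _)]

end

section

variable {p q p' q' : ℝ[X]} {c x x' : Fin 8 → ℝ} {X X' : Fin 5 → ℂ → ℂ}
  {w v : Fin 8 → Equiv.Perm (Fin 5)} {f g : RatFunc ℝ}

theorem wr_smul (u : ℝ) (p q : ℝ[X]) : wr (C u * p) (C u * q) = C (u * u) * wr p q := by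
  rw [wr, wr, derivative_C_mul, derivative_C_mul, C_mul]; ring

theorem exists_num_denom (h : IsCoprime p q) (hq : q ≠ 0) : ∃ (f : RatFunc ℝ) (u : ℝ),
    u ≠ 0 ∧ f.num = C u * p ∧ f.denom = C u * q := by
  refine ⟨algebraMap _ _ p / algebraMap _ _ q, ?_⟩
  set f : RatFunc ℝ := algebraMap _ _ p / algebraMap _ _ q with hf
  have he : f.num * q = p * f.denom := by
    have h1 := RatFunc.num_div_denom f
    rw [hf, div_eq_div_iff, ← map_mul, ← map_mul,
      (RatFunc.algebraMap_injective ℝ).eq_iff] at h1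
    · exact h1
    · exact (map_ne_zero_iff _ (RatFunc.algebraMap_injective ℝ)).2 (RatFunc.denom_ne_zero _)
    · exact (map_ne_zero_iff _ (RatFunc.algebraMap_injective ℝ)).2 hq
  have hd : q ∣ f.denom := h.symm.dvd_of_dvd_mul_left (Dvd.intro_left _ he)
  obtain ⟨k, hk⟩ := hd
  have hn : f.num = k * p := by
    refine mul_right_cancel₀ hq ?_
    rw [he, hk]; ring
  have hu : IsUnit k := f.isCoprime_num_denom.isUnit_of_dvd' ⟨p, hn⟩ ⟨q, by rw [hk, mul_comm]⟩
  obtain ⟨u, hu0, rfl⟩ := isUnit_iff.1 hu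
  exact ⟨u, hu0.ne_zero, hn, by rw [hk, mul_comm]⟩

/-- A generic pair defines a generic rational function. -/
theorem Good.exists_generic (h : Good p q c x) : ∃ f : RatFunc ℝ,
    GenericDegR 5 (Set.range c) f ∧ Rel p q f.num f.denom := by
  obtain ⟨f, u, hu, hn, hd⟩ := exists_num_denom h.isCoprime h.q_ne_zero
  have hW : wronskian' f = C (u * u * q.leadingCoeff) * ∏ j, (X - C (x j)) := by
    have : wronskian' f = wr f.num f.denom := rfl
    rw [this, hn, hd, wr_smul, h.wr_eq, ← mul_assoc, ← C_mul]
  have hκ : u * u * q.leadingCoeff ≠ 0 := mul_ne_zero (mul_ne_zero hu hu) h.pos.ne'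
  have hroot : ∀ z : ℂ, aeval z (wronskian' f) = 0 ↔ ∃ j, z = x j := by
    intro z
    rw [hW, map_mul, aeval_C, mul_eq_zero, map_prod, Finset.prod_eq_zero_iff]
    simp only [map_sub, aeval_X, aeval_C, Complex.coe_algebraMap, sub_eq_zero]
    have : ((u * u * q.leadingCoeff : ℝ) : ℂ) ≠ 0 := by exact_mod_cast hκ
    simp [-Complex.ofReal_mul, this]
  have hval : ∀ j, aeval (x j : ℂ) f.denom ≠ 0 ∧
      aeval (x j : ℂ) f.num / aeval (x j : ℂ) f.denom = c j := by
    intro j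
    have hq := h.q_eval_ne j
    have h1 : ∀ r : ℝ[X], aeval (x j : ℂ) r = ((r.eval (x j) : ℝ) : ℂ) := fun r =>
      Polynomial.aeval_algebraMap_apply_eq_algebraMap_eval (x j) r
    rw [h1, h1, hn, hd, eval_mul, eval_mul, h.val, eval_C]
    refine ⟨by exact_mod_cast mul_ne_zero hu hq, ?_⟩
    rw [← Complex.ofReal_div]
    congr 1
    field_simp
  refine ⟨f, ⟨?_, ?_, ?_, ?_⟩, ?_⟩
  · rw [hn, hd, natDegree_C_mul hu, natDegree_C_mul hu, h.degp, h.degq]; rfl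
  · rw [hW, natDegree_C_mul hκ, natDegree_prod_eight]
  · intro z hz
    obtain ⟨j, rfl⟩ := (hroot z).1 hz
    exact (hval j).1
  · ext y
    constructor
    · rintro ⟨z, hz, rfl⟩
      obtain ⟨j, rfl⟩ := (hroot z).1 hz
      exact ⟨c j, ⟨j, rfl⟩, (hval j).2.symm⟩
    · rintro ⟨_, ⟨j, rfl⟩, rfl⟩
      exact ⟨x j, (hroot _).2 ⟨j, rfl⟩, (hval j).2⟩
  · refine ⟨1, 0, 0, 1, by norm_num, Eventually.of_forall fun t => ?_⟩
    rw [hn, hd]; simp; ring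

/-- The critical points and values of a generic rational function. -/
theorem exists_gen {Cv : Set ℝ} (hc : Function.Injective c) (hCv : Set.range c = Cv)
    (h : GenericDegR 5 Cv f) : ∃ κ x, Gen f.num f.denom κ c x := by
  obtain ⟨hdeg, hW, hden, hval⟩ := h
  have hW0 : wronskian' f ≠ 0 := by
    intro h0; rw [h0] at hW; simp at hW
  have hz : ∀ j, ∃ z : ℂ, aeval z (wronskian' f) = 0 ∧
      aeval z f.num / aeval z f.denom = c j := by
    intro j
    have : (c j : ℂ) ∈ Complex.ofReal '' Cv := ⟨c j, hCv ▸ ⟨j, rfl⟩, rfl⟩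
    rw [← hval] at this
    exact this
  choose z hz0 hzc using hz
  have hzinj : Function.Injective z := by
    intro i j hij
    refine hc ?_
    have := hzc i
    rw [hij, hzc j] at this
    exact_mod_cast this.symm
  have hcard : ∀ r : ℂ, aeval r (wronskian' f) = 0 → ∃ j, r = z j := by
    have hcx : cx (wronskian' f) ≠ 0 := (Polynomial.map_ne_zero_iff (algebraMap ℝ ℂ).injective).2 hW0
    have hsub : Finset.univ.image z ⊆ (cx (wronskian' f)).roots.toFinset := by
      intro r hr
      obtain ⟨j, -, rfl⟩ := Finset.mem_image.1 hr
      rw [Multiset.mem_toFinset, mem_roots hcx, IsRoot, eval_map_algebraMap, hz0]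
    have heq := Finset.eq_of_subset_of_card_le hsub (by
      rw [Finset.card_image_of_injective _ hzinj, Finset.card_univ, Fintype.card_fin]
      refine (Multiset.toFinset_card_le _).trans ((card_roots' _).trans ?_)
      rw [natDegree_map, hW])
    intro r hr
    have : r ∈ (cx (wronskian' f)).roots.toFinset := by
      rw [Multiset.mem_toFinset, mem_roots hcx, IsRoot, eval_map_algebraMap, hr]
    rw [← heq] at this
    obtain ⟨j, -, hj⟩ := Finset.mem_image.1 this
    exact ⟨j, hj.symm⟩
  have hconj : ∀ (r : ℝ[X]) (t : ℂ), aeval (starRingEnd ℂ t) r = starRingEnd ℂ (aeval t r) := by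
    intro r t
    rw [← Complex.conjAe_coe, ← aeval_algHom_apply]
  have hreal : ∀ j, starRingEnd ℂ (z j) = z j := by
    intro j
    obtain ⟨k, hk⟩ := hcard (starRingEnd ℂ (z j)) (by rw [hconj, hz0, map_zero])
    have h1 := hzc k
    rw [← hk, hconj, hconj, ← map_div₀, hzc j, Complex.conj_ofReal] at h1
    have h2 : c j = c k := by exact_mod_cast h1
    rw [hk, hc h2]
  obtain ⟨x, hx⟩ : ∃ x : Fin 8 → ℝ, ∀ j, z j = x j :=
    ⟨fun j => (z j).re, fun j => (Complex.conj_eq_iff_re.1 (hreal j)).symm⟩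
  have hev : ∀ j (r : ℝ[X]), aeval (z j) r = ((r.eval (x j) : ℝ) : ℂ) := fun j r => by
    rw [hx]; exact Polynomial.aeval_algebraMap_apply_eq_algebraMap_eval (x j) r
  have hxinj : Function.Injective x := fun i j hij => hzinj (by rw [hx, hx, hij])
  have hdvd : ∏ j, (X - C (x j)) ∣ wronskian' f := by
    refine Finset.prod_dvd_of_coprime (fun i _ j _ hij => pairwise_coprime_X_sub_C hxinj hij)
      fun j _ => dvd_iff_isRoot.2 ?_
    have := hz0 j
    rw [hev] at this
    exact_mod_cast this
  obtain ⟨k, hk⟩ := hdvd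
  have hk0 : k ≠ 0 := by rintro rfl; exact hW0 (by rw [hk, mul_zero])
  have hm : (∏ j, (X - C (x j))).Monic := monic_prod_of_monic _ _ fun i _ => monic_X_sub_C _
  have hkd : k.natDegree = 0 := by
    rw [hk, hm.natDegree_mul' hk0, natDegree_prod_eight] at hW; omega
  obtain ⟨κ, rfl⟩ := natDegree_eq_zero.1 hkd
  refine ⟨κ, x, ⟨hdeg ▸ le_max_left _ _, hdeg ▸ le_max_right _ _, by rintro rfl; simp at hk0, ?_, hxinj, ?_⟩⟩
  · rw [mul_comm, ← hk]; rfl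
  · intro j
    have h1 := hden _ (hz0 j)
    have h2 := hzc j
    rw [div_eq_iff h1, hev, hev] at h2
    exact_mod_cast h2

theorem exists_good {Cv : Set ℝ} (hc : Function.Injective c) (hCv : Set.range c = Cv)
    (h : GenericDegR 5 Cv f) : ∃ p q x, Good p q c x ∧ Rel f.num f.denom p q := by
  obtain ⟨κ, x, hg⟩ := exists_gen hc hCv h
  obtain ⟨a, b, e, d, u, hD, hu, x', hx'⟩ := hg.exists_good
  exact ⟨_, _, x', hx', rel_of_smul hg.degp hg.degq hD⟩

/-- Conjugacy of walks. -/
def ConjWalk (w v : Fin 8 → Equiv.Perm (Fin 5)) : Prop :=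
  ∃ ρ : Equiv.Perm (Fin 5), ∀ k, v k = ρ⁻¹ * w k * ρ

theorem conjWalk_iff_rel (hc : StrictMono c) (h : Good p q c x) (hs : Sheets p q X)
    (hw : IsMon X c w) (h' : Good p' q' c x') (hs' : Sheets p' q' X') (hv : IsMon X' c v) :
    ConjWalk w v ↔ Rel p q p' q' := by
  constructor
  · rintro ⟨ρ, hρ⟩
    obtain rfl : v = _ := funext hρ
    obtain ⟨a, b, e, d, u, hD, hu, rfl, rfl⟩ := IsMon.exists_moebius_smul h' hc hs' hv h
      (hs.comp_perm ρ) (hw.comp_perm ρ)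
    exact rel_of_smul h.degp.le (h.degq.le.trans (by norm_num)) hD
  · intro hr
    obtain ⟨a, b, e, d, u, hD, hu, rfl, rfl⟩ := h.smul_of_rel h' hr
    exact hw.conj_of_moebius h hc hs hD hu h' hs' hv

theorem conjWalk_equivalence (c : Fin 8 → ℝ) :
    Equivalence fun w v : {w // ∃ x₀, Realized w x₀ c} => ConjWalk w.1 v.1 := by
  refine ⟨fun w => ⟨1, fun k => by simp⟩, ?_, ?_⟩
  · rintro _ _ ⟨ρ, hρ⟩
    exact ⟨ρ⁻¹, fun k => by rw [hρ]; group⟩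
  · rintro _ _ _ ⟨ρ, hρ⟩ ⟨τ, hτ⟩
    exact ⟨ρ * τ, fun k => by rw [hτ, hρ]; group⟩

/-- Classes of generic rational functions correspond to conjugacy classes of realized walks. -/
theorem card_classes (hc : StrictMono c) :
    Nat.card (Quot fun f g : {f : RatFunc ℝ // GenericDegR 5 (Set.range c) f} =>
      MobiusEquiv f.1 g.1) =
    Nat.card (Quot fun w v : {w // ∃ x₀, Realized w x₀ c} => ConjWalk w.1 v.1) := by
  have hex : ∀ f : {f : RatFunc ℝ // GenericDegR 5 (Set.range c) f}, ∃ w p q x X,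
      Good p q c x ∧ Sheets p q X ∧ IsMon X c w ∧ Rel f.1.num f.1.denom p q := by
    rintro ⟨f, hf⟩
    obtain ⟨p, q, x, h, hr⟩ := exists_good hc.injective rfl hf
    obtain ⟨X, hs⟩ := h.exists_sheets
    obtain ⟨w, hw⟩ := exists_isMon h hc hs
    exact ⟨w, p, q, x, X, h, hs, hw, hr⟩
  choose W P Q x X hG hS hM hR using hex
  have hdeg : ∀ f : {f : RatFunc ℝ // GenericDegR 5 (Set.range c) f},
      f.1.num.natDegree ≤ 5 ∧ f.1.denom.natDegree ≤ 5 := fun f =>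
    ⟨(le_max_left _ _).trans f.2.1.le, (le_max_right _ _).trans f.2.1.le⟩
  have key : ∀ f g, ConjWalk (W f) (W g) ↔ MobiusEquiv f.1 g.1 := by
    intro f g
    rw [conjWalk_iff_rel hc (hG f) (hS f) (hM f) (hG g) (hS g) (hM g),
      mobiusEquiv_iff (hdeg f).1 (hdeg f).2]
    constructor
    · intro h
      exact ((hR f).trans h (hG f).q_ne_zero).trans (hR g).symm (hG g).q_ne_zero
    · intro h
      exact ((hR f).symm.trans h f.1.denom_ne_zero).trans (hR g) g.1.denom_ne_zero
  refine Nat.card_eq_of_bijective (Quot.map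
    (fun f => ⟨W f, x f, P f, Q f, x f, X f, hG f, hS f, hM f, fun _ _ => Iff.rfl⟩)
    fun f g h => (key f g).2 h) ⟨?_, ?_⟩
  · rintro ⟨f⟩ ⟨g⟩ h
    exact Quot.sound ((key f g).1 ((conjWalk_equivalence c).eqvGen_iff.1 (Quot.eqvGen_exact h)))
  · rintro ⟨w, x₀, p, q, y, Y, h, hs, hw, ho⟩
    obtain ⟨f, hf, hr⟩ := h.exists_generic
    refine ⟨Quot.mk _ ⟨f, hf⟩, Quot.sound ?_⟩
    exact (conjWalk_iff_rel hc (hG _) (hS _) (hM _) h hs hw).2 ((hr.trans (hR ⟨f, hf⟩)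
      f.denom_ne_zero).symm)

end

section

variable {c x₀ : Fin 8 → ℝ} {w v : Fin 8 → Equiv.Perm (Fin 5)}

/-- Only the trivial sets are invariant under all `w k`. -/
def Transitive (w : Fin 8 → Equiv.Perm (Fin 5)) : Prop :=
  ∀ S : Finset (Fin 5), (∀ k, ∀ i ∈ S, w k i ∈ S) → S = ∅ ∨ S = Finset.univ

theorem Realized.walk (hc : StrictMono c) (h : Realized w x₀ c) : Walk w := by
  obtain ⟨p, q, x, X, hg, hs, hw, -⟩ := h
  exact hw.walk hg hc hs

theorem Realized.transitive (hc : StrictMono c) (h : Realized w x₀ c) : Transitive w := by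
  obtain ⟨p, q, x, X, hg, hs, hw, -⟩ := h
  exact fun S hS => hw.transitive hg hc hs hS

theorem Realized.conj (h : Realized w x₀ c) (ρ : Equiv.Perm (Fin 5)) :
    Realized (fun k => ρ⁻¹ * w k * ρ) x₀ c := by
  obtain ⟨p, q, x, X, hg, hs, hw, ho⟩ := h
  exact ⟨p, q, x, _, hg, hs.comp_perm ρ, hw.comp_perm ρ, ho⟩

theorem Walk.conj (h : Walk w) (ρ : Equiv.Perm (Fin 5)) : Walk fun k => ρ⁻¹ * w k * ρ where
  inv k := by
    have := h.inv k
    calc ρ⁻¹ * w k * ρ * (ρ⁻¹ * w k * ρ) = ρ⁻¹ * (w k * w k) * ρ := by group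
      _ = 1 := by rw [this]; group
  step k := by
    rcases h.step k with hk | ⟨a, b, hab, hk⟩
    · exact Or.inl (by rw [hk])
    · refine Or.inr ⟨ρ⁻¹ a, ρ⁻¹ b, fun h => hab (ρ⁻¹.injective h), ?_⟩
      rw [hk, Equiv.swap_apply_apply]; group

theorem Transitive.conj (h : Transitive w) (ρ : Equiv.Perm (Fin 5)) :
    Transitive fun k => ρ⁻¹ * w k * ρ := by
  intro S hS
  have key : ∀ k, ∀ i ∈ S.map ρ.toEmbedding, w k i ∈ S.map ρ.toEmbedding := by
    intro k i hi
    obtain ⟨j, hj, rfl⟩ := Finset.mem_map.1 hi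
    exact Finset.mem_map.2 ⟨_, hS k j hj, by simp⟩
  rcases h _ key with h | h
  · left; simpa using h
  · right
    refine Finset.eq_univ_of_card _ ?_
    rw [← Finset.card_map ρ.toEmbedding, h, Finset.card_univ]

theorem Transitive.exists_swap (h : Transitive w) (hw : Walk w) :
    ∃ k a b, a ≠ b ∧ w (k + 1) = Equiv.swap a b * w k := by
  by_contra! hcon
  have hstep : ∀ k, w (k + 1) = w k := fun k => (hw.step k).resolve_right fun ⟨a, b, hab, h⟩ =>
    hcon k a b hab h
  have hall : ∀ k, w k = w 0 := by
    have := hstep 0; have := hstep 1; have := hstep 2; have := hstep 3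
    have := hstep 4; have := hstep 5; have := hstep 6
    intro k
    fin_cases k <;> simp_all
  have hinv := hw.inv 0
  have key : ∀ k, ∀ i ∈ ({0, w 0 0} : Finset (Fin 5)), w k i ∈ ({0, w 0 0} : Finset (Fin 5)) := by
    intro k i hi
    rw [hall k]
    rcases Finset.mem_insert.1 hi with rfl | hi
    · simp
    · rw [Finset.mem_singleton.1 hi, ← Equiv.Perm.mul_apply, hinv]; simp
  rcases h _ key with h | h
  · simp at h
  · have h2 := congrArg Finset.card h
    have h3 := Finset.card_le_two (a := (0 : Fin 5)) (b := w 0 0)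
    rw [h2] at h3
    simp at h3

theorem exists_fixed : ∀ ρ : Equiv.Perm (Fin 5), ρ * ρ = 1 → ∃ i, ρ i = i := by
  decide +kernel

theorem Transitive.fixed (h : Transitive w) {ρ : Equiv.Perm (Fin 5)}
    (hρ : ∀ k, ρ * w k = w k * ρ) {a : Fin 5} (ha : ρ a = a) : ρ = 1 := by
  have key : ∀ k, ∀ i ∈ Finset.univ.filter fun i => ρ i = i,
      w k i ∈ Finset.univ.filter fun i => ρ i = i := by
    intro k i hi
    have hi' := (Finset.mem_filter.1 hi).2
    refine Finset.mem_filter.2 ⟨Finset.mem_univ _, ?_⟩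
    rw [← Equiv.Perm.mul_apply, hρ, Equiv.Perm.mul_apply, hi']
  rcases h _ key with h | h
  · have : a ∈ (∅ : Finset (Fin 5)) := h ▸ Finset.mem_filter.2 ⟨Finset.mem_univ _, ha⟩
    simp at this
  · ext1 i
    have : i ∈ Finset.univ.filter fun i => ρ i = i := by rw [h]; exact Finset.mem_univ i
    exact (Finset.mem_filter.1 this).2

/-- The conjugation action on transitive walks is free. -/
theorem Transitive.eq_one (h : Transitive w) (hw : Walk w) {ρ : Equiv.Perm (Fin 5)}
    (hρ : ∀ k, ρ * w k = w k * ρ) : ρ = 1 := by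
  obtain ⟨k, a, b, hab, hk⟩ := h.exists_swap hw
  have hsw : ρ * Equiv.swap a b = Equiv.swap a b * ρ := by
    have h1 := hρ (k + 1)
    rw [hk, ← mul_assoc, mul_assoc _ _ ρ, ← hρ, ← mul_assoc] at h1
    exact mul_right_cancel h1
  have h1 : Equiv.swap a b (ρ a) = ρ b := by
    rw [← Equiv.Perm.mul_apply, ← hsw, Equiv.Perm.mul_apply, Equiv.swap_apply_left]
  by_cases ha : ρ a = a
  · exact h.fixed hρ ha
  have hb : ρ a = b := by
    by_contra hb
    rw [Equiv.swap_apply_of_ne_of_ne ha hb] at h1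
    exact hab (ρ.injective h1)
  rw [hb, Equiv.swap_apply_right] at h1
  have h2 : ρ * ρ = 1 := by
    refine h.fixed (a := a) (fun k => ?_) (by rw [Equiv.Perm.mul_apply, hb, ← h1])
    rw [mul_assoc, hρ, ← mul_assoc, hρ, mul_assoc]
  obtain ⟨i, hi⟩ := exists_fixed ρ h2
  exact h.fixed hρ hi

/-- The finite set of all transitive walks. -/
noncomputable def walks : Finset (Fin 8 → Equiv.Perm (Fin 5)) :=
  (Set.toFinite {w | Walk w ∧ Transitive w}).toFinset

theorem mem_walks : w ∈ walks ↔ Walk w ∧ Transitive w := by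
  rw [walks, Set.Finite.mem_toFinset]; rfl

theorem card_mul_le (hc : StrictMono c) :
    Nat.card (Quot fun w v : {w // ∃ x₀, Realized w x₀ c} => ConjWalk w.1 v.1) * 120 ≤
      walks.card := by
  have h120 : Nat.card (Equiv.Perm (Fin 5)) = 120 := by
    rw [Nat.card_eq_fintype_card, Fintype.card_perm]; rfl
  have hwalk : ∀ w : {w // ∃ x₀, Realized w x₀ c}, Walk w.1 ∧ Transitive w.1 :=
    fun ⟨w, x₀, h⟩ => ⟨h.walk hc, h.transitive hc⟩
  refine (congrArg (_ * ·) h120.symm).trans_le ?_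
  rw [← Nat.card_prod, ← Nat.card_eq_finsetCard walks]
  refine Nat.card_le_card_of_injective (fun a => ⟨fun k => a.2⁻¹ * a.1.out.1 k * a.2, ?_⟩) ?_
  · exact mem_walks.2 ⟨(hwalk _).1.conj _, (hwalk _).2.conj _⟩
  · rintro ⟨Q, ρ⟩ ⟨R, τ⟩ h
    have hk : ∀ k, ρ⁻¹ * Q.out.1 k * ρ = τ⁻¹ * R.out.1 k * τ := congrFun (Subtype.ext_iff.1 h)
    have hQR : Q = R := by
      rw [← Quot.out_eq Q, ← Quot.out_eq R]
      exact Quot.sound ⟨ρ * τ⁻¹, fun k => by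
        have := hk k
        calc R.out.1 k = τ * (τ⁻¹ * R.out.1 k * τ) * τ⁻¹ := by group
          _ = _ := by rw [← this]; group⟩
    subst hQR
    have h1 : τ * ρ⁻¹ = 1 := (hwalk Q.out).2.eq_one (hwalk Q.out).1 fun k => by
      have := hk k
      calc τ * ρ⁻¹ * Q.out.1 k = τ * (ρ⁻¹ * Q.out.1 k * ρ) * ρ⁻¹ := by group
        _ = _ := by rw [this]; group
    rw [mul_inv_eq_one.1 h1]

end

section

variable {w : Fin 8 → Equiv.Perm (Fin 5)}

/-- The involutions of `Fin 5`, numbered from `0` to `25`. -/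
def dec (s : ℕ) (i : Fin 5) : Fin 5 :=
  Fin.ofNat 5 (51411109686364841695738146600584996716893901481186825674326885536315474534821082260771718238168233312253328987571848 >>> (15 * s + 3 * i.val) % 8)

/-- The neighbours of an involution: those differing from it by at most a transposition. -/
def nbr (s : ℕ) : List ℕ :=
  List.getD
  [[0, 1, 2, 3, 4, 5, 6, 7, 8, 9, 10],
   [0, 1, 11, 15, 16],
   [0, 2, 12, 15, 17],
   [0, 3, 11, 14, 23],
   [0, 4, 13, 16, 20],
   [0, 5, 12, 21, 24],
   [0, 6, 13, 18, 25],
   [0, 7, 14, 19, 22],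
   [0, 8, 17, 18, 19],
   [0, 9, 20, 21, 22],
   [0, 10, 23, 24, 25],
   [1, 3, 11],
   [2, 5, 12],
   [4, 6, 13],
   [3, 7, 14],
   [1, 2, 15],
   [1, 4, 16],
   [2, 8, 17],
   [6, 8, 18],
   [7, 8, 19],
   [4, 9, 20],
   [5, 9, 21],
   [7, 9, 22],
   [3, 10, 23],
   [5, 10, 24],
   [6, 10, 25]] s []

/-- The block containing `i` of the set partitions of `Fin 5`, numbered from `0` to `51`. -/
def lab (π : ℕ) (i : Fin 5) : ℕ :=
  27716874494108736317968460035305130187959103852148932079142720040862822669272086915026090747891749292245286000415353164280295844465562900234445710151690752558636482673638061999286297765226745467716184434470288132775684805081712264 >>> (15 * π + 3 * i.val) % 8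

/-- The number of blocks of a partition. -/
def blocks (π : ℕ) : ℕ :=
  14680261982118490850678606889584347569166895397 >>> (3 * π) % 8

/-- The join of a partition with the orbit partition of an involution. -/
def jn (s π : ℕ) : ℕ :=
  7303893850650763495128754599758950418645857761585532812848133238732519949648139241865963791363980096426646964043427375318697781445574039595344886276543438070404761871004998819646764962055494157874483039678735795932047240950906284981528672649809239450685295796009510227797172212419083596390302210943668339956233222335622831219858726044586942829707202170746200154033715974058486412189534976725970890236050095108414037536220561689174700127036354993180611909056410682162911533762028507004576972684058267720490791489125406287965215166035793290851472403994317775021689319197459576745991879946287547505604258944223789955522925149660202892604891812805670940830822829898684327582296082428476408567842177589425537786274146925939549127225112993108989430319794271703994854392842520058563492928762863405792410318343717497697388871465488549066786873378653837528743915576102145664779229090849247679664229092985452386384457280817245187744101034563416173474191921845916709701711374050927854657540611741274899691599445883220591140132925198249952276615203978779863347978116841726760128785688764940338196250789990795632733370785951130941829235172659005130583565139542888476052542790417821936880934767920973870885800242801013661012390939752314634772742718973698789366710795642702657698933801247135449627188876791272474990695350142668105977351508364825348170337968094029318822676599555413170329238501388694866722253135435168904869396725776086495946484228939264737845152629184393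48612629581863666450120613236994258325303431407709721521786170698897939457765169779275670960908662719867594977016768296178443354398340455399774141439385078032612550800478169417547065071891633142790069202084556874723365260750179536728770676583009078177840865427892979776705990208297557516263961766382310393056108939595762688149356587686127666483726871203503025769752546514766729663690009885517826541050848773658282498721261852802848697982712463308659517317851952309029776841467007714610467207442055250725461724388870510995008144946642736746243501470362312620261630545200119735602941422276602992830387381862163021493985163870274035191024580266678928305055034287761868090304893184377998896787738919866832054806551051089586113583260298769938933336687916704043413643697174839901712158543300470146470296348005872002855296343010690011786891648819980018233473324668250192756866056284089087138773210474418380723238848870918973344786244651819518392669137935651606294048017229693665731097010937920 >>> (6 * (26 * π + s)) % 64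

theorem dec_step : ∀ s < 26, ∀ a b : Fin 5,
    (∀ i, Equiv.swap a b (dec s (Equiv.swap a b (dec s i))) = i) →
      ∃ t ∈ nbr s, t < 26 ∧ ∀ i, dec t i = Equiv.swap a b (dec s i) := by
  decide +kernel

theorem jn_spec : ∀ s < 26, ∀ π < 52, jn s π < 52 ∧ jn s (jn s π) = jn s π ∧
    (∀ a, lab (jn s π) (dec s a) = lab (jn s π) a) ∧
    ∀ a b, lab π a = lab π b → lab (jn s π) a = lab (jn s π) b := by
  decide +kernel

theorem blocks_jn : ∀ s < 26, ∀ π < 52, jn s π = π → ∀ t ∈ nbr s, t < 26 ∧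
    blocks π ≤ blocks (jn t π) + 1 := by
  decide +kernel

theorem blocks_le_one : ∀ π < 52, (∀ i, lab π i = lab π 0) → blocks π ≤ 1 := by
  decide +kernel

theorem dec_injective : ∀ s < 26, ∀ t < 26, (∀ i, dec s i = dec t i) → s = t := by
  decide +kernel

/-- The sequences of `n` further involutions, starting after `s` with the partition `π`, that can
be closed up at `g`, and make the partition trivial. -/
def paths (g : ℕ) : ℕ → ℕ → ℕ → List (List ℕ)
  | 0, s, π => if blocks π ≤ 1 then if g ∈ nbr s then [[]] else [] else []
  | n + 1, s, π => if blocks π ≤ n + 2 then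
      (nbr s).flatMap fun t => (paths g n t (jn t π)).map (t :: ·) else []

/-- The application `f a`, in a form that makes the kernel evaluate `a` first. -/
def force (a : ℕ) (f : ℕ → ℕ) : ℕ :=
  Nat.rec (f 0) (fun k _ => f (k + 1)) a

theorem force_eq (a : ℕ) (f : ℕ → ℕ) : force a f = f a := by
  cases a <;> rfl

/-- The number of elements of `paths`. -/
def count (g n : ℕ) : ℕ → ℕ → ℕ :=
  Nat.rec (fun s π => if blocks π ≤ 1 then if g ∈ nbr s then 1 else 0 else 0)
    (fun n ih s π => if blocks π ≤ n + 2 then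
      ((nbr s).map fun t => force (jn t π) fun σ => ih t σ).sum else 0) n

theorem length_paths (g n s π : ℕ) : (paths g n s π).length = count g n s π := by
  induction n generalizing s π with
  | zero => change _ = if blocks π ≤ 1 then _ else _; rw [paths]; split_ifs <;> rfl
  | succ n ih =>
    rw [paths, count]
    dsimp only
    split_ifs
    · simp [List.length_flatMap, ih, force_eq, count]
    · rfl

theorem count_id : count 0 7 0 0 = 15480 := by decide +kernel

theorem count_swap : count 1 7 1 (jn 1 0) = 2436 := by decide +kernel

theorem count_double : count 11 7 11 (jn 11 0) = 592 := by decide +kernel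

end

section

variable {w : Fin 8 → Equiv.Perm (Fin 5)}

/-- Successive elements of `s :: l` are neighbours. -/
def Valid : ℕ → List ℕ → Prop
  | _, [] => True
  | s, t :: l => t ∈ nbr s ∧ Valid t l

/-- The join of a partition with the orbits of a list of involutions. -/
def joins (π : ℕ) : List ℕ → ℕ
  | [] => π
  | t :: l => joins (jn t π) l

theorem blocks_le_joins {s π : ℕ} {l : List ℕ} (hl : Valid s l) (hs : s < 26) (hπ : π < 52)
    (hj : jn s π = π) : blocks π ≤ blocks (joins π l) + l.length := by
  induction l generalizing s π with
  | nil => exact le_rfl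
  | cons t l ih =>
    obtain ⟨ht, hle⟩ := blocks_jn s hs π hπ hj t hl.1
    have := ih hl.2 ht (jn_spec t ht π hπ).1 (jn_spec t ht π hπ).2.1
    rw [joins, List.length_cons]; omega

theorem mem_paths {g s π : ℕ} {l : List ℕ} (hl : Valid s l) (hs : s < 26) (hπ : π < 52)
    (hj : jn s π = π) (hb : blocks (joins π l) ≤ 1) (hg : g ∈ nbr ((s :: l).getLast (by simp))) :
    l ∈ paths g l.length s π := by
  induction l generalizing s π with
  | nil =>
    change blocks π ≤ 1 at hb
    rw [List.length_nil, paths, if_pos hb, if_pos (by simpa using hg)]; simp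
  | cons t l ih =>
    obtain ⟨ht, -⟩ := blocks_jn s hs π hπ hj t hl.1
    have h1 := blocks_le_joins hl hs hπ hj
    rw [List.length_cons] at h1 ⊢
    rw [paths, if_pos (by omega), List.mem_flatMap]
    refine ⟨t, hl.1, List.mem_map.2 ⟨l, ?_, rfl⟩⟩
    exact ih hl.2 ht (jn_spec t ht π hπ).1 (jn_spec t ht π hπ).2.1 hb
      (by rwa [List.getLast_cons (by simp)] at hg)

theorem joins_spec {π : ℕ} {l : List ℕ} (hl : ∀ t ∈ l, t < 26) (hπ : π < 52) :
    joins π l < 52 ∧ (∀ t ∈ l, ∀ a, lab (joins π l) (dec t a) = lab (joins π l) a) ∧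
      ∀ a b, lab π a = lab π b → lab (joins π l) a = lab (joins π l) b := by
  induction l generalizing π with
  | nil => simpa [joins] using hπ
  | cons t l ih =>
    obtain ⟨h1, -, h2, h3⟩ := jn_spec t (hl t (by simp)) π hπ
    obtain ⟨h4, h5, h6⟩ := ih (fun t ht => hl t (by simp [ht])) h1
    refine ⟨h4, fun u hu a => ?_, fun a b hab => h6 _ _ (h3 _ _ hab)⟩
    rcases List.mem_cons.1 hu with rfl | hu
    · exact h6 _ _ (h2 a)
    · exact h5 u hu a

theorem Walk.exists_code (hw : Walk w) (k : Fin 8) {s : ℕ} (hs : s < 26) (h : ∀ i, dec s i = w k i) :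
    ∃ t ∈ nbr s, t < 26 ∧ ∀ i, dec t i = w (k + 1) i := by
  obtain ⟨a, b, hab⟩ : ∃ a b, w (k + 1) = Equiv.swap a b * w k := by
    rcases hw.step k with h | ⟨a, b, -, h⟩
    · exact ⟨0, 0, by rw [h, Equiv.swap_self]; rfl⟩
    · exact ⟨a, b, h⟩
  have hinv : ∀ i, w (k + 1) (w (k + 1) i) = i := fun i => by
    rw [← Equiv.Perm.mul_apply, hw.inv]; rfl
  obtain ⟨t, ht, ht', he⟩ := dec_step s hs a b fun i => by
    have := hinv i
    rw [hab] at this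
    simpa [h] using this
  exact ⟨t, ht, ht', fun i => by rw [he, hab, h]; rfl⟩

/-- The numbers of the involutions in a transitive walk. -/
theorem Walk.exists_codes (hw : Walk w) (ht : Transitive w) {g : ℕ} (hg : g < 26)
    (h0 : ∀ i, dec g i = w 0 i) :
    ∃ t₁ t₂ t₃ t₄ t₅ t₆ t₇, Valid g [t₁, t₂, t₃, t₄, t₅, t₆, t₇] ∧ g ∈ nbr t₇ ∧
      blocks (joins (jn g 0) [t₁, t₂, t₃, t₄, t₅, t₆, t₇]) ≤ 1 ∧
      ∀ k i, dec ([g, t₁, t₂, t₃, t₄, t₅, t₆, t₇].getD (k : Fin 8) 0) i = w k i := by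
  obtain ⟨t₁, n₁, l₁, h₁⟩ := hw.exists_code 0 hg h0
  obtain ⟨t₂, n₂, l₂, h₂⟩ := hw.exists_code 1 l₁ h₁
  obtain ⟨t₃, n₃, l₃, h₃⟩ := hw.exists_code 2 l₂ h₂
  obtain ⟨t₄, n₄, l₄, h₄⟩ := hw.exists_code 3 l₃ h₃
  obtain ⟨t₅, n₅, l₅, h₅⟩ := hw.exists_code 4 l₄ h₄
  obtain ⟨t₆, n₆, l₆, h₆⟩ := hw.exists_code 5 l₅ h₅
  obtain ⟨t₇, n₇, l₇, h₇⟩ := hw.exists_code 6 l₆ h₆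
  obtain ⟨t₈, n₈, l₈, h₈⟩ := hw.exists_code 7 l₇ h₇
  have hall : ∀ k i, dec ((g :: [t₁, t₂, t₃, t₄, t₅, t₆, t₇]).getD (k : Fin 8) 0) i = w k i := by
    intro k
    fin_cases k
    exacts [h0, h₁, h₂, h₃, h₄, h₅, h₆, h₇]
  have hlt : ∀ t ∈ g :: [t₁, t₂, t₃, t₄, t₅, t₆, t₇], t < 26 := by
    simp only [List.mem_cons, List.not_mem_nil]
    rintro t (rfl | rfl | rfl | rfl | rfl | rfl | rfl | rfl | h) <;> first | assumption | exact h.elim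
  have hmem : ∀ k : Fin 8, (g :: [t₁, t₂, t₃, t₄, t₅, t₆, t₇]).getD k 0 ∈
      g :: [t₁, t₂, t₃, t₄, t₅, t₆, t₇] := by
    intro k
    rw [List.getD_eq_getElem _ _ (by simp)]
    exact List.getElem_mem _
  have hv : Valid g [t₁, t₂, t₃, t₄, t₅, t₆, t₇] := ⟨n₁, n₂, n₃, n₄, n₅, n₆, n₇, trivial⟩
  have hlast : g ∈ nbr t₇ := by
    rwa [← dec_injective t₈ l₈ g hg fun i => (h₈ i).trans (h0 i).symm]
  obtain ⟨hj1, -, hj3, -⟩ := jn_spec g hg 0 (by norm_num)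
  refine ⟨t₁, t₂, t₃, t₄, t₅, t₆, t₇, hv, hlast, ?_, hall⟩
  obtain ⟨hf1, hf2, hf3⟩ := joins_spec (π := jn g 0) (l := [t₁, t₂, t₃, t₄, t₅, t₆, t₇])
    (fun t ht => hlt t (List.mem_cons_of_mem _ ht)) hj1
  generalize joins (jn g 0) [t₁, t₂, t₃, t₄, t₅, t₆, t₇] = σ at *
  refine blocks_le_one _ hf1 ?_
  have key : ∀ k, ∀ i ∈ Finset.univ.filter fun i => lab σ i = lab σ 0,
      w k i ∈ Finset.univ.filter fun i => lab σ i = lab σ 0 := by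
    intro k i hi
    refine Finset.mem_filter.2 ⟨Finset.mem_univ _, ?_⟩
    rw [← (Finset.mem_filter.1 hi).2, ← hall k i]
    rcases List.mem_cons.1 (hmem k) with h | h
    · rw [h]; exact hf3 _ _ (hj3 i)
    · exact hf2 _ h i
  rcases ht _ key with h | h
  · have : (0 : Fin 5) ∈ (∅ : Finset (Fin 5)) :=
      h ▸ Finset.mem_filter.2 ⟨Finset.mem_univ _, rfl⟩
    simp at this
  · intro i
    have : i ∈ Finset.univ.filter fun i => lab σ i = lab σ 0 := by
      rw [h]; exact Finset.mem_univ i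
    exact (Finset.mem_filter.1 this).2

/-- A transitive walk starting at the involution numbered `g` comes from an element of `paths`. -/
theorem Walk.exists_path (hw : Walk w) (ht : Transitive w) {g : ℕ} (hg : g < 26)
    (h0 : ∀ i, dec g i = w 0 i) :
    ∃ l ∈ paths g 7 g (jn g 0), ∀ k i, dec ((g :: l).getD (k : Fin 8) 0) i = w k i := by
  obtain ⟨t₁, t₂, t₃, t₄, t₅, t₆, t₇, hv, hlast, hb, hall⟩ := hw.exists_codes ht hg h0
  obtain ⟨hj1, hj2, -⟩ := jn_spec g hg 0 (by norm_num)
  exact ⟨_, mem_paths hv hg hj1 hj2 hb hlast, hall⟩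

theorem card_filter_le {g : ℕ} (hg : g < 26) {τ : Equiv.Perm (Fin 5)} (h : ∀ i, dec g i = τ i) :
    (walks.filter fun w => w 0 = τ).card ≤ count g 7 g (jn g 0) := by
  rw [← length_paths]
  let F : List ℕ → Fin 8 → Fin 5 → Fin 5 := fun l k => dec ((g :: l).getD k 0)
  refine le_trans ?_ ((List.toFinset_card_le _).trans_eq (List.length_map F))
  refine Finset.card_le_card_of_injOn (fun w k => w k) ?_ ?_
  · intro w hw
    obtain ⟨hw, h0⟩ := Finset.mem_filter.1 hw
    obtain ⟨hw, ht⟩ := mem_walks.1 hw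
    obtain ⟨l, hl, hlw⟩ := hw.exists_path ht hg fun i => by rw [h0, h]
    rw [Finset.mem_coe, List.mem_toFinset, List.mem_map]
    exact ⟨l, hl, funext fun k => funext fun i => hlw k i⟩
  · intro w _ v _ hwv
    funext k
    exact Equiv.ext fun i => congrFun (congrFun hwv k) i

theorem card_filter_conj (τ ρ : Equiv.Perm (Fin 5)) :
    (walks.filter fun w => w 0 = τ).card ≤ (walks.filter fun w => w 0 = ρ⁻¹ * τ * ρ).card := by
  refine Finset.card_le_card_of_injOn (fun w k => ρ⁻¹ * w k * ρ) ?_ ?_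
  · intro w hw
    obtain ⟨hw, h0⟩ := Finset.mem_filter.1 hw
    obtain ⟨hw, ht⟩ := mem_walks.1 hw
    refine Finset.mem_coe.2 (Finset.mem_filter.2 ⟨mem_walks.2 ⟨hw.conj ρ, ht.conj ρ⟩, ?_⟩)
    exact congrArg (ρ⁻¹ * · * ρ) h0
  · intro w _ v _ hwv
    funext k
    exact mul_left_cancel (mul_right_cancel (congrFun hwv k))

theorem dec_start : ∀ i, dec 0 i = (1 : Equiv.Perm (Fin 5)) i ∧
    dec 1 i = (Equiv.swap 0 1 : Equiv.Perm (Fin 5)) i ∧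
    dec 11 i = (Equiv.swap 0 1 * Equiv.swap 2 3 : Equiv.Perm (Fin 5)) i := by
  decide +kernel

/-- A bound for the number of transitive walks from an involution. -/
def bound (τ : Equiv.Perm (Fin 5)) : ℕ :=
  if τ * τ = 1 then
    if (Finset.univ.filter fun i => τ i = i).card = 5 then 15480
    else if (Finset.univ.filter fun i => τ i = i).card = 3 then 2436 else 592
  else 0

theorem exists_conj : ∀ τ : Equiv.Perm (Fin 5), τ * τ = 1 →
    (τ = 1 ∧ bound τ = 15480) ∨
    (bound τ = 2436 ∧ ∃ ρ : Equiv.Perm (Fin 5), ρ⁻¹ * τ * ρ = Equiv.swap 0 1) ∨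
    (bound τ = 592 ∧ ∃ ρ : Equiv.Perm (Fin 5), ρ⁻¹ * τ * ρ = Equiv.swap 0 1 * Equiv.swap 2 3) := by
  decide +kernel

theorem sum_bound : ∑ τ, bound τ = 48720 := by
  decide +kernel

theorem card_filter_le_bound (τ : Equiv.Perm (Fin 5)) :
    (walks.filter fun w => w 0 = τ).card ≤ bound τ := by
  by_cases hτ : τ * τ = 1
  · rcases exists_conj τ hτ with ⟨rfl, h⟩ | ⟨h, ρ, hρ⟩ | ⟨h, ρ, hρ⟩
    · have hj : jn 0 0 = 0 := by decide +kernel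
      have := card_filter_le (g := 0) (by norm_num) fun i => (dec_start i).1
      rwa [h, ← count_id, ← hj, hj]
    · refine (card_filter_conj τ ρ).trans ?_
      rw [h, ← count_swap, hρ]
      exact card_filter_le (by norm_num) fun i => (dec_start i).2.1
    · refine (card_filter_conj τ ρ).trans ?_
      rw [h, ← count_double, hρ]
      exact card_filter_le (by norm_num) fun i => (dec_start i).2.2
  · rw [Finset.filter_false_of_mem fun w hw (h : w 0 = τ) => hτ (h ▸ (mem_walks.1 hw).1.inv 0)]
    exact Nat.zero_le _

theorem card_walks_le : walks.card ≤ 48720 := by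
  rw [← sum_bound, Finset.card_eq_sum_card_fiberwise (f := fun w => w 0) (t := Finset.univ)
    fun w _ => Finset.mem_coe.2 (Finset.mem_univ _)]
  exact Finset.sum_le_sum fun τ _ => card_filter_le_bound τ

end

section

variable {c : Fin 8 → ℝ}

/-- The real polynomial with the given list of coefficients. -/
noncomputable def ofList : List ℤ → ℝ[X]
  | [] => 0
  | a :: l => C (a : ℝ) + X * ofList l

theorem coeff_ofList (l : List ℤ) (n : ℕ) : (ofList l).coeff n = (l.getD n 0 : ℤ) := by
  induction l generalizing n with
  | nil => simp [ofList]
  | cons a l ih =>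
    rw [ofList, coeff_add, coeff_C]
    cases n <;> simp [ih]

theorem ofList_map {α : Type*} (f g : α → ℤ) (a b : ℤ) (l : List α) :
    ofList (l.map fun t => a * f t + b * g t) =
      C (a : ℝ) * ofList (l.map f) + C (b : ℝ) * ofList (l.map g) := by
  induction l with
  | nil => simp [ofList]
  | cons t l ih =>
    simp only [List.map_cons, ofList] at ih ⊢
    rw [ih]; push_cast; simp only [map_add, map_mul]; ring

/-- The coefficients of `a + (X + m) * r`. -/
def horner (m : ℤ) : ℤ → List ℤ → List ℤ
  | a, [] => [a]
  | a, b :: r => (a + m * b) :: horner m b r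

theorem ofList_horner (m a : ℤ) (r : List ℤ) :
    ofList (horner m a r) = C (a : ℝ) + (X + C (m : ℝ)) * ofList r := by
  induction r generalizing a with
  | nil => simp [ofList, horner]
  | cons b r ih => rw [horner, ofList, ih, ofList]; push_cast; simp only [map_add, map_mul]; ring

/-- The coefficients of the polynomial translated by `m`. -/
def translate (m : ℤ) (l : List ℤ) : List ℤ :=
  l.foldr (horner m) []

theorem ofList_translate (m : ℤ) (l : List ℤ) :
    ofList (translate m l) = (ofList l).comp (X + C (m : ℝ)) := by
  induction l with
  | nil => simp [translate, ofList]
  | cons a l ih =>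
    rw [translate, List.foldr_cons, ofList_horner, ofList, ← translate, ih]
    simp

theorem eval_ofList_int (m : ℤ) (l : List ℤ) :
    (ofList l).eval (m : ℝ) = ((translate m l).getD 0 0 : ℤ) := by
  rw [← coeff_ofList, ofList_translate, coeff_zero_eq_eval_zero, eval_comp]; simp

theorem eval_derivative_ofList (m : ℤ) (l : List ℤ) :
    (derivative (ofList l)).eval (m : ℝ) = ((translate m l).getD 1 0 : ℤ) := by
  have h : ((ofList l).comp (X + C (m : ℝ))).coeff 1 =
      (derivative ((ofList l).comp (X + C (m : ℝ)))).coeff 0 := by simp [coeff_derivative]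
  rw [← coeff_ofList, ofList_translate, h, coeff_zero_eq_eval_zero, derivative_comp]
  simp [eval_comp]

theorem abs_eval_ofList_le (l : List ℤ) {y : ℝ} (hy : |y| ≤ 1) :
    |(ofList l).eval y| ≤ ((l.map Int.natAbs).sum : ℕ) := by
  induction l with
  | nil => simp [ofList]
  | cons a l ih =>
    rw [ofList, List.map_cons, List.sum_cons, eval_add, eval_C, eval_mul, eval_X]
    refine (abs_add_le _ _).trans ?_
    rw [abs_mul, Nat.cast_add, Nat.cast_natAbs, Int.cast_abs]
    have := mul_le_mul hy ih (abs_nonneg _) zero_le_one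
    linarith

/-- A sufficient condition for positivity on `[m - 1, m + 1]`. -/
def PosAt (l : List ℤ) (m : ℤ) : Prop :=
  ((((translate m l).tail.map Int.natAbs).sum : ℕ) : ℤ) < (translate m l).getD 0 0

instance (l : List ℤ) (m : ℤ) : Decidable (PosAt l m) := by
  unfold PosAt; infer_instance

theorem PosAt.eval_pos {l : List ℤ} {m : ℤ} (h : PosAt l m) {r : ℝ} (hr : |r - m| ≤ 1) :
    0 < (ofList l).eval r := by
  have he : (ofList l).eval r = (ofList (translate m l)).eval (r - m) := by
    rw [ofList_translate, eval_comp]; simp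
  rw [he]
  unfold PosAt at h
  generalize translate m l = k at h
  cases k with
  | nil => simp at h
  | cons a k =>
    have h1 : (((k.map Int.natAbs).sum : ℕ) : ℝ) < a := by
      rw [← Int.cast_natCast]; exact Int.cast_lt.2 h
    have h2 := (abs_le.1 (abs_eval_ofList_le k hr)).1
    have h3 : |(r - m) * (ofList k).eval (r - m)| ≤ ((k.map Int.natAbs).sum : ℕ) := by
      rw [abs_mul]
      have := mul_le_mul hr (abs_eval_ofList_le k hr) (abs_nonneg _) zero_le_one
      linarith
    rw [ofList, eval_add, eval_C, eval_mul, eval_X]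
    linarith [(abs_le.1 h3).1]

/-- The coefficients of `a * p + b * q`. -/
def comb (l : List (ℤ × ℤ)) (a b : ℤ) : List ℤ :=
  l.map fun t => a * t.1 + b * t.2

/-- The value of the Wronskian at an integer. -/
def wrAt (l : List (ℤ × ℤ)) (m : ℤ) : ℤ :=
  (translate m (l.map Prod.fst)).getD 1 0 * (translate m (l.map Prod.snd)).getD 0 0 -
    (translate m (l.map Prod.fst)).getD 0 0 * (translate m (l.map Prod.snd)).getD 1 0

/-- A certificate that there is a critical point in `[m - 1, m + 1]`, with value between
`2 * j - 8` and `2 * j - 6`. -/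
def Isolates (l : List (ℤ × ℤ)) (m j : ℤ) : Prop :=
  wrAt l (m - 1) * wrAt l (m + 1) < 0 ∧
    (PosAt (comb l 1 (8 - 2 * j)) m ∧ PosAt (comb l (-1) (2 * j - 6)) m ∨
      PosAt (comb l (-1) (2 * j - 8)) m ∧ PosAt (comb l 1 (6 - 2 * j)) m)

instance (l : List (ℤ × ℤ)) (m j : ℤ) : Decidable (Isolates l m j) := by
  unfold Isolates; infer_instance

theorem eval_comb (l : List (ℤ × ℤ)) (a b : ℤ) (r : ℝ) : (ofList (comb l a b)).eval r =
    a * (ofList (l.map Prod.fst)).eval r + b * (ofList (l.map Prod.snd)).eval r := by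
  rw [comb, ofList_map]; simp

theorem eval_wr_ofList (l : List (ℤ × ℤ)) (m : ℤ) :
    (wr (ofList (l.map Prod.fst)) (ofList (l.map Prod.snd))).eval (m : ℝ) = wrAt l m := by
  rw [wr, eval_sub, eval_mul, eval_mul, eval_ofList_int, eval_ofList_int, eval_derivative_ofList,
    eval_derivative_ofList, wrAt]
  push_cast; ring

theorem Isolates.exists {l : List (ℤ × ℤ)} {m j : ℤ} (h : Isolates l m j) :
    ∃ r y : ℝ, |r - m| ≤ 1 ∧ 2 * j - 8 < y ∧ y < 2 * j - 6 ∧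
      (ofList (l.map Prod.fst)).eval r = y * (ofList (l.map Prod.snd)).eval r ∧
      (derivative (ofList (l.map Prod.fst))).eval r =
        y * (derivative (ofList (l.map Prod.snd))).eval r := by
  set p := ofList (l.map Prod.fst)
  set q := ofList (l.map Prod.snd)
  obtain ⟨r, hr, h0⟩ : ∃ r : ℝ, |r - m| ≤ 1 ∧ (wr p q).eval r = 0 := by
    have h1 : (wr p q).eval ((m : ℝ) - 1) * (wr p q).eval ((m : ℝ) + 1) < 0 := by
      have h2 := eval_wr_ofList l (m - 1)
      have h3 := eval_wr_ofList l (m + 1)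
      push_cast at h2 h3
      rw [h2, h3]; exact_mod_cast h.1
    have hc : ContinuousOn (fun r => (wr p q).eval r) (Set.Icc ((m : ℝ) - 1) (m + 1)) :=
      (wr p q).continuous.continuousOn
    have hle : (m : ℝ) - 1 ≤ m + 1 := by linarith
    rcases mul_neg_iff.1 h1 with ⟨ha, hb⟩ | ⟨ha, hb⟩
    · obtain ⟨r, hr, h0⟩ := intermediate_value_Icc' hle hc ⟨hb.le, ha.le⟩
      exact ⟨r, abs_le.2 ⟨by linarith [hr.1], by linarith [hr.2]⟩, h0⟩
    · obtain ⟨r, hr, h0⟩ := intermediate_value_Icc hle hc ⟨ha.le, hb.le⟩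
      exact ⟨r, abs_le.2 ⟨by linarith [hr.1], by linarith [hr.2]⟩, h0⟩
  rw [wr, eval_sub, eval_mul, eval_mul] at h0
  have main : q.eval r ≠ 0 ∧ 2 * j - 8 < p.eval r / q.eval r ∧
      p.eval r / q.eval r < 2 * j - 6 := by
    rcases h.2 with ⟨ha, hb⟩ | ⟨ha, hb⟩
    all_goals
      have ha := ha.eval_pos hr
      have hb := hb.eval_pos hr
      rw [eval_comb] at ha hb
      push_cast at ha hb
      change 0 < _ * p.eval r + _ * q.eval r at ha
      change 0 < _ * p.eval r + _ * q.eval r at hb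
    · have hq : 0 < q.eval r := by linarith
      exact ⟨hq.ne', by rw [lt_div_iff₀ hq]; linarith, by rw [div_lt_iff₀ hq]; linarith⟩
    · have hq : q.eval r < 0 := by linarith
      exact ⟨hq.ne, by rw [lt_div_iff_of_neg hq]; linarith, by rw [div_lt_iff_of_neg hq]; linarith⟩
  obtain ⟨hq, h1, h2⟩ := main
  refine ⟨r, _, hr, h1, h2, by field_simp, ?_⟩
  field_simp
  linarith

/-- A certificate for a function with critical points near the integers `m j`. -/
structure Certifies (l : List (ℤ × ℤ)) (m : Fin 8 → ℤ) : Prop where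
  length : l.length = 6
  fst_pos : 0 < (l.map Prod.fst).getD 5 0
  snd_eq : (l.map Prod.snd).getD 5 0 = 0
  snd_pos : 0 < (l.map Prod.snd).getD 4 0
  isolates : ∀ j, Isolates l (m j) j.val
  sep : ∀ i j, i = j ∨ m i + 2 < m j ∨ m j + 2 < m i

theorem natDegree_ofList {l : List ℤ} {n : ℕ} (hl : l.length ≤ n + 1) (h : l.getD n 0 ≠ 0) :
    (ofList l).natDegree = n := by
  refine natDegree_eq_of_le_of_coeff_ne_zero ?_ (by rw [coeff_ofList]; exact_mod_cast h)
  refine natDegree_le_iff_coeff_eq_zero.2 fun k hk => ?_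
  rw [coeff_ofList, List.getD_eq_default _ _ (by omega)]; simp

theorem Certifies.exists_realized {l : List (ℤ × ℤ)} {m : Fin 8 → ℤ} (h : Certifies l m)
    (hc : StrictMono c) : ∃ w, Realized w (fun j => m j) c := by
  choose x y hx hy1 hy2 hval hder using fun j => (h.isolates j).exists
  set p := ofList (l.map Prod.fst) with hp
  set q := ofList (l.map Prod.snd) with hq
  have hy : StrictMono y := by
    intro i j hij
    have h1 : ((i.val : ℤ) : ℝ) + 1 ≤ ((j.val : ℤ) : ℝ) := by exact_mod_cast hij
    linarith [hy2 i, hy1 j]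
  have hlt : ∀ i j, m i < m j → x i < x j := by
    intro i j hij
    have h1 : m i + 2 < m j := by
      rcases h.sep i j with rfl | h | h <;> omega
    have h2 : (m i : ℝ) + 2 < m j := by exact_mod_cast h1
    linarith [(abs_le.1 (hx i)).2, (abs_le.1 (hx j)).1]
  have hne : ∀ i j, i ≠ j → m i ≠ m j := fun i j hij => by
    rcases h.sep i j with h | h | h
    · exact absurd h hij
    all_goals omega
  have hord : ∀ i j, x i < x j ↔ m i < m j := by
    refine fun i j => ⟨fun hij => ?_, hlt i j⟩
    by_contra hcon
    rcases (not_lt.1 hcon).lt_or_eq with h1 | h1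
    · exact lt_asymm hij (hlt _ _ h1)
    · refine hij.ne (congrArg x ?_)
      by_contra h2
      exact hne _ _ h2 h1.symm
  have hxi : Function.Injective x := by
    intro i j hij
    by_contra h1
    rcases (hne i j h1).lt_or_gt with h2 | h2
    · exact (hlt _ _ h2).ne hij
    · exact (hlt _ _ h2).ne hij.symm
  have hdp : p.natDegree = 5 := natDegree_ofList (by simp [h.length]) h.fst_pos.ne'
  have hdq : q.natDegree = 4 := by
    refine natDegree_eq_of_le_of_coeff_ne_zero ?_ ?_
    · refine natDegree_le_iff_coeff_eq_zero.2 fun k hk => ?_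
      rw [hq, coeff_ofList]
      rcases eq_or_ne k 5 with rfl | h5
      · rw [h.snd_eq]; simp
      · rw [List.getD_eq_default _ _ (by simp [h.length]; omega)]; simp
    · rw [hq, coeff_ofList]; exact_mod_cast h.snd_pos.ne'
  have hlp : 0 < p.leadingCoeff := by
    rw [leadingCoeff, hdp, hp, coeff_ofList]; exact_mod_cast h.fst_pos
  have hlq : 0 < q.leadingCoeff := by
    rw [leadingCoeff, hdq, hq, coeff_ofList]; exact_mod_cast h.snd_pos
  have hli := inv_pos.2 hlp
  have hg : Good (C p.leadingCoeff⁻¹ * p) (C p.leadingCoeff⁻¹ * q) y x := by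
    refine Good.of_contact ?_ ?_ ?_ ?_ hxi (fun j => ?_) fun j => ?_
    · rw [Monic, leadingCoeff_mul, leadingCoeff_C, inv_mul_cancel₀ hlp.ne']
    · rw [natDegree_C_mul hli.ne', hdp]
    · rw [natDegree_C_mul hli.ne', hdq]
    · rw [leadingCoeff_mul, leadingCoeff_C]; positivity
    · rw [eval_mul, eval_mul, hval]; ring
    · rw [derivative_C_mul, derivative_C_mul, eval_mul, eval_mul, hder]; ring
  obtain ⟨X, hs⟩ := hg.exists_sheets
  obtain ⟨w, hw⟩ := exists_isMon hg hy hs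
  have hr : Realized w (fun j => m j) y := ⟨_, _, x, X, hg, hs, hw, fun a b => by
    rw [hord]; exact Int.cast_lt.symm⟩
  exact ⟨w, hr.transport hy hc⟩

end

section

variable {w v : Fin 8 → Equiv.Perm (Fin 5)}

/-- A cyclic permutation of four elements. -/
def cyc : Equiv.Perm (Fin 5) :=
  Equiv.swap 0 1 * Equiv.swap 1 2 * Equiv.swap 2 3

/-- Representatives of the conjugacy classes of permutations with trivial fourth power. -/
def reps : List (Equiv.Perm (Fin 5)) :=
  [1, Equiv.swap 0 1, Equiv.swap 0 1 * Equiv.swap 2 3, cyc]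

theorem exists_conj_mem_reps : ∀ ρ : Equiv.Perm (Fin 5), ρ * ρ * (ρ * ρ) = 1 →
    ∃ σ : Equiv.Perm (Fin 5), σ⁻¹ * ρ * σ ∈ reps := by
  decide +kernel

theorem exists_dec : ∀ τ : Equiv.Perm (Fin 5), τ * τ = 1 → ∃ s < 26, ∀ i, dec s i = τ i := by
  decide +kernel

/-- `t` is the conjugate of `s` by `g`. -/
def ConjCode (g : Equiv.Perm (Fin 5)) (s t : ℕ) : Prop :=
  ∀ i, dec t (g i) = g (dec s i)

instance (g : Equiv.Perm (Fin 5)) (s t : ℕ) : Decidable (ConjCode g s t) := by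
  unfold ConjCode; infer_instance

theorem conj_codes : ∀ g ∈ reps, ∀ s < 26, ∀ t₁ ∈ nbr s, ∀ t₂ ∈ nbr t₁, ConjCode g s t₂ →
    ∀ t₃ ∈ nbr t₂, ConjCode g t₁ t₃ → ∀ t₄ ∈ nbr t₃, ConjCode g t₂ t₄ →
    ∀ t₅ ∈ nbr t₄, ConjCode g t₃ t₅ → ∀ t₆ ∈ nbr t₅, ConjCode g t₄ t₆ →
    ∀ t₇ ∈ nbr t₆, ConjCode g t₅ t₇ →
    blocks (joins (jn s 0) [t₁, t₂, t₃, t₄, t₅, t₆, t₇]) ≤ 1 → g = cyc ∧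
      ∃ n : Fin 4, ((∀ i, dec s i = i) ∧
          ∀ i, dec t₁ ((cyc ^ n.val) i) = (cyc ^ n.val) (Equiv.swap 0 4 i)) ∨
        ((∀ i, dec t₁ i = i) ∧
          ∀ i, dec s ((cyc ^ n.val) i) = (cyc ^ n.val) (Equiv.swap 0 4 i)) := by
  decide +kernel

/-- The walks generated by a star of four transpositions permuted cyclically. -/
structure Star (b : Bool) (u : Fin 8 → Equiv.Perm (Fin 5)) : Prop where
  step : ∀ k, u (k + 2) = cyc * u k * cyc⁻¹
  zero : u 0 = if b then 1 else Equiv.swap 0 4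
  one : u 1 = if b then Equiv.swap 0 4 else 1

theorem Star.unique {b : Bool} (hw : Star b w) (hv : Star b v) : w = v := by
  have h0 : w 0 = v 0 := by rw [hw.zero, hv.zero]
  have h1 : w 1 = v 1 := by rw [hw.one, hv.one]
  have hs : ∀ k, w k = v k → w (k + 2) = v (k + 2) := fun k h => by rw [hw.step, hv.step, h]
  have h2 := hs _ h0
  have h3 := hs _ h1
  have h4 := hs _ h2
  have h5 := hs _ h3
  have h6 := hs _ h4
  have h7 := hs _ h5
  funext k
  fin_cases k
  exacts [h0, h1, h2, h3, h4, h5, h6, h7]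

/-- A transitive walk that is conjugate to its shift by two steps is conjugate to one of two
walks. -/
theorem Walk.exists_star (hw : Walk w) (ht : Transitive w)
    (h : ConjWalk w fun k => w (k - 2)) : ∃ b u, ConjWalk w u ∧ Star b u := by
  obtain ⟨ρ, hρ⟩ := h
  have hρ : ∀ k, w (k + 2) = ρ * w k * ρ⁻¹ := fun k => by
    have := hρ (k + 2)
    dsimp only at this
    rw [add_sub_cancel_right] at this
    rw [this]; group
  have h4 : ρ * ρ * (ρ * ρ) = 1 := ht.eq_one hw fun k => by
    have h8 : k + 2 + 2 + 2 + 2 = k := by revert k; decide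
    have := congrArg w h8
    rw [hρ, hρ, hρ, hρ] at this
    nth_rw 2 [← this]
    group
  obtain ⟨σ, hσ⟩ := exists_conj_mem_reps ρ h4
  set g := σ⁻¹ * ρ * σ with hg
  set v : Fin 8 → Equiv.Perm (Fin 5) := fun k => σ⁻¹ * w k * σ with hv
  have hvw : Walk v := hw.conj σ
  have hvs : ∀ k, v (k + 2) = g * v k * g⁻¹ := fun k => by
    simp only [hv, hg, hρ]; group
  obtain ⟨s, hs, hs0⟩ := exists_dec (v 0) (hvw.inv 0)
  obtain ⟨t₁, t₂, t₃, t₄, t₅, t₆, t₇, ⟨n₁, n₂, n₃, n₄, n₅, n₆, n₇, -⟩, -, hb, hall⟩ :=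
    hvw.exists_codes (ht.conj σ) hs hs0
  have hc : ∀ k i, v (k + 2) (g i) = g (v k i) := fun k i => by rw [hvs]; simp
  have h1 : ∀ i, dec t₁ i = v 1 i := hall 1
  have h2 : ∀ i, dec t₂ i = v 2 i := hall 2
  have h3 : ∀ i, dec t₃ i = v 3 i := hall 3
  have h4 : ∀ i, dec t₄ i = v 4 i := hall 4
  have h5 : ∀ i, dec t₅ i = v 5 i := hall 5
  have h6 : ∀ i, dec t₆ i = v 6 i := hall 6
  have h7 : ∀ i, dec t₇ i = v 7 i := hall 7
  obtain ⟨hgc, n, hn⟩ := conj_codes g hσ s hs t₁ n₁ t₂ n₂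
    (fun i => by rw [h2, hs0]; exact hc 0 i) t₃ n₃ (fun i => by rw [h3, h1]; exact hc 1 i) t₄ n₄
    (fun i => by rw [h4, h2]; exact hc 2 i) t₅ n₅ (fun i => by rw [h5, h3]; exact hc 3 i) t₆ n₆
    (fun i => by rw [h6, h4]; exact hc 4 i) t₇ n₇ (fun i => by rw [h7, h5]; exact hc 5 i) hb
  simp only [hs0, h1] at hn
  generalize hm : cyc ^ n.val = m at hn
  have hmc : m * cyc = cyc * m := by rw [← hm, ← pow_succ, ← pow_succ']
  have hu : ∀ k, m⁻¹ * v (k + 2) * m = cyc * (m⁻¹ * v k * m) * cyc⁻¹ := fun k => by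
    have hmi : m⁻¹ * cyc = cyc * m⁻¹ := by
      rw [inv_mul_eq_iff_eq_mul, ← mul_assoc, hmc, mul_assoc, mul_inv_cancel, mul_one]
    have hmi2 : cyc⁻¹ * m = m * cyc⁻¹ := by
      rw [inv_mul_eq_iff_eq_mul, ← mul_assoc, ← hmc, mul_assoc, mul_inv_cancel, mul_one]
    rw [hvs, hgc]
    calc m⁻¹ * (cyc * v k * cyc⁻¹) * m = m⁻¹ * cyc * v k * (cyc⁻¹ * m) := by group
      _ = _ := by rw [hmi, hmi2]; group
  have hcw : ConjWalk w fun k => m⁻¹ * v k * m := ⟨σ * m, fun k => by simp only [hv]; group⟩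
  have hone : ∀ τ : Equiv.Perm (Fin 5), (∀ i, τ i = i) → m⁻¹ * τ * m = 1 := fun τ hτ => by
    rw [show τ = 1 from Equiv.ext hτ]; group
  have hsw : ∀ τ : Equiv.Perm (Fin 5), (∀ i, τ (m i) = m (Equiv.swap 0 4 i)) →
      m⁻¹ * τ * m = Equiv.swap 0 4 := fun τ hτ => by
    rw [mul_assoc, inv_mul_eq_iff_eq_mul]; exact Equiv.ext hτ
  rcases hn with ⟨ha, hb⟩ | ⟨ha, hb⟩
  · exact ⟨true, _, hcw, hu, hone _ ha, hsw _ hb⟩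
  · exact ⟨false, _, hcw, hu, hsw _ hb, hone _ ha⟩

end

section

variable {c x₀ : Fin 8 → ℝ} {w : Fin 8 → Equiv.Perm (Fin 5)}

set_option maxHeartbeats 2000000 in
/-- Pairs of polynomials, given by their coefficients, with approximate positions of the critical
points, in the order of the critical values. -/
def samples : List (List (ℤ × ℤ) × List ℤ) := [
  ([(12073662802853310, 8387294496126355), (89421591039580, 45067246797136), (235785382551,
    68108852475), (203441683, 26375557), (-48161, 16587), (1, 0)], [-2638, -16384, -593, 16384,
    -207, 1010, -374, -378]),
  ([(71867924544, -69116317925), (-3877333236, 4298126208), (74465349, -67461763), (-766128,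
    -7328), (-161, 333), (4, 0)], [-512, -427, 28, -11, 77, 343, 34, 512]),
  ([(0, -147727370), (-362294900, 0), (0, -25038908), (-435759, 0), (0, 225), (4, 0)], [-362,
    -305, -2, -28, 28, 2, 305, 362]),
  ([(-133573841098901552, 44525648428170064), (135821491453301, 1985398060593), (354785738241,
    -116156845920), (-373403897, -2593784), (-236051, 75763), (256, 0)], [-1024, -726, -854,
    726, 1024, 897, -864, 890]),
  ([(-2679450823585988, -9877030915633), (-3013994740009, -44572418921625), (-182213770298,
    -48748962552), (-199189497, 54349113), (234030, 59463), (256, 0)], [-920, -1024, -787, -121,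
    120, 787, 1024, -907]),
  ([(153882635027352128, -98804371254980240), (-699300261495137, 306560600394328),
    (938789206178, -106987877509), (308864642, -419628290), (-1676061, 335554), (1024, 0)],
    [678, -1024, -680, 364, 704, 1024, 709, 727]),
  ([(0, 30661328510), (952523778, 0), (0, -13589938), (-498969, 0), (0, 1515), (64, 0)], [-70,
    -91, 65, -42, 42, -65, 91, 70]),
  ([(708941445763045632, 1360718746334372), (-860479582728600, 83613809573072), (-65019846612,
    -93268674874), (278118612, -20476094), (-35286, 32792), (4, 0)], [-1602, -1998, -8192, 1212,
    8192, 1217, 1302, 1118]),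
  ([(61018138359373, -87689388190), (-745871977833, 612676583900), (7202291873, -1320831567),
    (-9791347, -2879807), (-35893, 6211), (64, 0)], [-512, -410, -99, 460, 100, 410, 512, 467]),
  ([(-21521418541374, -17097114508801), (-410338458393, -250775179592), (-2719595865,
    -880775024), (-5795504, 580665), (6507, 2135), (16, 0)], [-139, -724, -588, -206, -70, -130,
    589, 724]),
  ([(1803964359238, -1771449315861), (-42966790227, 38567885096), (371368197, -201870239),
    (-1192626, -142601), (-1460, 565), (4, 0)], [-724, 87, -437, 16, 167, 578, 724, 94]),
  ([(-131847756224581, 21679927545272), (3929783200941, -837710470241), (-34155939281,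
    7835122113), (72022098, -2525762), (3595, 4208), (1, 0)], [-896, -78, -8192, 150, 70, 64,
    8192, 1890]),
  ([(2679450823585107, -9877030913256), (-3013994739989, 44572418921611), (182213770298,
    -48748962552), (-199189497, -54349113), (-234030, 59463), (256, 0)], [907, -1024, -787,
    -120, 121, 787, 1024, 920]),
  ([(21521418541335, -17097114508771), (-410338458393, 250775179591), (2719595865, -880775024),
    (-5795504, -580665), (-6507, 2135), (16, 0)], [-724, -589, 130, 70, 206, 588, 724, 139]),
  ([(-382025667145806208, -127290532699020640), (-1799929719201181, -408794348950835),
    (-1827424378666, 4322946829), (3315851961, 1067880154), (7674725, 857327), (4096, 0)],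
    [-621, -629, -633, -724, -514, -608, 513, 724]),
  ([(-99559689, -38609658), (-35685335, -4388108), (-2413858, -46362), (76053, -9426), (-294,
    258), (1, 0)], [-24, -10, -256, -6, 256, 57, 42, 15]),
  ([(0, -2067809086), (-6031607678, 0), (0, -176826060), (-1287411, 0), (0, 495), (4, 0)],
    [-724, -3, -471, -68, 68, 471, 3, 724]),
  ([(6495867176, -1177308362), (-444914040, 43495003), (3122487, -397829), (149292, 6468), (517,
    246), (1, 0)], [-19, -70, -95, -362, 26, 30, 362, 76]),
  ([(-322094124481781, 160704316983886), (835053459913, 25834317997), (4839553400, -2342017784),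
    (-14809763, -178238), (-18454, 8546), (64, 0)], [-512, 364, -235, 237, -353, 512, -358,
    387]),
  ([(11146452177912604, 1988659111234898), (92412942378053, 12311771511204), (249765185779,
    28015350937), (196139568, 37204763), (-64504, 32819), (1, 0)], [-1005, -478, -16384, 16384,
    -312, -364, -369, 262]),
  ([(0, -2502353815), (-11478922590, 0), (0, -269341997), (-1557093, 0), (0, 657), (4, 0)], [-3,
    -724, -556, -85, 85, 556, 724, 3]),
  ([(-269483912413508304896, 133376696464500768768), (115190445452033664, -13969276821119450),
    (10692098214679, -12366830132709), (-10295867130, 685742299), (142330, 307540), (256, 0)],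
    [-5793, -4541, 3724, 2272, -5126, -5131, 5793, 4344]),
  ([(-292512822983559168, 53775676962756344), (1157965912000517, -192421734206668),
    (-1480372943877, 195499121779), (619675095, -54416304), (-25791, 23458), (1, 0)], [-1428,
    293, -23170, 838, 23170, 3730, 605, 601]),
  ([(-8041315203832337, 8058217591227032), (36004759925764, 259104423446), (42641688502,
    -41559026886), (-192133538, -690469), (-56809, 53598), (256, 0)], [-629, -724, -515, -610,
    513, 724, 635, 631]),
  ([(-111838246170105, 244818181437741), (1821706441914, -166318172246), (-360135290,
    -2746083576), (-21224253, 955397), (6135, 7890), (64, 0)], [-456, -512, -386, 373, 268,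
    -449, 512, 407]),
  ([(-305683846925324992, 405192197031561920), (322470514380162, 327563761205315),
    (1524361016824, -733064925416), (-1005568163, -319552370), (-1489030, 391243), (1024, 0)],
    [-1448, 1227, 1224, -290, 1035, 1448, -776, -786]),
  ([(111838246170104, 244818181437743), (1821706441914, 166318172246), (360135290, -2746083576),
    (-21224253, -955397), (-6135, 7890), (64, 0)], [-407, -512, 449, -268, -373, 386, 512, 456]),
  ([(70179646758381, 45191126159614), (369134945551, 52897589684), (-1132208255, -1144742767),
    (-9574488, -666825), (2952, 7411), (64, 0)], [-268, -274, -362, 300, -128, 241, 362, 308]),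
  ([(-16742707249360252928, -32150467452055904), (-2809777220241126, -2019072312358354),
    (10560451146320, -562031598065), (2986193162, 1249743188), (-372171, 524675), (64, 0)],
    [-1602, -1998, -8192, -1794, 8192, -1790, 1302, 1118]),
  ([(-622165671318974, 1377079531489791), (7211010489072, -559662283844), (-524626443,
    -7772537621), (-42501873, 1601479), (6952, 11143), (64, 0)], [549, -724, -546, -622, 377,
    -627, 724, 582]),
  ([(1, 389576902245392), (1604102787114, 0), (0, -4576714601), (-20382768, 0), (0, 13426), (64,
    0)], [-418, -422, -512, -299, 299, 512, 422, 418]),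
  ([(159201082948992448, 44787570624387792), (115819290766951, 12561499358028), (-217287199676,
    -72126088467), (-170356054, -10104608), (72326, 29635), (64, 0)], [-1057, 1192, -1090,
    -1448, 1186, -511, 963, 1448]),
  ([(2556942964358528512, 1277628496723851008), (2678168124904264, -10278867837797),
    (-1571204829904, -774261474855), (-1656242321, 3078983), (241490, 117322), (256, 0)], [1806,
    -1843, -2048, -1590, 1798, -1811, 1588, 2048]),
  ([(-159201082948990912, 44787570624387408), (115819290766952, -12561499358028), (217287199676,
    -72126088467), (-170356054, 10104608), (-72326, 29635), (64, 0)], [-1448, -963, 511, -1186,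
    1448, 1090, -1192, 1057]),
  ([(-349512448806983, 349392792204761), (2235775710590, -12216683621), (3561542972,
    -3638163202), (-23928924, 64093), (-9044, 9475), (64, 0)], [-446, -512, -363, 430, 364, 512,
    -438, 440]),
  ([(-136370747055940336, 68225202295458656), (98451198761018, 405690797436), (204084546297,
    -101810421056), (-159360053, -331904), (-76504, 37989), (64, 0)], [-1181, -1448, -846, 844,
    1448, -1145, 1175, 1171]),
  ([(-842078750039434240, 259119478905832480), (2823131300772012, -487687494446979),
    (-3009865356869, 299184698676), (1001383604, -99684568), (29924, 32953), (1, 0)], [-1718,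
    1124, 1119, -32768, 946, 32768, 1392, 3188]),
  ([(-48765693903344696, 24392966458075240), (98661660093635, 858431811878), (582507681211,
    -289615330638), (-1277315795, -5355963), (-1744219, 859614), (4096, 0)], [-418, -512, -299,
    298, 512, 421, -406, 416]),
  ([(-7978475285253988, 7968319161316641), (35962912559329, -114503052348), (40860301174,
    -41325385186), (-191961572, 307282), (-52195, 53610), (256, 0)], [-631, -724, -514, 610,
    515, 724, 629, -620]),
  ([(-144768829717377056768, 144769501036699631616), (189745757821796512, -124418112587315),
    (20898005434441, -21061062817768), (-27878221475, 8984561), (-753939, 765953), (1024, 0)],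
    [-4096, -3346, 3691, 3686, -3697, 3346, 4096, -3704]),
  ([(-547824478104543936, 906045197667383040), (2056394455870208, 129555136032801),
    (733976525414, -600997128562), (-1436557989, -43219685), (-189350, 101156), (256, 0)],
    [-2048, 1835, -1255, 1830, -1593, 1648, 2048, -1610]),
  ([(2320353886077756416, 5189961660749335552), (6907846515233303, 766592308704925),
    (407919960819, -1896036722357), (-2597067631, -141415440), (-167971, 178090), (256, 0)],
    [2523, -2896, 2518, -1499, -2040, 2185, 2896, -2098]),
  ([(250260869654263103488, 250203241534632067072), (141390443929237808, 541511712220403),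
    (-20411150769109, -20711514600938), (-12032895582, -22192002), (415371, 428554), (256, 0)],
    [4909, 4905, -5793, -4108, -4830, 4106, 5793, -4879]),
  ([(68901769176007624, 154395010979520832), (215908574049166, -66067229513486), (-288798718436,
    -263715252552), (-452226647, 57698885), (222263, 118507), (256, 0)], [930, 924, -1448, -963,
    510, -1185, 1448, -1190]),
  ([(1129, 508084936406485632), (369871665313109, 0), (0, -196460664370), (-154099564, 0), (0,
    18986), (16, 0)], [2258, 2253, -2896, -1688, 1688, 2896, -2253, -2258]),
  ([(-1466570, 32585948819299266560), (50828036996404576, 190), (1, -4592751297832),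
    (-7214411370, 0), (0, 161822), (256, 0)], [-4096, -3463, 3758, -3751, 3751, -3758, 3463,
    4096]),
  ([(285256644579400, 1435025853511848704), (3165452785219762, 1172017856221), (2509754920,
    -405236992259), (-900192882, -164856), (-364, 28607), (64, 0)], [-2896, -2449, -2641, 2655,
    2651, -2654, 2449, 2896]),
  ([(17878189993837694, 4065965893557204), (122629362265637, 22555486377162), (265401874226,
    44966708057), (138045889, 47966083), (-93463, 33095), (4, 0)], [-1409, -8192, -505, 8192,
    -369, -420, 229, -425]),
  ([(177338776323614, 176346028089001), (1414847383514, -34349550273), (-2471462724,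
    -2175940820), (-19067379, 205633), (8709, 6722), (64, 0)], [-425, -512, 388, -300, 381, 298,
    -403, 512]),
  ([(0, 21830015595072), (144299411114, 0), (0, -371581175), (-3063398, 0), (0, 1569), (16, 0)],
    [-512, 331, 326, -203, 203, -326, -331, 512]),
  ([(13430, 1257878543320914688), (2657949393003012, -15), (0, -768236213814), (-1649798408, 0),
    (0, 117289), (256, 0)], [1804, -2048, -1588, 1798, -1798, 1588, 2048, -1804]),
  ([(-46041677989244, 56152705465132136), (167761704072314, 1145946156140), (3477051856,
    -68245949129), (-207238216, -691008), (-2147, 20738), (64, 0)], [1287, -1448, -1123, -1261,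
    -1266, 1124, 1448, 1305]),
  ([(-41050420206357880766464, 20524382895933438820352), (10910662572767055872,
    -34189257014719072), (1552140573052330, -785071439504345), (-422770325081, 646952554),
    (-14660423, 7506482), (4096, 0)], [-8192, -6352, 7163, 7131, 6353, 8192, -7232, -7235]),
  ([(0, 4767597), (1145062, 0), (0, -109251), (-30014, 0), (0, 227), (64, 0)], [-23, -19, -9,
    -5, 5, 9, 19, 23]),
  ([(0, 39276402101626), (663223182056, 0), (0, -1517975903), (-26057546, 0), (0, 14674), (256,
    0)], [-230, -256, -199, -225, 225, 199, 256, 230])]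

/-- The approximate critical points of the `n / 8`-th sample, with labels shifted by `n`. -/
def position (n : ℕ) (k : Fin 8) : ℤ :=
  (samples.getD (n / 8) ([], [])).2.getD (k - Fin.ofNat 8 n).val 0

theorem certifies_samples : ∀ s ∈ samples, Certifies s.1 fun j => s.2.getD j.val 0 := by
  have h : ∀ s ∈ samples, s.1.length = 6 ∧ 0 < (s.1.map Prod.fst).getD 5 0 ∧
      (s.1.map Prod.snd).getD 5 0 = 0 ∧ 0 < (s.1.map Prod.snd).getD 4 0 ∧
      (∀ j : Fin 8, Isolates s.1 (s.2.getD j.val 0) j.val) ∧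
      ∀ i j : Fin 8, i = j ∨ s.2.getD i.val 0 + 2 < s.2.getD j.val 0 ∨
        s.2.getD j.val 0 + 2 < s.2.getD i.val 0 := by
    decide +kernel
  intro s hs
  obtain ⟨h1, h2, h3, h4, h5, h6⟩ := h s hs
  exact ⟨h1, h2, h3, h4, h5, h6⟩

/-- The quadruples of labels whose separation tells the samples apart. -/
def quadruples : List (Fin 8 × Fin 8 × Fin 8 × Fin 8) := [
  (0, 1, 2, 3), (0, 1, 2, 4), (0, 1, 2, 5), (0, 1, 2, 6), (2, 7, 3, 6), (1, 5, 4, 7), (2, 4, 3,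
  5), (0, 5, 3, 6), (0, 3, 2, 5), (1, 6, 4, 7), (0, 6, 3, 7), (2, 6, 3, 5), (0, 4, 2, 6), (2, 4,
  6, 7), (0, 4, 5, 7)]

/-- A numerical invariant of configurations up to projective equivalence. -/
def keyOf (m : Fin 8 → ℤ) : ℕ :=
  quadruples.foldl (fun r t => 2 * r +
    if 0 < (m t.1 - m t.2.2.1) * (m t.2.1 - m t.2.2.1) * (m t.1 - m t.2.2.2) *
      (m t.2.1 - m t.2.2.2) then 1 else 0)
    (if 0 < ∏ l ∈ Finset.univ.erase 0, (m 0 - m l) then 1 else 0)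

theorem keyOf_eq {m m' : Fin 8 → ℤ} (h : SameKey (fun j => m j) fun j => m' j) :
    keyOf m = keyOf m' := by
  have h1 : ∀ a b e d, 0 < (m a - m e) * (m b - m e) * (m a - m d) * (m b - m d) ↔
      0 < (m' a - m' e) * (m' b - m' e) * (m' a - m' d) * (m' b - m' d) := fun a b e d => by
    have := h.1 a b e d
    beta_reduce at this
    exact_mod_cast this
  have h2 : 0 < ∏ l ∈ Finset.univ.erase 0, (m 0 - m l) ↔
      0 < ∏ l ∈ Finset.univ.erase 0, (m' 0 - m' l) := by
    have := h.2 0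
    beta_reduce at this
    exact_mod_cast this
  simp only [keyOf, h1, h2]

set_option maxRecDepth 4000 in
/-- The labelled samples, one for each key, in the order of their keys. -/
def indices : List ℕ := [
  21, 49, 433, 209, 308, 193, 191, 256, 67, 24, 219, 258, 273, 255, 342, 211, 347, 77, 368, 195,
  117, 153, 51, 339, 299, 285, 283, 239, 148, 29, 327, 121, 301, 366, 374, 224, 269, 350, 360,
  331, 264, 133, 365, 403, 250, 13, 262, 89, 276, 267, 27, 182, 248, 99, 61, 306, 80, 217, 244,
  274, 128, 188, 386, 70, 44, 411, 94, 222, 168, 356, 358, 165, 298, 85, 323, 362, 253, 289,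
  292, 199, 312, 109, 287, 81, 137, 141, 215, 105, 204, 62, 315, 370, 55, 144, 41, 45, 279, 316,
  335, 58, 293, 200, 303, 196, 39, 229, 259, 145, 179, 6, 126, 246, 173, 328, 416, 130, 324,
  378, 387, 236, 311, 400, 10, 320, 35, 186, 189, 2, 183, 332, 270, 216, 8, 64, 16, 207, 242,
  103, 95, 158, 240, 18, 149, 169, 305, 30, 178, 92, 424, 33, 318, 127, 74, 19, 159, 107, 52,
  140, 373, 409, 131, 392, 47, 155, 56, 395, 344, 163, 123, 75, 379, 226, 348, 97, 115, 167,
  237, 11, 202, 114, 101, 352, 212, 143, 161, 7, 79, 65, 83, 104, 119, 172, 233, 37, 354, 336,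
  340, 3, 418, 230, 282, 295, 5, 175, 151, 322, 252, 310, 278, 221, 394, 329, 111, 181, 87, 23,
  69, 401, 43, 314, 206, 325, 291, 60, 139, 54, 198, 146, 177, 385, 135, 15, 260, 266, 185, 26,
  91, 317, 294, 355, 364, 281, 275, 249, 297, 372, 288, 319, 367, 353, 147, 1, 171, 326, 261,
  214, 337, 345, 334, 402, 377, 330, 203, 34, 160, 227, 40, 72, 419, 284, 371, 241, 363, 235,
  359, 338, 346, 157, 228, 113, 25, 125, 73, 265, 351, 343, 96, 162, 154, 408, 106, 232, 82, 20,
  100, 205, 12, 59, 220, 124, 22, 28, 234, 46, 142, 116, 225, 296, 71, 120, 263, 152, 166, 238,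
  42, 138, 112, 38, 88, 218, 156, 280, 309, 210, 164, 190, 57, 9, 63, 84, 68, 93, 122, 375, 90,
  201, 272, 300, 257, 192, 223, 425, 98, 50, 307, 4, 376, 86, 369, 417, 14, 180, 277, 208, 17,
  170, 247, 150, 136, 197, 187, 176, 290, 333, 108, 78, 32, 432, 66, 243, 174, 110, 132, 36,
  245, 393, 76, 349, 134, 0, 231, 251, 357, 129, 361, 341, 302, 102, 321, 213, 304, 31, 48, 118,
  410, 268, 286, 254, 53, 194, 271, 384, 184, 313]

theorem length_indices : indices.length = 404 := by
  decide +kernel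

theorem indices_lt : ∀ n ∈ indices, n / 8 < samples.length := by
  decide +kernel

theorem isChain_indices : indices.IsChain fun n n' => keyOf (position n) < keyOf (position n') := by
  decide +kernel

theorem pairwise_indices :
    indices.Pairwise fun n n' => keyOf (position n) < keyOf (position n') :=
  haveI : Trans (fun n n' => keyOf (position n) < keyOf (position n'))
    (fun n n' => keyOf (position n) < keyOf (position n'))
    fun n n' => keyOf (position n) < keyOf (position n') := ⟨lt_trans⟩
  isChain_indices.pairwise

theorem nodup_indices : indices.Nodup :=
  pairwise_indices.imp fun h => by rintro rfl; exact lt_irrefl _ h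

theorem eq_of_sameKey {n n' : ℕ} (hn : n ∈ indices) (hn' : n' ∈ indices)
    (h : SameKey (fun j => position n j) fun j => position n' j) : n = n' := by
  by_contra hne
  have hp : indices.Pairwise fun n n' => keyOf (position n) ≠ keyOf (position n') :=
    pairwise_indices.imp fun h => h.ne
  have : Std.Symm fun n n' => keyOf (position n) ≠ keyOf (position n') := ⟨fun _ _ h => h.symm⟩
  exact hp.forall hn hn' hne (keyOf_eq h)

/-- The samples with labels that can be rotated by two steps. -/
def symmetricIndices : List ℕ := [424, 425, 432, 433]

theorem symmetricIndices_subset : symmetricIndices ⊆ indices := by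
  decide +kernel

theorem sameKey_symmetric {n : ℕ} (hn : n ∈ symmetricIndices) :
    SameKey (fun j => position n (j - 2)) fun j => position n j := by
  have h : ∀ s ∈ samples.drop 53, (∀ a b e d : Fin 8,
      0 < (s.2.getD (a - 2).val 0 - s.2.getD (e - 2).val 0) *
        (s.2.getD (b - 2).val 0 - s.2.getD (e - 2).val 0) *
        (s.2.getD (a - 2).val 0 - s.2.getD (d - 2).val 0) *
        (s.2.getD (b - 2).val 0 - s.2.getD (d - 2).val 0) ↔
      0 < (s.2.getD a.val 0 - s.2.getD e.val 0) * (s.2.getD b.val 0 - s.2.getD e.val 0) *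
        (s.2.getD a.val 0 - s.2.getD d.val 0) * (s.2.getD b.val 0 - s.2.getD d.val 0)) ∧
      ∀ j : Fin 8, 0 < ∏ l ∈ Finset.univ.erase j,
          (s.2.getD (j - 2).val 0 - s.2.getD (l - 2).val 0) ↔
        0 < ∏ l ∈ Finset.univ.erase j, (s.2.getD j.val 0 - s.2.getD l.val 0) := by
    decide +kernel
  have hs : ∀ n ∈ symmetricIndices, samples.getD (n / 8) ([], []) ∈ samples.drop 53 := by
    decide +kernel
  obtain ⟨h1, h2⟩ := h _ (hs n hn)
  have h3 : SameKey
      (fun j => ((samples.getD (n / 8) ([], [])).2.getD (j - 2 : Fin 8).val 0 : ℤ))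
      fun j => ((samples.getD (n / 8) ([], [])).2.getD j.val 0 : ℤ) := by
    refine ⟨fun a b e d => ?_, fun j => ?_⟩
    · have := h1 a b e d
      beta_reduce
      exact_mod_cast this
    · have := h2 j
      beta_reduce
      exact_mod_cast this
  have h4 := h3.perm (Equiv.subRight (Fin.ofNat 8 n))
  refine (congrArg (SameKey · _) (funext fun j => ?_)).mp h4
  simp only [Function.comp, Equiv.subRight_apply, position, sub_right_comm]

theorem Realized.exists_iterate_shift (hc : StrictMono c) (h : Realized w x₀ c) (n : ℕ) :
    ∃ x₁, SameKey (fun k => x₀ (k - Fin.ofNat 8 n)) x₁ ∧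
      Realized (fun k => w (k - Fin.ofNat 8 n)) x₁ c := by
  induction n with
  | zero => exact ⟨x₀, by simpa using sameKey_of_order fun _ _ => Iff.rfl, by simpa using h⟩
  | succ n ih =>
    obtain ⟨x₁, h1, h2⟩ := ih
    obtain ⟨x₂, h3, h4⟩ := h2.exists_shift hc
    have he : ∀ k : Fin 8, k - Fin.ofNat 8 (n + 1) = k - 1 - Fin.ofNat 8 n := fun k => by
      have : Fin.ofNat 8 (n + 1) = Fin.ofNat 8 n + 1 := by ext; simp [Fin.val_add]
      rw [this]; abel
    simp only [he]
    exact ⟨x₂, (h1.perm (Equiv.subRight 1)).trans h3, h4⟩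

theorem exists_realized_position (hc : StrictMono c) {n : ℕ} (hn : n ∈ indices) :
    ∃ w x₁, Realized w x₁ c ∧ SameKey (fun j => position n j) x₁ := by
  have hlt := indices_lt n hn
  obtain ⟨w, hw⟩ := (certifies_samples _ (List.getElem_mem hlt)).exists_realized hc
  obtain ⟨x₁, h1, h2⟩ := hw.exists_iterate_shift hc n
  refine ⟨_, x₁, h2, ?_⟩
  simpa only [position, List.getD_eq_getElem _ _ hlt] using h1

end

section

variable {c x₀ x₁ : Fin 8 → ℝ} {w v : Fin 8 → Equiv.Perm (Fin 5)}

theorem ConjWalk.symm (h : ConjWalk w v) : ConjWalk v w := by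
  obtain ⟨ρ, h⟩ := h
  exact ⟨ρ⁻¹, fun k => by rw [h]; group⟩

/-- The conjugacy classes of the walks realized by functions with critical values `c`. -/
abbrev Classes (c : Fin 8 → ℝ) : Type :=
  Quot fun w v : {w // ∃ x₀, Realized w x₀ c} => ConjWalk w.1 v.1

theorem conjWalk_of_class_eq {h : ∃ x₀, Realized w x₀ c} {h' : ∃ x₀, Realized v x₀ c}
    (e : (Quot.mk _ ⟨w, h⟩ : Classes c) = Quot.mk _ ⟨v, h'⟩) : ConjWalk w v :=
  (conjWalk_equivalence c).eqvGen_iff.1 (Quot.eqvGen_exact e)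

/-- The class `Q` contains functions with critical points configured as in the `n`-th labelled
sample. -/
def HasKey (c : Fin 8 → ℝ) (n : ℕ) (Q : Classes c) : Prop :=
  ∃ w x₁, ∃ h : Realized w x₁ c, SameKey (fun j => position n j) x₁ ∧ Q = Quot.mk _ ⟨w, x₁, h⟩

theorem HasKey.unique (hc : StrictMono c) {n n' : ℕ} (hn : n ∈ indices) (hn' : n' ∈ indices)
    {Q : Classes c} (h : HasKey c n Q) (h' : HasKey c n' Q) : n = n' := by
  obtain ⟨w, x₁, hr, hk, rfl⟩ := h
  obtain ⟨v, x₂, hr', hk', he⟩ := h'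
  obtain ⟨ρ, hv⟩ := conjWalk_of_class_eq he
  exact eq_of_sameKey hn hn' (hk.trans ((hr.sameKey hc hr' hv).trans hk'.symm))

theorem exists_hasKey (hc : StrictMono c) {n : ℕ} (hn : n ∈ indices) : ∃ Q, HasKey c n Q := by
  obtain ⟨w, x₁, hr, hk⟩ := exists_realized_position hc hn
  exact ⟨_, w, x₁, hr, hk, rfl⟩

theorem HasKey.exists_rotate (hc : StrictMono c) {n : ℕ} (hn : n ∈ symmetricIndices)
    {Q : Classes c} (h : HasKey c n Q) : ∃ Q', HasKey c n Q' ∧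
      (Q' = Q → ∃ b u x₂, ∃ h : Realized u x₂ c, Star b u ∧ Q = Quot.mk _ ⟨u, x₂, h⟩) := by
  obtain ⟨w, x₁, hr, hk, rfl⟩ := h
  obtain ⟨x₂, h1, h2⟩ := hr.exists_iterate_shift hc 2
  refine ⟨_, ⟨_, x₂, h2, ?_, rfl⟩, fun he => ?_⟩
  · exact (sameKey_symmetric hn).symm.trans ((hk.perm (Equiv.subRight 2)).trans h1)
  · obtain ⟨b, u, hu, hs⟩ := (hr.walk hc).exists_star (hr.transitive hc)
      (conjWalk_of_class_eq he).symm
    obtain ⟨ρ, hρ⟩ := hu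
    have h3 : Realized u x₁ c := by
      rw [funext hρ]; exact hr.conj ρ
    exact ⟨b, u, x₁, h3, hs, Quot.sound ⟨ρ, hρ⟩⟩

/-- There are at least 406 classes: 404 of them are distinguished by their keys, and at least two
of the four symmetric keys belong to more than one class. -/
theorem le_card_classes (hc : StrictMono c) : 406 ≤ Nat.card (Classes c) := by
  classical
  have : Nonempty (Classes c) :=
    ⟨(exists_hasKey hc (symmetricIndices_subset (List.mem_cons_self ..))).choose⟩
  choose! f hf using fun n hn => exists_hasKey (c := c) hc (n := n) hn
  have hsub := symmetricIndices_subset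
  choose! g hg hs using fun n hn => (hf n (hsub hn)).exists_rotate hc hn
  set I : Finset ℕ := indices.toFinset
  set J : Finset ℕ := symmetricIndices.toFinset
  set B : Finset ℕ := J.filter fun n => g n = f n
  have hI : ∀ n ∈ I, n ∈ indices := fun n hn => List.mem_toFinset.1 hn
  have hJ : ∀ n ∈ J, n ∈ symmetricIndices := fun n hn => List.mem_toFinset.1 hn
  have hB : B.card ≤ 2 := by
    have hB' : ∀ n ∈ B, ∃ b u x₂, ∃ h : Realized u x₂ c, Star b u ∧ f n = Quot.mk _ ⟨u, x₂, h⟩ :=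
      fun n hn => hs n (hJ n (Finset.mem_filter.1 hn).1) (Finset.mem_filter.1 hn).2
    choose! b hb using hB'
    refine (Finset.card_le_card_of_injOn b (t := Finset.univ)
      (fun _ _ => Finset.mem_coe.2 (Finset.mem_univ _)) ?_).trans_eq (by simp)
    intro n hn n' hn' he
    have hn0 := hsub (hJ n (Finset.mem_filter.1 hn).1)
    have hn0' := hsub (hJ n' (Finset.mem_filter.1 hn').1)
    obtain ⟨u, x₂, h, hu, e⟩ := hb n hn
    obtain ⟨u', x₂', h', hu', e'⟩ := hb n' hn'
    rw [← he] at hu'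
    obtain rfl := hu.unique hu'
    refine HasKey.unique hc hn0 hn0' (hf n hn0) ?_
    rw [e, ← e']; exact hf n' hn0'
  have hIJ : ∀ n ∈ J \ B, n ∈ J ∧ g n ≠ f n := fun n hn => by
    obtain ⟨h1, h2⟩ := Finset.mem_sdiff.1 hn
    exact ⟨h1, fun h3 => h2 (Finset.mem_filter.2 ⟨h1, h3⟩)⟩
  have hfi : Set.InjOn f I := fun n hn n' hn' he =>
    HasKey.unique hc (hI n hn) (hI n' hn') (hf n (hI n hn)) (he ▸ hf n' (hI n' hn'))
  have hgi : Set.InjOn g (J \ B : Finset ℕ) := fun n hn n' hn' he => by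
    have h1 := hJ n (hIJ n hn).1
    have h2 := hJ n' (hIJ n' hn').1
    exact HasKey.unique hc (hsub h1) (hsub h2) (hg n h1) (he ▸ hg n' h2)
  have hd : Disjoint (I.image f) ((J \ B).image g) := by
    rw [Finset.disjoint_left]
    intro Q h1 h2
    obtain ⟨n, hn, rfl⟩ := Finset.mem_image.1 h1
    obtain ⟨n', hn', he⟩ := Finset.mem_image.1 h2
    have h3 := hJ n' (hIJ n' hn').1
    obtain rfl := HasKey.unique hc (hI n hn) (hsub h3) (hf n (hI n hn)) (he ▸ hg n' h3)
    exact (hIJ n hn').2 he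
  have hcard : I.card = 404 := by
    rw [List.toFinset_card_of_nodup nodup_indices, length_indices]
  have hcardJ : J.card = 4 := rfl
  have h2 : 2 ≤ (J \ B).card := by
    have := Finset.le_card_sdiff B J
    omega
  have h3 := Finset.card_union_of_disjoint hd
  rw [Finset.card_image_of_injOn hfi, Finset.card_image_of_injOn hgi] at h3
  have h4 : (I.image f ∪ (J \ B).image g).card ≤ Nat.card (Classes c) := by
    have := Fintype.ofFinite (Classes c)
    rw [Nat.card_eq_fintype_card]; exact Finset.card_le_univ _
  omega

end

theorem exists_strictMono_range {Cv : Set ℝ} {n : ℕ} (h : Cv.ncard = n) (hn : n ≠ 0) :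
    ∃ c : Fin n → ℝ, StrictMono c ∧ Set.range c = Cv := by
  have hfin := Set.finite_of_ncard_ne_zero (h ▸ hn)
  have hcard : hfin.toFinset.card = n := by rw [← Set.ncard_eq_toFinset_card Cv hfin, h]
  exact ⟨hfin.toFinset.orderEmbOfFin hcard, OrderEmbedding.strictMono _, by simp⟩

end MFun

/-- For every set `C` of `8` distinct real numbers, the number of real
Möbius-equivalence classes of generic degree-`5` real rational M-functions with
critical value set `C` equals `406`. -/
theorem count_real_rational_M_functions_degree_5
    (Cv : Set ℝ) (hC : Cv.ncard = 8) :
    Nat.card (Quot fun f g : {f : RatFunc ℝ // GenericDegR 5 Cv f} =>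
        MobiusEquiv f.1 g.1) = 406 := by
  obtain ⟨c, hc, rfl⟩ := MFun.exists_strictMono_range hC (by norm_num)
  rw [MFun.card_classes hc]
  refine le_antisymm ?_ (MFun.le_card_classes hc)
  have := (MFun.card_mul_le hc).trans MFun.card_walks_le
  omega
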